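/- Let w be a permutation in S∞ and φ a flag. The weak Edelman–Greene insertion map ρ^• ↦ (P̂(ρ^•), Q̂(ρ^•)) is a bijection from RFC(w,φ) onto the disjoint union, over all weak compositions α such that YR_α(w) is nonempty, of the sets YR_α(w) × SSKT(α,φ). -/

import Mathlib

noncomputable section
attribute [local instance] Classical.propDecidable

/-! ### Words, permutations, reduced words -/

/-- The adjacent transposition `s_i` exchanging `i` and `i+1`. -/
def sPerm (i : ℕ) : Equiv.Perm ℕ := Equiv.swap i (i + 1)

/-- The permutation `s_{i_1} ⋯ s_{i_n}` represented by the word `i_1 ⋯ i_n`. -/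
def wordPerm (ρ : List ℕ) : Equiv.Perm ℕ := (ρ.map sPerm).prod

/-- A word whose letters are positive integers. -/
def PosWord (ρ : List ℕ) : Prop := ∀ x ∈ ρ, 1 ≤ x

/-- A reduced word: a word of positive integers of minimal length among all words of
positive integers representing the same permutation. -/
def IsReducedWord (ρ : List ℕ) : Prop :=
  PosWord ρ ∧ ∀ σ : List ℕ, PosWord σ → wordPerm σ = wordPerm ρ → ρ.length ≤ σ.length

/-- `ρ` is a reduced word for the permutation `w`. -/
def IsReducedWordFor (w : Equiv.Perm ℕ) (ρ : List ℕ) : Prop :=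
  IsReducedWord ρ ∧ wordPerm ρ = w

/-- A member of `S∞`: a permutation of the positive integers (it fixes `0`)
fixing all but finitely many points. -/
def FinitaryPerm (w : Equiv.Perm ℕ) : Prop := w 0 = 0 ∧ {i : ℕ | w i ≠ i}.Finite

/-- A flag: a weakly increasing function `φ : ℤ_{>0} → ℤ_{>0}` with `φ(n) ≥ n`. -/
def IsFlag (φ : ℕ → ℕ) : Prop :=
  (∀ m n : ℕ, 1 ≤ m → m ≤ n → φ m ≤ φ n) ∧ ∀ n : ℕ, 1 ≤ n → n ≤ φ n

/-- A weak composition, as a function on the positive integers (value `0` at `0`)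
with finitely many nonzero entries. -/
def WeakComp (α : ℕ → ℕ) : Prop := α 0 = 0 ∧ {i : ℕ | α i ≠ 0}.Finite

/-- `φ - e_i`, i.e. `l ↦ φ(l) - δ_{il}`. -/
def subE (φ : ℕ → ℕ) (i : ℕ) : ℕ → ℕ := fun l => if l = i then φ l - 1 else φ l

/-- The right action of `s_i` on weak compositions, swapping entries `i` and `i+1`. -/
def swapC (α : ℕ → ℕ) (i : ℕ) : ℕ → ℕ := fun j => α (sPerm i j)

/-- `α` has length `k`: `k` is minimal with `α i = 0` for all `i > k`. -/
def HasLen (α : ℕ → ℕ) (k : ℕ) : Prop :=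
  (∀ i, k < i → α i = 0) ∧ ∀ m, (∀ i, m < i → α i = 0) → k ≤ m

/-! ### Coxeter–Knuth equivalence -/

/-- One Coxeter–Knuth move. -/
def CKStep (u v : List ℕ) : Prop :=
  (∃ (a b : List ℕ) (x y z : ℕ), y < x ∧ x < z ∧
      u = a ++ [x, y, z] ++ b ∧ v = a ++ [x, z, y] ++ b) ∨
  (∃ (a b : List ℕ) (x y z : ℕ), y < z ∧ z < x ∧
      u = a ++ [x, y, z] ++ b ∧ v = a ++ [y, x, z] ++ b) ∨
  (∃ (a b : List ℕ) (i : ℕ),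
      u = a ++ [i, i + 1, i] ++ b ∧ v = a ++ [i + 1, i, i + 1] ++ b)

/-- Coxeter–Knuth equivalence: the transitive (symmetric, reflexive) closure of `CKStep`. -/
def CKEquiv : List ℕ → List ℕ → Prop := Relation.EqvGen CKStep

/-! ### Run factorizations and weak descent tableaux -/

/-- The run factorization of a word into maximal strictly increasing blocks
(listed from left to right). -/
def runFact : List ℕ → List (List ℕ)
  | [] => []
  | a :: rest =>
    match runFact rest with
    | [] => [[a]]
    | r :: rs => if a < r.headI then (a :: r) :: rs else [a] :: r :: rs

/-- Auxiliary: rows of the remaining blocks, given the row of the previous block. -/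
def wdtRowsAux : ℤ → List (List ℕ) → List ℤ
  | _, [] => []
  | prev, b :: bs =>
      min (prev - 1) (b.headI : ℤ) :: wdtRowsAux (min (prev - 1) (b.headI : ℤ)) bs

/-- The row indices assigned to the blocks of a run factorization (blocks listed
left to right): the leftmost block goes to the row indexed by its first letter, and each
subsequent block goes to the row indexed by its first letter if this is below the previous
block's row, and otherwise directly below the previous block's row. -/
def wdtRows : List (List ℕ) → List ℤ
  | [] => []
  | b :: bs => (b.headI : ℤ) :: wdtRowsAux (b.headI : ℤ) bs

/-- A tableau: rows indexed by `ℤ` (bottom to top), columns indexed by `ℕ` starting at `1`;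
the value `0` means that there is no box, a nonzero value is the (positive) entry. -/
abbrev Tableau := ℤ → ℕ → ℕ

/-- The weak descent tableau of a word. -/
def weakDesTab (ρ : List ℕ) : Tableau := fun r c =>
  if c = 0 then 0
  else
    match ((wdtRows (runFact ρ)).zip (runFact ρ)).find? (fun p => decide (p.1 = r)) with
    | some p => p.2.getD (c - 1) 0
    | none => 0

/-- A word is non-virtual if its weak descent tableau only occupies rows of positive index. -/
def NonVirtual (ρ : List ℕ) : Prop := ∀ r ∈ wdtRows (runFact ρ), 1 ≤ r

/-- The shape of a tableau: the number of boxes in each (positively indexed) row. -/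
def shapeOf (T : Tableau) : ℕ → ℕ := fun i => Set.ncard {c : ℕ | T (i : ℤ) c ≠ 0}

/-- The weak descent composition of a word: the shape of its weak descent tableau. -/
def desComp (ρ : List ℕ) : ℕ → ℕ := shapeOf (weakDesTab ρ)

/-- Partial-sum (dominance) order on weak compositions. -/
def compLE (μ ν : ℕ → ℕ) : Prop :=
  ∀ k : ℕ, ∑ i ∈ Finset.Icc 1 k, μ i ≤ ∑ i ∈ Finset.Icc 1 k, ν i

/-- A Yamanouchi reduced word: a non-virtual reduced word that is minimal in its
Coxeter–Knuth class among non-virtual words, for the order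
`ρ ≤ τ ↔ ρ ~ τ ∧ des ρ ≤ des τ`. -/
def Yamanouchi (ρ : List ℕ) : Prop :=
  IsReducedWord ρ ∧ NonVirtual ρ ∧
    ∀ σ : List ℕ, NonVirtual σ → CKEquiv ρ σ → compLE (desComp ρ) (desComp σ)

/-- The (unique) Yamanouchi reduced word Coxeter–Knuth equivalent to `ρ`. -/
def hatRho (ρ : List ℕ) : List ℕ :=
  if h : ∃ σ, Yamanouchi σ ∧ CKEquiv ρ σ then h.choose else []

/-- The weak Edelman–Greene insertion tableau of a word: the weak descent tableau of the
unique Yamanouchi reduced word Coxeter–Knuth equivalent to it. -/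
def hatP (ρ : List ℕ) : Tableau := weakDesTab (hatRho ρ)

/-! ### Factorizations -/

/-- The factorization `f : ℕ → List ℕ` stores the block `ρ^{(i)}` at index `i ≥ 1`
(blocks indexed from the right); the largest index of a nonempty block. -/
def topIdx (f : ℕ → List ℕ) : ℕ := sSup {i : ℕ | f i ≠ []}

/-- The concatenation `ρ^{(top)} ⋯ ρ^{(i+1)} ρ^{(i)}` of the blocks of `f` with index `≥ i`. -/
def factWordGe (f : ℕ → List ℕ) (i : ℕ) : List ℕ :=
  ((((List.range (topIdx f + 1)).reverse).filter (fun j => decide (i ≤ j))).map f).foldr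
    (· ++ ·) []

/-- The underlying word of a factorization. -/
def factWord (f : ℕ → List ℕ) : List ℕ := factWordGe f 0

/-- The weak Edelman–Greene recording tableau of a factorization: it has the same shape as
the weak EG insertion tableau of the underlying word, and has entry `i` in all boxes of
`P̂(ρ^{(k)}|⋯|ρ^{(i)})` that are not in `P̂(ρ^{(k)}|⋯|ρ^{(i+1)})`. -/
def hatQfact (f : ℕ → List ℕ) : Tableau := fun r c =>
  sSup {i : ℕ | 1 ≤ i ∧ hatP (factWordGe f i) r c ≠ 0 ∧ hatP (factWordGe f (i + 1)) r c = 0}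

/-- Every block is strictly increasing. -/
def IncreasingFact (f : ℕ → List ℕ) : Prop := ∀ i, List.Chain' (· < ·) (f i)

/-- The factorization is `φ`-flagged: every nonempty block `ρ^{(i)}` has first letter
`ρ^{(i)}_1` with `φ(ρ^{(i)}_1) ≥ i`. -/
def FlaggedFact (φ : ℕ → ℕ) (f : ℕ → List ℕ) : Prop :=
  ∀ i, f i ≠ [] → i ≤ φ ((f i).headI)

/-- `RFC(w, φ)`: all `φ`-flagged increasing factorizations of reduced words for `w`. -/
def RFCset (w : Equiv.Perm ℕ) (φ : ℕ → ℕ) : Set (ℕ → List ℕ) :=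
  {f | f 0 = [] ∧ {i : ℕ | f i ≠ []}.Finite ∧ IncreasingFact f ∧ FlaggedFact φ f ∧
       IsReducedWordFor w (factWord f)}

/-- `RF_n(w)`: increasing factorizations of reduced words for `w` with exactly `n` blocks
(indexed `1, …, n`, possibly empty). -/
def RFn (n : ℕ) (w : Equiv.Perm ℕ) : Set (ℕ → List ℕ) :=
  {f | f 0 = [] ∧ (∀ j, n < j → f j = []) ∧ IncreasingFact f ∧
       IsReducedWordFor w (factWord f)}

/-- `RFC_n(w, φ)`: the `φ`-flagged elements of `RF_n(w)`. -/
def RFCn (n : ℕ) (w : Equiv.Perm ℕ) (φ : ℕ → ℕ) : Set (ℕ → List ℕ) :=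
  {f | f ∈ RFn n w ∧ FlaggedFact φ f}

/-! ### Morse–Schilling crystal operators -/

/-- Pairing procedure: first argument is the block `r^{(i)}` in *decreasing* order, second is
the not-yet-paired part of the block `r^{(i+1)}` (in increasing order). Each letter `b` of
`r^{(i)}`, from largest to smallest, is paired with the smallest still unpaired letter of
`r^{(i+1)}` strictly larger than `b`. Returns the unpaired letters of `r^{(i+1)}`. -/
def unpairedUpper : List ℕ → List ℕ → List ℕ
  | [], A => A
  | b :: bs, A =>
    match A.find? (fun a => decide (b < a)) with
    | some a => unpairedUpper bs (A.erase a)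
    | none => unpairedUpper bs A

/-- As in `unpairedUpper`, but returns the unpaired letters of `r^{(i)}`. -/
def unpairedLower : List ℕ → List ℕ → List ℕ
  | [], _ => []
  | b :: bs, A =>
    match A.find? (fun a => decide (b < a)) with
    | some a => unpairedLower bs (A.erase a)
    | none => b :: unpairedLower bs A

/-- Insert a letter into a weakly increasing list, keeping it increasing. -/
def insAsc (x : ℕ) : List ℕ → List ℕ
  | [] => [x]
  | y :: ys => if x ≤ y then x :: y :: ys else y :: insAsc x ys

/-- The Morse–Schilling raising operator `e_i`: if every letter of block `i+1` is paired,
the result is `none` (i.e. `0`); otherwise the largest unpaired letter `a` of block `i+1` is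
removed and `a + s` is added to block `i`, where `s = min {j ≥ 0 | a+j+1 ∉ r^{(i+1)}}`. -/
def msE (i : ℕ) (f : ℕ → List ℕ) : Option (ℕ → List ℕ) :=
  let B := f i
  let A := f (i + 1)
  let L := unpairedUpper B.reverse A
  if L = [] then none
  else
    let a := L.foldr max 0
    let s := sInf {j : ℕ | (a + j + 1) ∉ A}
    some (Function.update (Function.update f (i + 1) (A.erase a)) i (insAsc (a + s) B))

/-- The Morse–Schilling lowering operator `f_i`: if every letter of block `i` is paired,
the result is `none`; otherwise the smallest unpaired letter `b` of block `i` is removed and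
`b - t` is added to block `i+1`, where `t = min {j ≥ 0 | b-j-1 ∉ r^{(i)}}`. -/
def msF (i : ℕ) (f : ℕ → List ℕ) : Option (ℕ → List ℕ) :=
  let B := f i
  let A := f (i + 1)
  let R := unpairedLower B.reverse A
  if R = [] then none
  else
    let b := R.foldr min R.headI
    let t := sInf {j : ℕ | (b - j - 1) ∉ B}
    some (Function.update (Function.update f i (B.erase b)) (i + 1) (insAsc (b - t) A))

/-- Iteration `e_j^k` of the raising operator. -/
def msEIter (j : ℕ) : ℕ → (ℕ → List ℕ) → Option (ℕ → List ℕ)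
  | 0, f => some f
  | k + 1, f => (msE j f).bind (msEIter j k)

/-- The Demazure operator `𝔇_j` on subsets of the crystal `RF_n(w)`:
`𝔇_j X = {b ∈ RF_n(w) | e_j^k(b) ∈ X for some k ≥ 0}`. -/
def demOp (n : ℕ) (w : Equiv.Perm ℕ) (j : ℕ) (X : Set (ℕ → List ℕ)) : Set (ℕ → List ℕ) :=
  {b | b ∈ RFn n w ∧ ∃ (k : ℕ) (c : ℕ → List ℕ), msEIter j k b = some c ∧ c ∈ X}

/-- `𝔇_{i_1} 𝔇_{i_2} ⋯ 𝔇_{i_k} X` for a word `i_1 i_2 ⋯ i_k` (the head is applied last). -/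
def demWord (n : ℕ) (w : Equiv.Perm ℕ) : List ℕ → Set (ℕ → List ℕ) → Set (ℕ → List ℕ)
  | [], X => X
  | j :: rest, X => demOp n w j (demWord n w rest X)

/-- `𝔇_{b↓a} = 𝔇_{b-1} 𝔇_{b-2} ⋯ 𝔇_a` (the identity when `b ≤ a`). -/
def demDown (n : ℕ) (w : Equiv.Perm ℕ) (b a : ℕ) (X : Set (ℕ → List ℕ)) :
    Set (ℕ → List ℕ) :=
  demWord n w ((List.range' a (b - a)).reverse) X

/-! ### Key tableaux -/

/-- A key tableau: a filling of a left-justified diagram in the positively indexed rows,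
with positive entries, weakly decreasing rows, distinct column entries, and the key
condition (c) of Assaf–Schilling. -/
def IsKeyTableau (T : Tableau) : Prop :=
  (∀ (r : ℤ) (c : ℕ), r ≤ 0 → T r c = 0) ∧
  (∀ r : ℤ, T r 0 = 0) ∧
  {p : ℤ × ℕ | T p.1 p.2 ≠ 0}.Finite ∧
  (∀ (r : ℤ) (c : ℕ), 1 ≤ c → T r (c + 1) ≠ 0 → T r c ≠ 0) ∧
  (∀ (r : ℤ) (c : ℕ), 1 ≤ c → T r (c + 1) ≠ 0 → T r (c + 1) ≤ T r c) ∧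
  (∀ (r r' : ℤ) (c : ℕ), r ≠ r' → T r c ≠ 0 → T r' c ≠ 0 → T r c ≠ T r' c) ∧
  (∀ (r r' : ℤ) (c : ℕ), r < r' → T r c ≠ 0 → T r' c ≠ 0 → T r' c < T r c →
      T r (c + 1) ≠ 0 ∧ T r' c < T r (c + 1))

/-- The tableau is `φ`-flagged: every entry in row `i` is at most `φ(i)`. -/
def FlaggedTab (φ : ℕ → ℕ) (T : Tableau) : Prop := ∀ (i c : ℕ), T (i : ℤ) c ≤ φ i

/-- `SSKT(α, φ)`: the `φ`-flagged key tableaux of shape `α`. -/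
def SSKT (α φ : ℕ → ℕ) : Set Tableau :=
  {T | IsKeyTableau T ∧ shapeOf T = α ∧ FlaggedTab φ T}

/-- The weight of a tableau: `wt(T)_v` is the number of entries equal to `v`. -/
def wtTab (T : Tableau) : ℕ → ℕ := fun v =>
  if v = 0 then 0 else Set.ncard {p : ℤ × ℕ | T p.1 p.2 = v}

/-- The weight of a word: the multiplicity of each positive letter. -/
def wtWord (u : List ℕ) : ℕ → ℕ := fun v => if v = 0 then 0 else u.count v

/-- The statistic `m_i(col(T), j)` where position `j` of the reverse column reading word
(entries read down columns, from right to left) is the box in row `r`, column `c`: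
the number of entries `i+1` weakly after this box minus the number of entries `i`. -/
def mi (T : Tableau) (i : ℕ) (r : ℤ) (c : ℕ) : ℤ :=
  (Set.ncard {p : ℤ × ℕ | T p.1 p.2 = i + 1 ∧ (p.2 < c ∨ (p.2 = c ∧ p.1 ≤ r))} : ℤ) -
  (Set.ncard {p : ℤ × ℕ | T p.1 p.2 = i ∧ (p.2 < c ∨ (p.2 = c ∧ p.1 ≤ r))} : ℤ)

/-- The box `(r, c)` maximizes `m_i` among all boxes of `T`. -/
def isMaxBox (T : Tableau) (i : ℕ) (r : ℤ) (c : ℕ) : Prop :=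
  T r c ≠ 0 ∧ ∀ (r' : ℤ) (c' : ℕ), T r' c' ≠ 0 → mi T i r' c' ≤ mi T i r c

/-- The Assaf–Schilling raising operator `e_i` on key tableaux.  If `m_i(col(T)) ≤ 0` the
result is `none` (i.e. `0`); otherwise, with `q` the largest position of the reverse column
reading word achieving the maximum (i.e. the maximizing box with the smallest column index,
and the smallest row index in that column), all entries `i+1` in the row of `q` weakly to its
right are changed to `i`, and all entries `i` in the same columns as these entries are
changed to `i+1`. -/
def keyE (i : ℕ) (T : Tableau) : Option Tableau :=
  if h : ∃ (r : ℤ) (c : ℕ), isMaxBox T i r c ∧ 1 ≤ mi T i r c then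
    let cq := sInf {c : ℕ | ∃ r : ℤ, isMaxBox T i r c}
    let rq : ℤ := ((sInf {m : ℕ | isMaxBox T i ((m : ℕ) : ℤ) cq} : ℕ) : ℤ)
    some (fun r c =>
      if cq ≤ c ∧ T rq c = i + 1 then
        (if T r c = i + 1 then i else if T r c = i then i + 1 else T r c)
      else T r c)
  else none

/-- The Assaf–Schilling lowering operator `f_i`: the (unique) inverse of `e_i`. -/
def keyF (i : ℕ) (T : Tableau) : Option Tableau :=
  if h : ∃ T', keyE i T' = some T then some h.choose else none

/-- Restriction of a partially defined crystal operator to a subset: the operator returns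
`none` (i.e. `0`) whenever it would leave the subset. -/
def restrictOp {β : Type} (S : Set β) (op : β → Option β) (x : β) : Option β :=
  (op x).bind fun y => if y ∈ S then some y else none

/-! ### Polynomials: divided differences and key polynomials -/

/-- The divided difference operator `∂_i f = (f - s_i · f) / (x_i - x_{i+1})`. -/
def divDiff (i : ℕ) (fp : MvPolynomial ℕ ℤ) : MvPolynomial ℕ ℤ :=
  if h : ∃ g : MvPolynomial ℕ ℤ,
      g * (MvPolynomial.X i - MvPolynomial.X (i + 1)) =
        fp - MvPolynomial.rename (fun j => sPerm i j) fp
  then h.choose else 0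

/-- The isobaric divided difference operator `π_i f = ∂_i (x_i f)`. -/
def piOp (i : ℕ) (fp : MvPolynomial ℕ ℤ) : MvPolynomial ℕ ℤ :=
  divDiff i (MvPolynomial.X i * fp)

/-- `π_{i_1} π_{i_2} ⋯ π_{i_k} f` for a word `i_1 i_2 ⋯ i_k` (the head is applied last). -/
def piWord : List ℕ → MvPolynomial ℕ ℤ → MvPolynomial ℕ ℤ
  | [], fp => fp
  | i :: rest, fp => piOp i (piWord rest fp)

/-- `π_{b↓a} = π_{b-1} π_{b-2} ⋯ π_a` (the identity when `b ≤ a`). -/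
def piDown (b a : ℕ) (fp : MvPolynomial ℕ ℤ) : MvPolynomial ℕ ℤ :=
  piWord ((List.range' a (b - a)).reverse) fp

/-- The conjugate of a weak composition: `conjC α t = #{j ≥ 1 | α_j ≥ t}` for `t ≥ 1`. -/
def conjC (α : ℕ → ℕ) (t : ℕ) : ℕ :=
  Set.ncard {j : ℕ | 1 ≤ j ∧ 1 ≤ t ∧ t ≤ α j}

/-- The partition rearrangement of a weak composition (the conjugate of its conjugate). -/
def sortC (α : ℕ → ℕ) : ℕ → ℕ := conjC (conjC α)

/-- The length of a permutation: the common length of its reduced words. -/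
def permLength (w : Equiv.Perm ℕ) : ℕ :=
  sInf {n : ℕ | ∃ ρ : List ℕ, PosWord ρ ∧ wordPerm ρ = w ∧ ρ.length = n}

/-- The monomial `x^β = x_1^{β_1} x_2^{β_2} ⋯`. -/
def xExp (β : ℕ → ℕ) : MvPolynomial ℕ ℤ :=
  ∏ i ∈ Finset.range (sSup {n : ℕ | β n ≠ 0} + 1), MvPolynomial.X i ^ β i

/-- The key polynomial `κ_α = π_w x^λ` where `λ` is the partition rearrangement of `α` and
`w` is the minimal-length permutation of `S∞` with `α · w = λ`. -/
def keyPoly (α : ℕ → ℕ) : MvPolynomial ℕ ℤ :=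
  if h : ∃ (ρ : List ℕ) (w : Equiv.Perm ℕ), IsReducedWordFor w ρ ∧
      (∀ i, α (w i) = sortC α i) ∧
      (∀ v : Equiv.Perm ℕ, (∃ τ, IsReducedWordFor v τ) → (∀ i, α (v i) = sortC α i) →
        permLength w ≤ permLength v)
  then piWord h.choose (xExp (sortC α)) else 0

/-- The `φ`-flagged key polynomial `κ_{(α,φ)} = Σ_{T ∈ SSKT(α,φ)} x^{wt(T)}`. -/
def flaggedKeyPoly (α φ : ℕ → ℕ) : MvPolynomial ℕ ℤ :=
  ∑ᶠ T ∈ SSKT α φ, xExp (wtTab T)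

/-! ### Column insertion, keys, standardization -/

/-- The number of boxes in column `c` of a tableau. -/
def colHeightN (T : Tableau) (c : ℕ) : ℕ := Set.ncard {r : ℤ | T r c ≠ 0}

/-- One pass of column insertion: insert the value `x` starting at column `c`
(`fuel` bounds the number of columns visited). -/
def colInsertAux : ℕ → Tableau → ℕ → ℕ → Tableau
  | 0, T, _, _ => T
  | fuel + 1, T, c, x =>
    if ∀ r : ℤ, T r c ≠ 0 → T r c < x then
      -- x is greater than every entry of column c: place it at the end of the column
      fun r c' => if c' = c ∧ r = (colHeightN T c + 1 : ℤ) then x else T r c'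
    else if ∃ r : ℤ, T r c = x then
      -- column c contains x: move on to the next column with the same value
      colInsertAux fuel T (c + 1) x
    else
      -- bump the smallest entry of column c that is larger than x
      let y := sInf {v : ℕ | x < v ∧ ∃ r : ℤ, T r c = v}
      colInsertAux fuel (fun r c' => if c' = c ∧ T r c' = y then x else T r c') (c + 1) y

/-- Column insertion of `x` into the semistandard Young tableau `T`. -/
def colInsert (T : Tableau) (x : ℕ) : Tableau :=
  colInsertAux (sSup {c : ℕ | ∃ r : ℤ, T r c ≠ 0} + 2) T 1 x

/-- The insertion tableau `P` of `(v → ∅)`: successively column insert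
`v_n, v_{n-1}, …, v_1` into the empty tableau. -/
def insertP (v : List ℕ) : Tableau :=
  v.reverse.foldl colInsert (fun _ _ => 0)

/-- The recording tableau `Q` of `(v → ∅)`: the standard Young tableau whose restriction to
`{1, …, j}` has the same shape as the insertion tableau of the last `j` letters of `v`. -/
def insertQ (v : List ℕ) : Tableau := fun r c =>
  sInf {j : ℕ | insertP (v.drop (v.length - j)) r c ≠ 0}

/-- The key `key(α)`: the unique semistandard Young tableau of weight `α` such that the set
of entries of column `i+1` is a subset of the entries of column `i`; its column `c` consists
of the elements of `{x ≥ 1 | α_x ≥ c}` in increasing order from bottom to top. -/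
def keyTab (α : ℕ → ℕ) : Tableau := fun r c =>
  if c = 0 then 0
  else sInf {x : ℕ | 1 ≤ x ∧ c ≤ α x ∧
    ((Set.ncard {y : ℕ | 1 ≤ y ∧ c ≤ α y ∧ y ≤ x} : ℕ) : ℤ) = r}

/-- The standardization of a semistandard Young tableau: the `1`'s are replaced from left to
right by `1, …, β_1`, the `2`'s by `β_1 + 1, …, β_1 + β_2`, and so on. -/
def stdTab (T : Tableau) : Tableau := fun r c =>
  if T r c = 0 then 0
  else Set.ncard {p : ℤ × ℕ |
    T p.1 p.2 ≠ 0 ∧ (T p.1 p.2 < T r c ∨ (T p.1 p.2 = T r c ∧ p.2 ≤ c))}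

/-! ### Maximal factorizations (Reiner–Shimozono) -/

/-- Every block is weakly increasing. -/
def WeaklyIncrFact (g : ℕ → List ℕ) : Prop := ∀ i, List.Chain' (· ≤ ·) (g i)

/-- Maximality: the nonempty blocks have maximal length, i.e. there is a strict descent
between any two consecutive nonempty blocks (no letter can be moved from the end of a block
to the front of the next one to the right). -/
def MaxFact (g : ℕ → List ℕ) : Prop :=
  ∀ i j : ℕ, 1 ≤ i → i < j → g i ≠ [] → g j ≠ [] → (∀ m, i < m → m < j → g m = []) →
    (g i).headI < (g j).getLastD 0

/-- Reiner–Shimozono's set `𝒲(α, φ)` of `φ`-flagged maximal factorizations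
`u^• = u^n ⋯ u^2 u^1` with `ℓ(u^i) = α_i` and `(u → ∅) = (P, std(key(α)))`. -/
def Wset (α φ : ℕ → ℕ) : Set (ℕ → List ℕ) :=
  {g | g 0 = [] ∧ (∀ i, (g i).length = α i) ∧ (∀ i, ∀ x ∈ g i, 1 ≤ x) ∧
       WeaklyIncrFact g ∧ MaxFact g ∧ (∀ i, ∀ x ∈ g i, x ≤ φ i) ∧
       insertQ (factWord g) = stdTab (keyTab α)}

/-! ### Shifts and highest weight key tableaux -/

/-- `shift_N`: add `N` to every letter of every block. -/
def shiftFact (N : ℕ) (f : ℕ → List ℕ) : ℕ → List ℕ := fun i => (f i).map (· + N)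

/-- The tableau of shape `α` whose column `i` is filled by `1, 2, …, λ^T_i` in increasing
order from bottom to top (where `λ^T` is the conjugate of the partition rearrangement `λ`
of `α`): the box of column `c` in row `m` (where `α_m ≥ c`) contains the number of indices
`m' ≤ m` with `α_{m'} ≥ c`. -/
def highKeyTab (α : ℕ → ℕ) : Tableau := fun r c =>
  if c = 0 then 0
  else if ∃ m : ℕ, (m : ℤ) = r ∧ 1 ≤ m ∧ c ≤ α m then
    Set.ncard {m : ℕ | 1 ≤ m ∧ c ≤ α m ∧ (m : ℤ) ≤ r}
  else 0


/-- A `gl_n`-crystal isomorphism between two sets of key tableaux, both equipped with the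
Assaf–Schilling operators (restricted to the sets): a weight-preserving bijection commuting
with all raising and lowering operators `e_i, f_i` for `1 ≤ i < n`. -/
def SSKTIso (n : ℕ) (S₁ S₂ : Set Tableau) : Prop :=
  ∃ g : Tableau → Tableau, Set.BijOn g S₁ S₂ ∧
    (∀ T ∈ S₁, wtTab T = wtTab (g T)) ∧
    ∀ T ∈ S₁, ∀ i : ℕ, 1 ≤ i → i < n →
      Option.map g (restrictOp S₁ (keyE i) T) = restrictOp S₂ (keyE i) (g T) ∧
      Option.map g (restrictOp S₁ (keyF i) T) = restrictOp S₂ (keyF i) (g T)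

end

/-! ### Coxeter–Knuth equivalence and reduced words -/

theorem wordPerm_append (u v : List ℕ) : wordPerm (u ++ v) = wordPerm u * wordPerm v := by
  simp [wordPerm]

theorem posWord_append {u v : List ℕ} : PosWord (u ++ v) ↔ PosWord u ∧ PosWord v := by
  simp only [PosWord, List.mem_append]
  exact ⟨fun h => ⟨fun x hx => h x (Or.inl hx), fun x hx => h x (Or.inr hx)⟩,
    fun h x hx => hx.elim (h.1 x) (h.2 x)⟩

theorem CKEquiv.refl (u : List ℕ) : CKEquiv u u := Relation.EqvGen.refl u

theorem CKEquiv.symm {u v : List ℕ} (h : CKEquiv u v) : CKEquiv v u := Relation.EqvGen.symm _ _ h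

theorem CKEquiv.trans {u v t : List ℕ} (h : CKEquiv u v) (h' : CKEquiv v t) : CKEquiv u t :=
  Relation.EqvGen.trans _ _ _ h h'

theorem CKEquiv.context {u v : List ℕ} (h : CKEquiv u v) (p q : List ℕ) :
    CKEquiv (p ++ u ++ q) (p ++ v ++ q) := by
  induction h with
  | rel u v h =>
    apply Relation.EqvGen.rel
    rcases h with ⟨a, b, x, y, z, h1, h2, rfl, rfl⟩ | ⟨a, b, x, y, z, h1, h2, rfl, rfl⟩ |
      ⟨a, b, i, rfl, rfl⟩
    · exact Or.inl ⟨p ++ a, b ++ q, x, y, z, h1, h2, by simp, by simp⟩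
    · exact Or.inr (Or.inl ⟨p ++ a, b ++ q, x, y, z, h1, h2, by simp, by simp⟩)
    · exact Or.inr (Or.inr ⟨p ++ a, b ++ q, i, by simp, by simp⟩)
  | refl u => exact CKEquiv.refl _
  | symm u v _ ih => exact CKEquiv.symm ih
  | trans u v t _ _ ih ih' => exact CKEquiv.trans ih ih'

theorem CKEquiv.append_right {u v : List ℕ} (h : CKEquiv u v) (q : List ℕ) :
    CKEquiv (u ++ q) (v ++ q) := by simpa using h.context [] q

theorem CKEquiv.append_left {u v : List ℕ} (h : CKEquiv u v) (p : List ℕ) :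
    CKEquiv (p ++ u) (p ++ v) := by simpa using h.context p []

theorem CKEquiv.cons {u v : List ℕ} (h : CKEquiv u v) (x : ℕ) :
    CKEquiv (x :: u) (x :: v) := by simpa using h.append_left [x]

theorem CKEquiv.swap_right {x y z : ℕ} (h : y < x) (h' : x < z) (b : List ℕ) :
    CKEquiv (x :: y :: z :: b) (x :: z :: y :: b) :=
  Relation.EqvGen.rel _ _ (Or.inl ⟨[], b, x, y, z, h, h', by simp, by simp⟩)

theorem CKEquiv.swap_left {x y z : ℕ} (h : y < z) (h' : z < x) (b : List ℕ) :
    CKEquiv (x :: y :: z :: b) (y :: x :: z :: b) :=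
  Relation.EqvGen.rel _ _ (Or.inr (Or.inl ⟨[], b, x, y, z, h, h', by simp, by simp⟩))

theorem CKEquiv.braid (i : ℕ) (b : List ℕ) :
    CKEquiv (i :: (i + 1) :: i :: b) ((i + 1) :: i :: (i + 1) :: b) :=
  Relation.EqvGen.rel _ _ (Or.inr (Or.inr ⟨[], b, i, by simp, by simp⟩))

theorem CKEquiv.reverse {u v : List ℕ} (h : CKEquiv u v) : CKEquiv u.reverse v.reverse := by
  induction h with
  | rel u v h =>
    rcases h with ⟨a, b, x, y, z, h1, h2, rfl, rfl⟩ | ⟨a, b, x, y, z, h1, h2, rfl, rfl⟩ |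
      ⟨a, b, i, rfl, rfl⟩
    · exact Relation.EqvGen.rel _ _ (Or.inr (Or.inl
        ⟨b.reverse, a.reverse, z, y, x, h1, h2, by simp, by simp⟩))
    · exact Relation.EqvGen.rel _ _ (Or.inl
        ⟨b.reverse, a.reverse, z, y, x, h1, h2, by simp, by simp⟩)
    · exact Relation.EqvGen.rel _ _ (Or.inr (Or.inr
        ⟨b.reverse, a.reverse, i, by simp, by simp⟩))
  | refl u => exact CKEquiv.refl _
  | symm u v _ ih => exact CKEquiv.symm ih
  | trans u v t _ _ ih ih' => exact CKEquiv.trans ih ih'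

theorem sPerm_mul_self (i : ℕ) : sPerm i * sPerm i = 1 := Equiv.swap_mul_self _ _

theorem sPerm_comm {i j : ℕ} (h : i + 1 < j) : sPerm i * sPerm j = sPerm j * sPerm i := by
  ext n
  simp only [sPerm, Equiv.Perm.mul_apply, Equiv.swap_apply_def]
  split_ifs <;> omega

theorem sPerm_braid (i : ℕ) :
    sPerm i * sPerm (i + 1) * sPerm i = sPerm (i + 1) * sPerm i * sPerm (i + 1) := by
  ext n
  simp only [sPerm, Equiv.Perm.mul_apply, Equiv.swap_apply_def]
  split_ifs <;> omega

theorem CKEquiv.length_eq {u v : List ℕ} (h : CKEquiv u v) : u.length = v.length := by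
  induction h with
  | rel u v h =>
    rcases h with ⟨a, b, x, y, z, h1, h2, rfl, rfl⟩ | ⟨a, b, x, y, z, h1, h2, rfl, rfl⟩ |
      ⟨a, b, i, rfl, rfl⟩ <;> simp
  | refl u => rfl
  | symm u v _ ih => exact ih.symm
  | trans u v t _ _ ih ih' => exact ih.trans ih'

theorem sPerm_comm' {i j : ℕ} (h : i + 1 < j) (t : Equiv.Perm ℕ) :
    sPerm i * (sPerm j * t) = sPerm j * (sPerm i * t) := by
  rw [← mul_assoc, sPerm_comm h, mul_assoc]

theorem IsReducedWord.factor {a b c : List ℕ} (h : IsReducedWord (a ++ b ++ c)) :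
    IsReducedWord b := by
  obtain ⟨hp, hm⟩ := h
  rw [posWord_append, posWord_append] at hp
  refine ⟨hp.1.2, fun σ hσ hw => ?_⟩
  have := hm (a ++ σ ++ c) (by rw [posWord_append, posWord_append]; exact ⟨⟨hp.1.1, hσ⟩, hp.2⟩)
    (by simp [wordPerm_append, hw])
  simp at this
  omega

theorem IsReducedWord.left {a b : List ℕ} (h : IsReducedWord (a ++ b)) : IsReducedWord a :=
  IsReducedWord.factor (a := []) (c := b) (by simpa using h)

theorem IsReducedWord.right {a b : List ℕ} (h : IsReducedWord (a ++ b)) : IsReducedWord b :=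
  IsReducedWord.factor (a := a) (c := []) (by simpa using h)

theorem IsReducedWord.ne {a b : List ℕ} {x y : ℕ} (h : IsReducedWord (a ++ x :: y :: b)) :
    x ≠ y := by
  rintro rfl
  have h' : IsReducedWord [x, x] := IsReducedWord.factor (a := a) (c := b) (by simpa using h)
  have := h'.2 [] (by simp [PosWord]) (by simp [wordPerm, sPerm_mul_self])
  simp at this

/-- A factor `x y x` in a reduced word is a braid. -/
theorem IsReducedWord.braid {a b : List ℕ} {x y : ℕ} (h : IsReducedWord (a ++ x :: y :: x :: b)) :
    y = x + 1 ∨ x = y + 1 := by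
  by_contra hne
  push Not at hne
  have h0 := IsReducedWord.ne h
  have h' : IsReducedWord [x, y, x] := IsReducedWord.factor (a := a) (c := b) (by simpa using h)
  have := h'.2 [y] (fun z hz => h'.1 z (by simp at hz; simp [hz])) (by
    simp only [wordPerm, List.map_cons, List.map_nil, List.prod_cons, List.prod_nil, mul_one]
    rcases lt_or_gt_of_ne h0 with hl | hl
    · rw [← sPerm_comm (by omega), ← mul_assoc, sPerm_mul_self, one_mul]
    · rw [sPerm_comm (by omega), ← mul_assoc, sPerm_mul_self, one_mul])
  simp at this

theorem CKEquiv.wordPerm_eq {u v : List ℕ} (h : CKEquiv u v) : wordPerm u = wordPerm v := by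
  induction h with
  | rel u v h =>
    rcases h with ⟨a, b, x, y, z, h1, h2, rfl, rfl⟩ | ⟨a, b, x, y, z, h1, h2, rfl, rfl⟩ |
      ⟨a, b, i, rfl, rfl⟩
    · simp only [wordPerm_append]
      congr 2
      simp [wordPerm, sPerm_comm (show y + 1 < z by omega)]
    · simp only [wordPerm_append]
      congr 2
      simp [wordPerm, sPerm_comm' (show y + 1 < x by omega)]
    · simp only [wordPerm_append]
      congr 2
      simpa [wordPerm, mul_assoc] using sPerm_braid i
  | refl u => rfl
  | symm u v _ ih => exact ih.symm
  | trans u v t _ _ ih ih' => exact ih.trans ih'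

theorem CKEquiv.forall_le_iff {u v : List ℕ} (h : CKEquiv u v) :
    (∀ k, (∀ x ∈ u, k ≤ x) ↔ ∀ x ∈ v, k ≤ x) := by
  induction h with
  | rel u v h =>
    intro k
    rcases h with ⟨a, b, x, y, z, h1, h2, rfl, rfl⟩ | ⟨a, b, x, y, z, h1, h2, rfl, rfl⟩ |
      ⟨a, b, i, rfl, rfl⟩
    · simp; grind
    · simp; grind
    · simp; grind
  | refl u => simp
  | symm u v _ ih => exact fun k => (ih k).symm
  | trans u v t _ _ ih ih' => exact fun k => (ih k).trans (ih' k)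

theorem CKEquiv.isReducedWord {u v : List ℕ} (h : CKEquiv u v) (hu : IsReducedWord u) :
    IsReducedWord v := by
  refine ⟨(h.forall_le_iff 1).1 hu.1, fun σ hσ hw => ?_⟩
  rw [← h.length_eq]
  exact hu.2 σ hσ (hw.trans h.wordPerm_eq.symm)

theorem wordPerm_reverse (u : List ℕ) : wordPerm u.reverse = (wordPerm u)⁻¹ := by
  induction u with
  | nil => simp [wordPerm]
  | cons a u ih =>
    rw [List.reverse_cons, wordPerm_append, ih, show a :: u = [a] ++ u from rfl,
      wordPerm_append [a] u, mul_inv_rev]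
    congr 1

theorem IsReducedWord.reverse {u : List ℕ} (hu : IsReducedWord u) :
    IsReducedWord u.reverse := by
  refine ⟨fun x hx => hu.1 x (by simpa using hx), fun σ hσ hw => ?_⟩
  have := hu.2 σ.reverse (fun x hx => hσ x (by simpa using hx))
    (by rw [wordPerm_reverse, hw, wordPerm_reverse, inv_inv])
  simpa using this

/-! ### Edelman–Greene insertion into a row -/

/-- The smallest element of `R` greater than `x`. -/
def nextIn (R : Finset ℕ) (x : ℕ) : Option ℕ :=
  if h : (R.filter (x < ·)).Nonempty then some ((R.filter (x < ·)).min' h) else none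

theorem nextIn_eq_some {R : Finset ℕ} {x y : ℕ} :
    nextIn R x = some y ↔ y ∈ R ∧ x < y ∧ ∀ z ∈ R, x < z → y ≤ z := by
  unfold nextIn
  split_ifs with h
  · simp only [Option.some.injEq]
    have hm := Finset.mem_filter.1 (Finset.min'_mem _ h)
    constructor
    · rintro rfl
      exact ⟨hm.1, hm.2, fun z hz hz' => Finset.min'_le _ z (by simp [hz, hz'])⟩
    · rintro ⟨h1, h2, h3⟩
      exact le_antisymm (Finset.min'_le _ y (by simp [h1, h2])) (h3 _ hm.1 hm.2)
  · simp only [false_iff]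
    rintro ⟨h1, h2, -⟩
    exact h ⟨y, by simp [h1, h2]⟩

theorem nextIn_eq_none {R : Finset ℕ} {x : ℕ} : nextIn R x = none ↔ ∀ z ∈ R, z ≤ x := by
  unfold nextIn
  split_ifs with h
  · obtain ⟨y, hy⟩ := h
    simp only [Finset.mem_filter] at hy
    simp only [false_iff, not_forall]
    exact ⟨y, hy.1, by omega⟩
  · simp only [true_iff]
    intro z hz
    by_contra hlt
    exact h ⟨z, by simp [hz]; omega⟩

/-- The row obtained by inserting `x` into the row `R`. -/
def rowIns (R : Finset ℕ) (x : ℕ) : Finset ℕ :=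
  match nextIn R x with
  | none => insert x R
  | some y => if x ∈ R then R else insert x (R.erase y)

theorem mem_rowIns {R : Finset ℕ} {x v : ℕ} :
    v ∈ rowIns R x ↔ v = x ∨ v ∈ R ∧ (x ∈ R ∨ nextIn R x ≠ some v) := by
  unfold rowIns
  cases h : nextIn R x with
  | none => simp
  | some y => split_ifs <;> grind

/-- Insert a letter into a row and append the bumped letter to a word. -/
def rowStep (s : Finset ℕ × List ℕ) (x : ℕ) : Finset ℕ × List ℕ :=
  (rowIns s.1 x, s.2 ++ (nextIn s.1 x).toList)

theorem foldl_rowStep (w : List ℕ) (R : Finset ℕ) (o : List ℕ) :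
    w.foldl rowStep (R, o) =
      ((w.foldl rowStep (R, [])).1, o ++ (w.foldl rowStep (R, [])).2) := by
  induction w generalizing R o with
  | nil => simp
  | cons x w ih =>
    simp only [List.foldl_cons, rowStep]
    rw [ih, ih _ ([] ++ _)]
    simp

/-- The bottom row of the Edelman–Greene tableau of a word. -/
def bottomRow (ρ : List ℕ) : Finset ℕ := (ρ.foldl rowStep (∅, [])).1

/-- The word bumped out of the bottom row. -/
def bumped (ρ : List ℕ) : List ℕ := (ρ.foldl rowStep (∅, [])).2

@[simp] theorem bottomRow_nil : bottomRow [] = ∅ := rfl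

@[simp] theorem bumped_nil : bumped [] = [] := rfl

theorem bottomRow_concat (ρ : List ℕ) (x : ℕ) :
    bottomRow (ρ ++ [x]) = rowIns (bottomRow ρ) x := by
  simp [bottomRow, rowStep]

theorem bumped_concat (ρ : List ℕ) (x : ℕ) :
    bumped (ρ ++ [x]) = bumped ρ ++ (nextIn (bottomRow ρ) x).toList := by
  simp [bumped, bottomRow, rowStep]

theorem fold_rowStep_append (u v : List ℕ) :
    bottomRow (u ++ v) = (v.foldl rowStep (bottomRow u, [])).1 ∧
      bumped (u ++ v) = bumped u ++ (v.foldl rowStep (bottomRow u, [])).2 := by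
  have := foldl_rowStep v (bottomRow u) (bumped u)
  have h2 : (u ++ v).foldl rowStep (∅, []) = v.foldl rowStep (bottomRow u, bumped u) := by
    simp [bottomRow, bumped]
  simp only [bottomRow, bumped] at *
  rw [h2, this]
  simp

/-- Moving the letter bumped by `x` across the larger letters of a row. -/
theorem CKEquiv.bump_right {x y : ℕ} (hxy : x < y) (B : List ℕ) (hB : (y :: B).Pairwise (· < ·)) :
    CKEquiv (y :: B ++ [x]) (y :: x :: B) := by
  induction B generalizing y with
  | nil => exact CKEquiv.refl _
  | cons b B ih =>
    have hyb : y < b := by simp at hB; exact hB.1.1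
    have h1 := (ih (y := b) (by omega) (by simp at hB ⊢; exact hB.2)).cons y
    exact h1.trans (CKEquiv.swap_right hxy hyb B).symm

/-- Moving the bumped letter across the smaller letters of a row. -/
theorem CKEquiv.bump_left {y h : ℕ} (hy : h < y) (A B : List ℕ)
    (hA : (A ++ [h]).Pairwise (· < ·)) :
    CKEquiv (A ++ y :: h :: B) (y :: A ++ h :: B) := by
  induction A with
  | nil => exact CKEquiv.refl _
  | cons a A ih =>
    simp only [List.cons_append, List.pairwise_cons] at hA
    refine ((ih hA.2).cons a).trans ?_
    obtain ⟨e, t, he⟩ : ∃ e t, A ++ h :: B = e :: t := List.exists_cons_of_ne_nil (by simp)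
    have hmem : e ∈ A ++ [h] := by
      cases A with
      | nil => simp at he ⊢; exact he.1.symm
      | cons a' A => simp at he ⊢; exact Or.inl he.1.symm
    have hae : a < e := hA.1 e hmem
    have hey : e < y := by
      rcases List.mem_append.1 hmem with h' | h'
      · exact lt_trans ((List.pairwise_append.1 hA.2).2.2 e h' h (by simp)) hy
      · simp at h'; omega
    simp only [List.cons_append, he]
    exact (CKEquiv.swap_left hae hey t).symm

theorem exists_split_of_mem {L : List ℕ} (hL : L.Pairwise (· < ·)) {y : ℕ} (hy : y ∈ L) :
    ∃ A B, L = A ++ y :: B ∧ (∀ z, z ∈ A ↔ z ∈ L ∧ z < y) ∧ (∀ z, z ∈ B ↔ z ∈ L ∧ y < z) ∧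
      A.Pairwise (· < ·) ∧ B.Pairwise (· < ·) := by
  obtain ⟨A, B, rfl⟩ := List.append_of_mem hy
  rw [List.pairwise_append, List.pairwise_cons] at hL
  obtain ⟨h1, ⟨h2, h3⟩, h4⟩ := hL
  refine ⟨A, B, rfl, fun z => ?_, fun z => ?_, h1, h3⟩
  · have := fun h => h4 z h y (by simp)
    have := h2 z
    simp; grind
  · have := fun h => h4 z h y (by simp)
    have := h2 z
    simp; grind

/-- Reduced words are equivalent to the bumped word followed by the row word, and insertion
into the bottom row satisfies the admissibility condition. -/
theorem row_word_insert {R : Finset ℕ} {L : List ℕ} {x : ℕ} (hL : L.Pairwise (· < ·))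
    (hR : ∀ z, z ∈ L ↔ z ∈ R) (hred : IsReducedWord (L ++ [x])) :
    (x ∈ R → x + 1 ∈ R) ∧ ∃ L' : List ℕ, L'.Pairwise (· < ·) ∧
      (∀ z, z ∈ L' ↔ z ∈ rowIns R x) ∧
      CKEquiv (L ++ [x]) ((nextIn R x).toList ++ L') := by
  cases hn : nextIn R x with
  | none =>
    have hn' := nextIn_eq_none.1 hn
    have hx : x ∉ R := by
      intro hx
      obtain ⟨A, B, rfl, hA, hB, -, -⟩ := exists_split_of_mem hL ((hR x).2 hx)
      cases B with
      | nil => exact (show IsReducedWord (A ++ x :: x :: []) by simpa using hred).ne rfl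
      | cons b B =>
        have := (hB b).1 (by simp)
        have := hn' b ((hR b).1 this.1)
        omega
    refine ⟨fun h => absurd h hx, L ++ [x], ?_, fun z => ?_, by simpa using CKEquiv.refl _⟩
    · rw [List.pairwise_append]
      refine ⟨hL, by simp, fun a ha b hb => ?_⟩
      simp at hb; subst hb
      have := hn' a ((hR a).1 ha)
      have : a ≠ b := by rintro rfl; exact hx ((hR a).1 ha)
      omega
    · rw [mem_rowIns]; simp [hn, hR]; tauto
  | some y =>
    obtain ⟨hy, hxy, hmin⟩ := nextIn_eq_some.1 hn
    obtain ⟨A, B, rfl, hA, hB, hpA, hpB⟩ := exists_split_of_mem hL ((hR y).2 hy)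
    have hyB : (y :: B).Pairwise (· < ·) := (List.pairwise_append.1 hL).2.1
    have e1 : CKEquiv (A ++ y :: B ++ [x]) (A ++ y :: x :: B) := by
      simpa using (CKEquiv.bump_right hxy B hyB).append_left A
    have hAx : ∀ a ∈ A, a ≤ x := by
      intro a ha
      have := (hA a).1 ha
      by_contra hlt
      have := hmin a ((hR a).1 this.1) (by omega)
      omega
    by_cases hx : x ∈ R
    · obtain ⟨A', B', hA', hmA, hmB, hpA', -⟩ :=
        exists_split_of_mem hpA ((hA x).2 ⟨(hR x).2 hx, hxy⟩)
      have hB' : B' = [] := by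
        cases B' with
        | nil => rfl
        | cons b B' =>
          have := (hmB b).1 (by simp)
          have := hAx b this.1
          omega
      subst hB'
      subst hA'
      have hr := e1.isReducedWord hred
      have hy1 : y = x + 1 := by
        have := (show IsReducedWord (A' ++ x :: y :: x :: B) by simpa using hr).braid
        omega
      subst hy1
      refine ⟨fun _ => hy, A' ++ [x] ++ (x + 1) :: B, hL, fun z => ?_, ?_⟩
      · rw [mem_rowIns]; simp only [hR, hx]; grind
      · refine e1.trans ?_
        have e2 := ((CKEquiv.braid x B).append_left A').trans
          (CKEquiv.bump_left (show x < x + 1 by omega) A' ((x + 1) :: B) hpA)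
        simpa using e2
    · refine ⟨fun h => absurd h hx, A ++ x :: B, ?_, fun z => ?_, ?_⟩
      · rw [List.pairwise_append, List.pairwise_cons]
        refine ⟨hpA, ⟨fun b hb => ?_, hpB⟩, fun a ha b hb => ?_⟩
        · have := (hB b).1 hb; omega
        · have h1 := hAx a ha
          have : a ≠ x := by
            rintro rfl
            exact hx ((hR a).1 (by simp [ha]))
          rcases List.mem_cons.1 hb with rfl | hb
          · omega
          · have := (hB b).1 hb; omega
      · have := hR z
        rw [mem_rowIns, hn]
        have := hA z
        have := hB z
        simp at *
        grind
      · refine e1.trans ?_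
        have hpAx : (A ++ [x]).Pairwise (· < ·) := by
          rw [List.pairwise_append]
          refine ⟨hpA, by simp, fun a ha b hb => ?_⟩
          simp at hb; subst hb
          have h1 := hAx a ha
          have : a ≠ b := by
            rintro rfl
            exact hx ((hR a).1 (by simp [ha]))
          omega
        simpa using CKEquiv.bump_left hxy A B hpAx

theorem exists_row_word {ρ : List ℕ} (h : IsReducedWord ρ) :
    ∃ L : List ℕ, L.Pairwise (· < ·) ∧ (∀ z, z ∈ L ↔ z ∈ bottomRow ρ) ∧
      CKEquiv ρ (bumped ρ ++ L) := by
  induction ρ using List.reverseRecOn with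
  | nil => exact ⟨[], by simp, by simp, CKEquiv.refl _⟩
  | append_singleton ρ x ih =>
    obtain ⟨L, h1, h2, h3⟩ := ih h.left
    have h4 := h3.append_right [x]
    obtain ⟨-, L', h5, h6, h7⟩ := row_word_insert h1 h2
      (x := x) (by
        have := h4.isReducedWord h
        rw [List.append_assoc] at this
        exact this.right)
    refine ⟨L', h5, fun z => by rw [h6, bottomRow_concat], ?_⟩
    rw [bumped_concat]
    refine h4.trans ?_
    simpa using h7.append_left (bumped ρ)

theorem bottomRow_adm {ρ : List ℕ} {x : ℕ} (h : IsReducedWord (ρ ++ [x]))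
    (hx : x ∈ bottomRow ρ) : x + 1 ∈ bottomRow ρ := by
  obtain ⟨L, h1, h2, h3⟩ := exists_row_word h.left
  have h4 := (h3.append_right [x]).isReducedWord h
  rw [List.append_assoc] at h4
  exact (row_word_insert h1 h2 h4.right).1 hx

theorem IsReducedWord.bumped {ρ : List ℕ} (h : IsReducedWord ρ) : IsReducedWord (bumped ρ) := by
  obtain ⟨L, h1, h2, h3⟩ := exists_row_word h
  exact (h3.isReducedWord h).left

/-! ### Coxeter–Knuth moves and row insertion -/

theorem nextIn_congr {S T : Finset ℕ} {z : ℕ} (h : ∀ v, z < v → (v ∈ S ↔ v ∈ T)) :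
    nextIn S z = nextIn T z := by
  cases hT : nextIn T z with
  | none => rw [nextIn_eq_none] at hT ⊢; grind
  | some y => rw [nextIn_eq_some] at hT ⊢; grind

theorem rowIns_comm {S : Finset ℕ} {y z : ℕ} (hyz : y ≠ z)
    (h1 : nextIn (rowIns S y) z = nextIn S z) (h2 : nextIn (rowIns S z) y = nextIn S y)
    (h3 : nextIn S y ≠ some z) (h4 : nextIn S z ≠ some y) :
    rowIns (rowIns S y) z = rowIns (rowIns S z) y := by
  ext v
  simp only [mem_rowIns, h1, h2]
  grind

theorem nextIn_gt {R : Finset ℕ} {x y : ℕ} (h : nextIn R x = some y) : x < y :=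
  (nextIn_eq_some.1 h).2.1

theorem nextIn_mem {R : Finset ℕ} {x y : ℕ} (h : nextIn R x = some y) : y ∈ R :=
  (nextIn_eq_some.1 h).1

theorem nextIn_le {R : Finset ℕ} {x y z : ℕ} (h : nextIn R x = some y) (hz : z ∈ R)
    (hxz : x < z) : y ≤ z :=
  (nextIn_eq_some.1 h).2.2 z hz hxz

theorem exists_nextIn_le {R : Finset ℕ} {x z : ℕ} (hz : z ∈ R) (hxz : x < z) :
    ∃ y, nextIn R x = some y ∧ y ≤ z := by
  cases h : nextIn R x with
  | none => have := nextIn_eq_none.1 h z hz; omega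
  | some y => exact ⟨y, rfl, nextIn_le h hz hxz⟩

theorem self_mem_rowIns (R : Finset ℕ) (x : ℕ) : x ∈ rowIns R x := mem_rowIns.2 (Or.inl rfl)

/-- The letters bumped when inserting three letters into a row. -/
def tripleBumped (R : Finset ℕ) (x y z : ℕ) : List ℕ :=
  (nextIn R x).toList ++ ((nextIn (rowIns R x) y).toList ++
    (nextIn (rowIns (rowIns R x) y) z).toList)

theorem foldl_rowStep_three (R : Finset ℕ) (x y z : ℕ) :
    [x, y, z].foldl rowStep (R, []) = (rowIns (rowIns (rowIns R x) y) z, tripleBumped R x y z) := by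
  simp [rowStep, tripleBumped]

theorem nextIn_eq_of_gap {R S : Finset ℕ} {x z b : ℕ} (hz : z ≤ x) (hb : nextIn R x = some b)
    (h : ∀ v, z < v → (v ∈ S ↔ v ∈ R ∧ x < v ∧ v ≠ b)) : nextIn S z = nextIn R b := by
  have hb' := nextIn_eq_some.1 hb
  cases c : nextIn R b with
  | none => rw [nextIn_eq_none] at c ⊢; grind
  | some b2 => rw [nextIn_eq_some] at c ⊢; grind

theorem nextIn_rowIns_of_gap {S : Finset ℕ} {x y z : ℕ} (hx : x ∈ S) (hyx : y < x) (hxz : x ≤ z) :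
    nextIn (rowIns S y) z = nextIn S z := by
  obtain ⟨y', h1, h2⟩ := exists_nextIn_le hx hyx
  apply nextIn_congr
  intro v hv
  rw [mem_rowIns, h1]
  grind

theorem nextIn_rowIns_of_gap' {S : Finset ℕ} {x y z : ℕ} (hx : x ∈ S) (hyx : y < x) (hxz : x ≤ z) :
    nextIn (rowIns S z) y = nextIn S y := by
  obtain ⟨y', h1, h2⟩ := exists_nextIn_le hx hyx
  rw [h1]
  rw [nextIn_eq_some] at h1 ⊢
  simp only [mem_rowIns]
  have := @nextIn_gt S z
  grind

theorem row_swap_right {R : Finset ℕ} {x y z : ℕ} (hyx : y < x) (hxz : x < z)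
    (hx : x ∈ R → x + 1 ∈ R) :
    rowIns (rowIns (rowIns R x) y) z = rowIns (rowIns (rowIns R x) z) y ∧
      CKEquiv (tripleBumped R x y z) (tripleBumped R x z y) := by
  have hxS := self_mem_rowIns R x
  have h1 := nextIn_rowIns_of_gap hxS hyx hxz.le
  have h2 := nextIn_rowIns_of_gap' hxS hyx hxz.le
  obtain ⟨y', hy', hyx'⟩ := exists_nextIn_le hxS hyx
  refine ⟨rowIns_comm (by omega) h1 h2 (by grind) (fun h => ?_), ?_⟩
  · have := nextIn_gt h; omega
  · unfold tripleBumped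
    rw [h1, h2, hy']
    cases hz' : nextIn (rowIns R x) z with
    | none => simpa using CKEquiv.refl _
    | some z' =>
      have hzz := nextIn_gt hz'
      have hm := nextIn_mem hz'
      rw [mem_rowIns] at hm
      obtain ⟨x', hx', -⟩ := exists_nextIn_le (x := x) (show z' ∈ R by grind) (by omega)
      have hlt : x' < z' := by
        have := nextIn_eq_some.1 hx'
        grind
      have := nextIn_gt hx'
      rw [hx']
      exact CKEquiv.swap_right (by omega) hlt []

theorem row_swap_left {R : Finset ℕ} {x y z : ℕ} (hyz : y < z) (hzx : z < x)
    (hx : x ∈ R → x + 1 ∈ R) (hy : y ∈ R → y + 1 ∈ R) :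
    rowIns (rowIns (rowIns R x) y) z = rowIns (rowIns (rowIns R y) x) z ∧
      CKEquiv (tripleBumped R x y z) (tripleBumped R y x z) := by
  by_cases hI : ∃ r ∈ R, y < r ∧ r < x
  · obtain ⟨r, hr, hyr, hrx⟩ := hI
    have h1 := nextIn_rowIns_of_gap hr hyr hrx.le
    have h2 := nextIn_rowIns_of_gap' hr hyr hrx.le
    obtain ⟨a, ha, har⟩ := exists_nextIn_le hr hyr
    have hc : rowIns (rowIns R x) y = rowIns (rowIns R y) x :=
      rowIns_comm (by omega) h2 h1 (fun h => by have := nextIn_gt h; omega) (by grind)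
    refine ⟨by rw [hc], ?_⟩
    unfold tripleBumped
    rw [h1, h2, hc, ha]
    obtain ⟨z', hz', hzx'⟩ := exists_nextIn_le (self_mem_rowIns (rowIns R y) x) hzx
    rw [hz']
    cases hx' : nextIn R x with
    | none => simpa using CKEquiv.refl _
    | some x' =>
      have hxx := nextIn_gt hx'
      have haz : a < z' := by
        have h5 := nextIn_eq_some.1 hz'
        have h6 := nextIn_eq_some.1 ha
        simp only [mem_rowIns] at h5
        grind
      exact CKEquiv.swap_left haz (by omega) []
  · push Not at hI
    have hyR : y ∉ R := fun h => by have := hI _ (hy h) (by omega); omega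
    by_cases hxR : x ∈ R
    · have a1 : nextIn R x = some (x + 1) := nextIn_eq_some.2 ⟨hx hxR, by omega, by grind⟩
      have m1 := fun v => @mem_rowIns R x v
      simp only [a1, ne_eq, Option.some.injEq] at m1
      have a2 : nextIn (rowIns R x) y = some x := nextIn_eq_some.2 ⟨by grind, by omega, by grind⟩
      have m2 := fun v => @mem_rowIns (rowIns R x) y v
      simp only [a2, ne_eq, Option.some.injEq] at m2
      have a3 : nextIn (rowIns (rowIns R x) y) z = some (x + 1) :=
        nextIn_eq_some.2 ⟨by grind, by omega, by grind⟩
      have m3 := fun v => @mem_rowIns (rowIns (rowIns R x) y) z v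
      simp only [a3, ne_eq, Option.some.injEq] at m3
      have b1 : nextIn R y = some x := nextIn_eq_some.2 ⟨by grind, by omega, by grind⟩
      have n1 := fun v => @mem_rowIns R y v
      simp only [b1, ne_eq, Option.some.injEq] at n1
      have b2 : nextIn (rowIns R y) x = some (x + 1) :=
        nextIn_eq_some.2 ⟨by grind, by omega, by grind⟩
      have n2 := fun v => @mem_rowIns (rowIns R y) x v
      simp only [b2, ne_eq, Option.some.injEq] at n2
      have b3 : nextIn (rowIns (rowIns R y) x) z = some x :=
        nextIn_eq_some.2 ⟨by grind, by omega, by grind⟩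
      have n3 := fun v => @mem_rowIns (rowIns (rowIns R y) x) z v
      simp only [b3, ne_eq, Option.some.injEq] at n3
      refine ⟨by ext v; grind, ?_⟩
      unfold tripleBumped
      rw [a1, a2, a3, b1, b2, b3]
      exact (CKEquiv.braid x []).symm
    · cases a1 : nextIn R x with
      | none =>
        have a1' := nextIn_eq_none.1 a1
        have m1 := fun v => @mem_rowIns R x v
        simp only [a1, ne_eq] at m1
        have a2 : nextIn (rowIns R x) y = some x := nextIn_eq_some.2 ⟨by grind, by omega, by grind⟩
        have m2 := fun v => @mem_rowIns (rowIns R x) y v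
        simp only [a2, ne_eq, Option.some.injEq] at m2
        have a3 : nextIn (rowIns (rowIns R x) y) z = none := nextIn_eq_none.2 (by grind)
        have m3 := fun v => @mem_rowIns (rowIns (rowIns R x) y) z v
        simp only [a3, ne_eq] at m3
        have b1 : nextIn R y = none := nextIn_eq_none.2 (by grind)
        have n1 := fun v => @mem_rowIns R y v
        simp only [b1, ne_eq] at n1
        have b2 : nextIn (rowIns R y) x = none := nextIn_eq_none.2 (by grind)
        have n2 := fun v => @mem_rowIns (rowIns R y) x v
        simp only [b2, ne_eq] at n2
        have b3 : nextIn (rowIns (rowIns R y) x) z = some x :=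
          nextIn_eq_some.2 ⟨by grind, by omega, by grind⟩
        have n3 := fun v => @mem_rowIns (rowIns (rowIns R y) x) z v
        simp only [b3, ne_eq, Option.some.injEq] at n3
        refine ⟨by ext v; grind, ?_⟩
        unfold tripleBumped
        rw [a1, a2, a3, b1, b2, b3]
        exact CKEquiv.refl _
      | some b =>
        have a1' := nextIn_eq_some.1 a1
        have m1 := fun v => @mem_rowIns R x v
        simp only [a1, ne_eq, Option.some.injEq] at m1
        have a2 : nextIn (rowIns R x) y = some x := nextIn_eq_some.2 ⟨by grind, by omega, by grind⟩
        have m2 := fun v => @mem_rowIns (rowIns R x) y v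
        simp only [a2, ne_eq, Option.some.injEq] at m2
        have b1 : nextIn R y = some b := nextIn_eq_some.2 ⟨by grind, by omega, by grind⟩
        have n1 := fun v => @mem_rowIns R y v
        simp only [b1, ne_eq, Option.some.injEq] at n1
        have hS : ∀ v, z ≤ v → (v ∈ rowIns (rowIns R x) y ↔ v ∈ R ∧ x < v ∧ v ≠ b) := by grind
        have hT : ∀ v, z ≤ v → (v ∈ rowIns R y ↔ v ∈ R ∧ x < v ∧ v ≠ b) := by grind
        have hzz : nextIn (rowIns (rowIns R x) y) z = nextIn R b :=
          nextIn_eq_of_gap (x := x) (by omega) a1 fun v hv => hS v hv.le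
        have hxx : nextIn (rowIns R y) x = nextIn R b :=
          nextIn_eq_of_gap (x := x) le_rfl a1 fun v hv => hT v (by omega)
        have n2 := fun v => @mem_rowIns (rowIns R y) x v
        have b3 : nextIn (rowIns (rowIns R y) x) z = some x :=
          nextIn_eq_some.2 ⟨by grind, by omega, by grind⟩
        refine ⟨by ext v; simp only [mem_rowIns, a1, a2, b1, b3, hxx, hzz]; grind, ?_⟩
        unfold tripleBumped
        rw [a1, a2, hzz, b1, hxx, b3]
        cases c : nextIn R b with
        | none => exact CKEquiv.refl _
        | some b2 => exact CKEquiv.swap_right (nextIn_gt a1) (nextIn_gt c) []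

theorem row_braid {R : Finset ℕ} {i : ℕ} (h1 : i ∈ R → i + 1 ∈ R)
    (h2 : i + 1 ∈ rowIns R i → i + 2 ∈ rowIns R i) (h3 : i + 1 ∈ R → i + 2 ∈ R) :
    rowIns (rowIns (rowIns R i) (i + 1)) i = rowIns (rowIns (rowIns R (i + 1)) i) (i + 1) ∧
      CKEquiv (tripleBumped R i (i + 1) i) (tripleBumped R (i + 1) i (i + 1)) := by
  by_cases hi1 : i + 1 ∈ R
  · have a1 : nextIn R i = some (i + 1) := nextIn_eq_some.2 ⟨hi1, by omega, by grind⟩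
    have m1 := fun v => @mem_rowIns R i v
    simp only [a1, ne_eq, Option.some.injEq] at m1
    have b1 : nextIn R (i + 1) = some (i + 2) := nextIn_eq_some.2 ⟨h3 hi1, by omega, by grind⟩
    have n1 := fun v => @mem_rowIns R (i + 1) v
    simp only [b1, ne_eq, Option.some.injEq] at n1
    have a2 : nextIn (rowIns R i) (i + 1) = some (i + 2) :=
      nextIn_eq_some.2 ⟨by grind, by omega, by grind⟩
    have m2 := fun v => @mem_rowIns (rowIns R i) (i + 1) v
    simp only [a2, ne_eq, Option.some.injEq] at m2
    have a3 : nextIn (rowIns (rowIns R i) (i + 1)) i = some (i + 1) :=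
      nextIn_eq_some.2 ⟨by grind, by omega, by grind⟩
    have m3 := fun v => @mem_rowIns (rowIns (rowIns R i) (i + 1)) i v
    simp only [a3, ne_eq, Option.some.injEq] at m3
    have b2 : nextIn (rowIns R (i + 1)) i = some (i + 1) :=
      nextIn_eq_some.2 ⟨by grind, by omega, by grind⟩
    have n2 := fun v => @mem_rowIns (rowIns R (i + 1)) i v
    simp only [b2, ne_eq, Option.some.injEq] at n2
    have b3 : nextIn (rowIns (rowIns R (i + 1)) i) (i + 1) = some (i + 2) :=
      nextIn_eq_some.2 ⟨by grind, by omega, by grind⟩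
    have n3 := fun v => @mem_rowIns (rowIns (rowIns R (i + 1)) i) (i + 1) v
    simp only [b3, ne_eq, Option.some.injEq] at n3
    refine ⟨by ext v; grind, ?_⟩
    unfold tripleBumped
    rw [a1, a2, a3, b1, b2, b3]
    exact CKEquiv.braid (i + 1) []
  · have hi : i ∉ R := fun h => hi1 (h1 h)
    cases a1 : nextIn R i with
    | none =>
      have a1' := nextIn_eq_none.1 a1
      have m1 := fun v => @mem_rowIns R i v
      simp only [a1, ne_eq] at m1
      have b1 : nextIn R (i + 1) = none := nextIn_eq_none.2 (by grind)
      have n1 := fun v => @mem_rowIns R (i + 1) v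
      simp only [b1, ne_eq] at n1
      have a2 : nextIn (rowIns R i) (i + 1) = none := nextIn_eq_none.2 (by grind)
      have m2 := fun v => @mem_rowIns (rowIns R i) (i + 1) v
      simp only [a2, ne_eq] at m2
      have a3 : nextIn (rowIns (rowIns R i) (i + 1)) i = some (i + 1) :=
        nextIn_eq_some.2 ⟨by grind, by omega, by grind⟩
      have m3 := fun v => @mem_rowIns (rowIns (rowIns R i) (i + 1)) i v
      simp only [a3, ne_eq, Option.some.injEq] at m3
      have b2 : nextIn (rowIns R (i + 1)) i = some (i + 1) :=
        nextIn_eq_some.2 ⟨by grind, by omega, by grind⟩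
      have n2 := fun v => @mem_rowIns (rowIns R (i + 1)) i v
      simp only [b2, ne_eq, Option.some.injEq] at n2
      have b3 : nextIn (rowIns (rowIns R (i + 1)) i) (i + 1) = none := nextIn_eq_none.2 (by grind)
      have n3 := fun v => @mem_rowIns (rowIns (rowIns R (i + 1)) i) (i + 1) v
      simp only [b3, ne_eq] at n3
      refine ⟨by ext v; grind, ?_⟩
      unfold tripleBumped
      rw [a1, a2, a3, b1, b2, b3]
      exact CKEquiv.refl _
    | some b =>
      have a1' := nextIn_eq_some.1 a1
      have m1 := fun v => @mem_rowIns R i v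
      simp only [a1, ne_eq, Option.some.injEq] at m1
      have b1 : nextIn R (i + 1) = some b := nextIn_eq_some.2 ⟨by grind, by grind, by grind⟩
      have n1 := fun v => @mem_rowIns R (i + 1) v
      simp only [b1, ne_eq, Option.some.injEq] at n1
      have hzz : nextIn (rowIns R i) (i + 1) = nextIn R b := by
        cases c : nextIn R b with
        | none => rw [nextIn_eq_none] at c ⊢; grind
        | some b2 => rw [nextIn_eq_some] at c ⊢; grind
      have m2 := fun v => @mem_rowIns (rowIns R i) (i + 1) v
      have a3 : nextIn (rowIns (rowIns R i) (i + 1)) i = some (i + 1) :=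
        nextIn_eq_some.2 ⟨by grind, by omega, by grind⟩
      have b2 : nextIn (rowIns R (i + 1)) i = some (i + 1) :=
        nextIn_eq_some.2 ⟨by grind, by omega, by grind⟩
      have n2 := fun v => @mem_rowIns (rowIns R (i + 1)) i v
      simp only [b2, ne_eq, Option.some.injEq] at n2
      have hxx : nextIn (rowIns (rowIns R (i + 1)) i) (i + 1) = nextIn R b := by
        cases c : nextIn R b with
        | none => rw [nextIn_eq_none] at c ⊢; grind
        | some b2 => rw [nextIn_eq_some] at c ⊢; grind
      have d1 : nextIn R b ≠ some i := fun h => by have := nextIn_gt h; omega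
      have d2 : nextIn R b ≠ some (i + 1) := fun h => by have := nextIn_gt h; omega
      refine ⟨?_, ?_⟩
      · ext v
        simp only [mem_rowIns, a1, a3, b1, b2, hxx, hzz, ne_eq, Option.some.injEq]
        rcases eq_or_ne v i with rfl | hv
        · simp [hi, hi1, d1]
        · rcases eq_or_ne v (i + 1) with rfl | hv'
          · simp [d1]
          · simp [hv, hv', Ne.symm hv', hi, hi1]
      unfold tripleBumped
      rw [a1, a3, hzz, b1, hxx, b2]
      cases c : nextIn R b with
      | none => exact CKEquiv.refl _
      | some b2 => exact (CKEquiv.swap_right (show i + 1 < b by grind) (nextIn_gt c) []).symm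

/-! ### The tableau of a reduced word -/

theorem CKEquiv.bottomRow_bumped {u v : List ℕ} (h : CKEquiv u v) (hu : IsReducedWord u) :
    bottomRow u = bottomRow v ∧ CKEquiv (bumped u) (bumped v) := by
  induction h with
  | rel u v h =>
    have hv : IsReducedWord v := CKEquiv.isReducedWord (Relation.EqvGen.rel _ _ h) hu
    have key : ∀ (a b : List ℕ) (t t' : List ℕ), u = a ++ t ++ b → v = a ++ t' ++ b →
        (t.foldl rowStep (bottomRow a, [])).1 = (t'.foldl rowStep (bottomRow a, [])).1 →
        CKEquiv (t.foldl rowStep (bottomRow a, [])).2 (t'.foldl rowStep (bottomRow a, [])).2 →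
        bottomRow u = bottomRow v ∧ CKEquiv (bumped u) (bumped v) := by
      rintro a b t t' rfl rfl h1 h2
      obtain ⟨a1, a2⟩ := fold_rowStep_append a t
      obtain ⟨b1, b2⟩ := fold_rowStep_append a t'
      obtain ⟨c1, c2⟩ := fold_rowStep_append (a ++ t) b
      obtain ⟨d1, d2⟩ := fold_rowStep_append (a ++ t') b
      rw [c1, c2, d1, d2, a1, a2, b1, b2, h1]
      exact ⟨rfl, (h2.append_left _).append_right _⟩
    rcases h with ⟨a, b, x, y, z, h1, h2, rfl, rfl⟩ | ⟨a, b, x, y, z, h1, h2, rfl, rfl⟩ |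
      ⟨a, b, i, rfl, rfl⟩
    · have r1 : IsReducedWord (a ++ [x]) :=
        IsReducedWord.left (b := y :: z :: b) (by simpa using hu)
      obtain ⟨k1, k2⟩ := row_swap_right h1 h2 (bottomRow_adm r1)
      refine key a b _ _ rfl rfl ?_ ?_ <;> simp only [foldl_rowStep_three] <;> assumption
    · have r1 : IsReducedWord (a ++ [x]) :=
        IsReducedWord.left (b := y :: z :: b) (by simpa using hu)
      have r2 : IsReducedWord (a ++ [y]) :=
        IsReducedWord.left (b := x :: z :: b) (by simpa using hv)
      obtain ⟨k1, k2⟩ := row_swap_left h1 h2 (bottomRow_adm r1) (bottomRow_adm r2)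
      refine key a b _ _ rfl rfl ?_ ?_ <;> simp only [foldl_rowStep_three] <;> assumption
    · have r1 : IsReducedWord (a ++ [i]) :=
        IsReducedWord.left (b := (i + 1) :: i :: b) (by simpa using hu)
      have r2 : IsReducedWord ((a ++ [i]) ++ [i + 1]) :=
        IsReducedWord.left (b := i :: b) (by simpa using hu)
      have r3 : IsReducedWord (a ++ [i + 1]) :=
        IsReducedWord.left (b := i :: (i + 1) :: b) (by simpa using hv)
      obtain ⟨k1, k2⟩ := row_braid (bottomRow_adm r1)
        (by rw [← bottomRow_concat]; exact bottomRow_adm r2) (bottomRow_adm r3)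
      refine key a b _ _ rfl rfl ?_ ?_ <;> simp only [foldl_rowStep_three] <;> assumption
  | refl u => exact ⟨rfl, CKEquiv.refl _⟩
  | symm u v h ih =>
    have := ih (CKEquiv.isReducedWord (CKEquiv.symm h) hu)
    exact ⟨this.1.symm, this.2.symm⟩
  | trans u v t h h' ih ih' =>
    have h1 := ih hu
    have h2 := ih' (CKEquiv.isReducedWord h hu)
    exact ⟨h1.1.trans h2.1, h1.2.trans h2.2⟩

/-- The rows of the Edelman–Greene tableau of a word, from the bottom. -/
def egRow (ρ : List ℕ) (k : ℕ) : Finset ℕ := bottomRow (bumped^[k] ρ)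

/-- The row lengths of the Edelman–Greene tableau of a word. -/
def egShape (ρ : List ℕ) (k : ℕ) : ℕ := (egRow ρ k).card

theorem egRow_zero (ρ : List ℕ) : egRow ρ 0 = bottomRow ρ := rfl
theorem egRow_succ (ρ : List ℕ) (k : ℕ) : egRow ρ (k + 1) = egRow (bumped ρ) k := rfl
theorem egShape_zero (ρ : List ℕ) : egShape ρ 0 = (bottomRow ρ).card := rfl
theorem egShape_succ (ρ : List ℕ) (k : ℕ) : egShape ρ (k + 1) = egShape (bumped ρ) k := rfl

theorem CKEquiv.egRow_eq {u v : List ℕ} (h : CKEquiv u v) (hu : IsReducedWord u) :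
    egRow u = egRow v := by
  funext k
  induction k generalizing u v with
  | zero => exact (h.bottomRow_bumped hu).1
  | succ k ih => exact ih (h.bottomRow_bumped hu).2 hu.bumped

theorem CKEquiv.egShape_eq {u v : List ℕ} (h : CKEquiv u v) (hu : IsReducedWord u) :
    egShape u = egShape v := by
  funext k
  rw [egShape, h.egRow_eq hu, egShape]

theorem nextIn_mem_of_mem {ρ : List ℕ} {x : ℕ} (h : IsReducedWord (ρ ++ [x]))
    (hx : x ∈ bottomRow ρ) : nextIn (bottomRow ρ) x = some (x + 1) :=
  nextIn_eq_some.2 ⟨bottomRow_adm h hx, by omega, by grind⟩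

theorem bumped_concat_reduced {ρ : List ℕ} {x y : ℕ} (h : IsReducedWord (ρ ++ [x]))
    (hy : nextIn (bottomRow ρ) x = some y) : IsReducedWord (bumped ρ ++ [y]) := by
  have := h.bumped
  rw [bumped_concat, hy] at this
  exact this

theorem card_rowIns_some {R : Finset ℕ} {x y : ℕ} (hy : nextIn R x = some y) :
    (rowIns R x).card = R.card := by
  unfold rowIns
  rw [hy]
  split_ifs with hx
  · simp
  · have := nextIn_gt hy
    have h1 := nextIn_mem hy
    have : x ∉ R.erase y := by simp [hx]
    show (insert x (R.erase y)).card = R.card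
    rw [Finset.card_insert_of_notMem this, Finset.card_erase_of_mem h1]
    have : 0 < R.card := Finset.card_pos.2 ⟨y, h1⟩
    omega

theorem card_rowIns_none {R : Finset ℕ} {x : ℕ} (hx : nextIn R x = none) (h : x ∉ R) :
    (rowIns R x).card = R.card + 1 := by
  unfold rowIns
  rw [hx]
  exact Finset.card_insert_of_notMem h

theorem bumped_length (ρ : List ℕ) (h : IsReducedWord ρ) :
    (bumped ρ).length + (bottomRow ρ).card = ρ.length := by
  induction ρ using List.reverseRecOn with
  | nil => simp
  | append_singleton ρ x ih =>
    have := ih h.left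
    rw [bumped_concat, bottomRow_concat]
    cases hn : nextIn (bottomRow ρ) x with
    | none =>
      rw [card_rowIns_none hn fun hx => by rw [nextIn_mem_of_mem h hx] at hn; cases hn]
      simp; omega
    | some y =>
      rw [card_rowIns_some hn]
      simp; omega

theorem bottomRow_nonempty {ρ : List ℕ} (h : ρ ≠ []) : (bottomRow ρ).Nonempty := by
  induction ρ using List.reverseRecOn with
  | nil => exact absurd rfl h
  | append_singleton ρ x ih =>
    rw [bottomRow_concat]
    exact ⟨x, self_mem_rowIns _ _⟩

theorem bumped_length_lt {ρ : List ℕ} (h : IsReducedWord ρ) (hne : ρ ≠ []) :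
    (bumped ρ).length < ρ.length := by
  have := bumped_length ρ h
  have := Finset.card_pos.2 (bottomRow_nonempty hne)
  omega

theorem concat_bumped_length_le {ρ : List ℕ} {x : ℕ} (h : IsReducedWord (ρ ++ [x]))
    {y : ℕ} (hy : nextIn (bottomRow ρ) x = some y) : (bumped ρ).length < ρ.length := by
  apply bumped_length_lt h.left
  rintro rfl
  simp [nextIn_eq_some] at hy

/-- Strong induction for insertion of a letter in a reduced word. -/
theorem reduced_concat_induction {motive : ∀ ρ x, IsReducedWord (ρ ++ [x]) → Prop}
    (none : ∀ ρ x (h : IsReducedWord (ρ ++ [x])), x ∉ bottomRow ρ → (∀ z ∈ bottomRow ρ, z < x) →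
      motive ρ x h)
    (some : ∀ ρ x y (h : IsReducedWord (ρ ++ [x])) (h' : IsReducedWord (bumped ρ ++ [y])),
      nextIn (bottomRow ρ) x = some y → motive (bumped ρ) y h' → motive ρ x h)
    (ρ : List ℕ) (x : ℕ) (h : IsReducedWord (ρ ++ [x])) : motive ρ x h := by
  induction hn : ρ.length using Nat.strong_induction_on generalizing ρ x with
  | _ n ih =>
    cases hx : nextIn (bottomRow ρ) x with
    | none =>
      have h1 := nextIn_eq_none.1 hx
      have h2 : x ∉ bottomRow ρ := fun h2 => by rw [nextIn_mem_of_mem h h2] at hx; cases hx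
      exact none ρ x h h2 fun z hz => lt_of_le_of_ne (h1 z hz) (by rintro rfl; exact h2 hz)
    | some y =>
      exact some ρ x y h (bumped_concat_reduced h hx) hx
        (ih _ (by have := concat_bumped_length_le h hx; omega) _ _ (bumped_concat_reduced h hx) rfl)

theorem exists_egShape_concat {ρ : List ℕ} {x : ℕ} (h : IsReducedWord (ρ ++ [x])) :
    ∃ a, egShape (ρ ++ [x]) = Function.update (egShape ρ) a (egShape ρ a + 1) := by
  induction ρ, x, h using reduced_concat_induction with
  | none ρ x h hx hlt =>
    have hn : nextIn (bottomRow ρ) x = none := nextIn_eq_none.2 fun z hz => (hlt z hz).le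
    refine ⟨0, ?_⟩
    funext k
    cases k with
    | zero => simp [egShape_zero, bottomRow_concat, card_rowIns_none hn hx]
    | succ k => simp [egShape_succ, bumped_concat, hn]
  | some ρ x y h h' hy ih =>
    obtain ⟨a, ha⟩ := ih
    refine ⟨a + 1, ?_⟩
    funext k
    cases k with
    | zero => simp [egShape_zero, bottomRow_concat, card_rowIns_some hy]
    | succ k =>
      rw [egShape_succ, bumped_concat, hy]
      simp only [Option.toList_some, ha, Function.update_apply, egShape_succ]
      simp

open Classical in
/-- The row of the box added when inserting `x` into the tableau of `ρ`. -/
noncomputable def boxRow (ρ : List ℕ) (x : ℕ) : ℕ :=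
  if h : ∃ a, egShape (ρ ++ [x]) = Function.update (egShape ρ) a (egShape ρ a + 1) then h.choose
  else 0

theorem egShape_concat {ρ : List ℕ} {x : ℕ} (h : IsReducedWord (ρ ++ [x])) :
    egShape (ρ ++ [x]) = Function.update (egShape ρ) (boxRow ρ x) (egShape ρ (boxRow ρ x) + 1) := by
  unfold boxRow
  rw [dif_pos (exists_egShape_concat h)]
  exact (exists_egShape_concat h).choose_spec

theorem egShape_concat_apply {ρ : List ℕ} {x : ℕ} (h : IsReducedWord (ρ ++ [x])) (k : ℕ) :
    egShape (ρ ++ [x]) k = egShape ρ k + if k = boxRow ρ x then 1 else 0 := by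
  rw [egShape_concat h, Function.update_apply]
  split_ifs with hk
  · rw [hk]
  · rfl

theorem boxRow_eq_of {ρ : List ℕ} {x a : ℕ} (h : IsReducedWord (ρ ++ [x]))
    (ha : egShape (ρ ++ [x]) a ≠ egShape ρ a) : boxRow ρ x = a := by
  rw [egShape_concat_apply h] at ha
  by_contra hne
  rw [if_neg (Ne.symm hne)] at ha
  exact ha rfl

theorem boxRow_none {ρ : List ℕ} {x : ℕ} (h : IsReducedWord (ρ ++ [x]))
    (hn : nextIn (bottomRow ρ) x = none) : boxRow ρ x = 0 := by
  apply boxRow_eq_of h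
  have hx : x ∉ bottomRow ρ := fun h2 => by rw [nextIn_mem_of_mem h h2] at hn; cases hn
  simp [egShape_zero, bottomRow_concat, card_rowIns_none hn hx]

theorem boxRow_some {ρ : List ℕ} {x y : ℕ} (h : IsReducedWord (ρ ++ [x]))
    (hy : nextIn (bottomRow ρ) x = some y) : boxRow ρ x = boxRow (bumped ρ) y + 1 := by
  apply boxRow_eq_of h
  rw [egShape_succ, bumped_concat, hy]
  simp only [Option.toList_some]
  rw [egShape_concat_apply (bumped_concat_reduced h hy), egShape_succ]
  simp

theorem boxRow_eq_zero_iff {ρ : List ℕ} {x : ℕ} (h : IsReducedWord (ρ ++ [x])) :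
    boxRow ρ x = 0 ↔ nextIn (bottomRow ρ) x = none := by
  refine ⟨fun h0 => ?_, boxRow_none h⟩
  cases hn : nextIn (bottomRow ρ) x with
  | none => rfl
  | some y => rw [boxRow_some h hn] at h0; omega

theorem CKEquiv.boxRow_eq {ρ σ : List ℕ} {x : ℕ} (h : CKEquiv ρ σ) (hr : IsReducedWord (ρ ++ [x])) :
    boxRow ρ x = boxRow σ x := by
  have h1 := h.append_right [x]
  refine boxRow_eq_of hr ?_
  rw [h1.egShape_eq hr, h.egShape_eq hr.left, egShape_concat_apply (h1.isReducedWord hr)]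
  simp

/-! ### Comparison of successive insertions -/

theorem boxRow_boxRow {ρ : List ℕ} {x y : ℕ} (h : IsReducedWord (ρ ++ [x] ++ [y])) :
    (x < y → boxRow (ρ ++ [x]) y ≤ boxRow ρ x) ∧ (y < x → boxRow ρ x < boxRow (ρ ++ [x]) y) := by
  induction ρ, x, h.left using reduced_concat_induction generalizing y with
  | none ρ x h1 hx hlt =>
    have hn : nextIn (bottomRow ρ) x = none := nextIn_eq_none.2 fun z hz => (hlt z hz).le
    rw [boxRow_none h1 hn]
    refine ⟨fun hxy => ?_, fun hyx => ?_⟩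
    · rw [boxRow_none h]
      rw [nextIn_eq_none, bottomRow_concat]
      intro z hz
      rw [mem_rowIns] at hz
      grind
    · obtain ⟨y', hy, -⟩ := exists_nextIn_le (self_mem_rowIns (bottomRow ρ) x) hyx
      rw [← bottomRow_concat] at hy
      rw [boxRow_some h hy]
      omega
  | some ρ x x' h1 h2 hx' ih =>
    rw [boxRow_some h1 hx']
    have hx := nextIn_eq_some.1 hx'
    have hb : bumped (ρ ++ [x]) = bumped ρ ++ [x'] := by rw [bumped_concat, hx']; rfl
    refine ⟨fun hxy => ?_, fun hyx => ?_⟩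
    · cases hy : nextIn (bottomRow (ρ ++ [x])) y with
      | none => rw [boxRow_none h hy]; omega
      | some y' =>
        rw [boxRow_some h hy, hb]
        have hr := bumped_concat_reduced h hy
        rw [hb] at hr
        have hy' := nextIn_eq_some.1 hy
        rw [bottomRow_concat, mem_rowIns, hx'] at hy'
        have : x' < y' := by
          by_cases hxR : x ∈ bottomRow ρ
          · rw [nextIn_mem_of_mem h1 hxR] at hx'
            grind
          · grind
        have := (ih hr).1 this
        omega
    · have hx2 := self_mem_rowIns (bottomRow ρ) x
      rw [← bottomRow_concat] at hx2
      obtain ⟨y', hy, hy'⟩ := exists_nextIn_le hx2 hyx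
      rw [boxRow_some h hy, hb]
      have hr := bumped_concat_reduced h hy
      rw [hb] at hr
      have := (ih hr).2 (by omega)
      omega

/-- Insertion is determined by the resulting tableau and the row of the new box. -/
theorem concat_injective {ρ ρ' : List ℕ} {x x' : ℕ} (h : IsReducedWord (ρ ++ [x]))
    (h' : IsReducedWord (ρ' ++ [x'])) (hb : boxRow ρ x = boxRow ρ' x')
    (hP : egRow (ρ ++ [x]) = egRow (ρ' ++ [x'])) : x = x' ∧ egRow ρ = egRow ρ' := by
  induction ρ, x, h using reduced_concat_induction generalizing ρ' x' with
  | none ρ x h1 hx hlt =>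
    have hn : nextIn (bottomRow ρ) x = none := nextIn_eq_none.2 fun z hz => (hlt z hz).le
    rw [boxRow_none h1 hn, eq_comm, boxRow_eq_zero_iff h'] at hb
    have hx' : x' ∉ bottomRow ρ' := fun h2 => by rw [nextIn_mem_of_mem h' h2] at hb; cases hb
    have hR := congrFun hP 0
    rw [egRow_zero, egRow_zero, bottomRow_concat, bottomRow_concat, Finset.ext_iff] at hR
    simp only [mem_rowIns, hn, hb] at hR
    have hb' := nextIn_eq_none.1 hb
    have hxx : x = x' := by
      have := hR x
      have := hR x'
      grind
    refine ⟨hxx, ?_⟩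
    funext k
    cases k with
    | zero =>
      rw [egRow_zero, egRow_zero]
      ext v
      have := hR v
      grind
    | succ k =>
      have := congrFun hP (k + 1)
      simpa [egRow_succ, bumped_concat, hn, hb] using this
  | some ρ x y h1 h2 hy ih =>
    rw [boxRow_some h1 hy] at hb
    cases hy' : nextIn (bottomRow ρ') x' with
    | none => rw [boxRow_none h' hy'] at hb; omega
    | some y' =>
      rw [boxRow_some h' hy'] at hb
      obtain ⟨rfl, hP'⟩ := ih (bumped_concat_reduced h' hy') (by omega) (by
        funext k
        have := congrFun hP (k + 1)
        simpa [egRow_succ, bumped_concat, hy, hy'] using this)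
      have hR := congrFun hP 0
      rw [egRow_zero, egRow_zero, bottomRow_concat, bottomRow_concat, Finset.ext_iff] at hR
      have a1 := nextIn_eq_some.1 hy
      have a2 := nextIn_eq_some.1 hy'
      simp only [mem_rowIns, hy, hy', ne_eq, Option.some.injEq] at hR
      have hxx : x = x' := by
        have := hR x
        have := hR x'
        grind
      subst hxx
      refine ⟨rfl, ?_⟩
      funext k
      cases k with
      | zero =>
        rw [egRow_zero, egRow_zero]
        have := hR y
        ext v
        have := hR v
        grind
      | succ k => exact congrFun hP' k

/-! ### The shape is a partition -/

/-- The number of elements of `R` below `v`. -/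
def countLt (R : Finset ℕ) (v : ℕ) : ℕ := (R.filter (· < v)).card

theorem countLt_succ (R : Finset ℕ) (v : ℕ) :
    countLt R (v + 1) = countLt R v + if v ∈ R then 1 else 0 := by
  unfold countLt
  split_ifs with h
  · rw [← Finset.card_insert_of_notMem (a := v) (by simp)]
    congr 1
    ext z
    simp only [Finset.mem_filter, Finset.mem_insert]
    grind
  · congr 1
    ext z
    simp only [Finset.mem_filter]
    grind

theorem countLt_mono (R : Finset ℕ) : Monotone (countLt R) :=
  monotone_nat_of_le_succ fun v => by rw [countLt_succ]; omega

theorem countLt_eq_of_gap {R : Finset ℕ} {v w : ℕ} (hvw : v ≤ w)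
    (h : ∀ z ∈ R, v ≤ z → w ≤ z) : countLt R w = countLt R v := by
  unfold countLt
  congr 1
  ext z
  simp only [Finset.mem_filter]
  grind

theorem countLt_rowIns_some {R : Finset ℕ} {x y : ℕ} (hy : nextIn R x = some y) (v : ℕ) :
    countLt (rowIns R x) v = countLt R v + if x ∉ R ∧ x < v ∧ v ≤ y then 1 else 0 := by
  have hy' := nextIn_eq_some.1 hy
  induction v with
  | zero => simp [countLt]
  | succ v ih =>
    rw [countLt_succ, countLt_succ, ih]
    have := @mem_rowIns R x v
    rw [hy] at this
    grind

theorem countLt_rowIns_none {R : Finset ℕ} {x : ℕ} (hy : nextIn R x = none) (hx : x ∉ R) (v : ℕ) :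
    countLt (rowIns R x) v = countLt R v + if x < v then 1 else 0 := by
  induction v with
  | zero => simp [countLt]
  | succ v ih =>
    rw [countLt_succ, countLt_succ, ih]
    have := @mem_rowIns R x v
    rw [hy] at this
    grind

theorem countLt_bumped_le {ρ : List ℕ} (h : IsReducedWord ρ) (v : ℕ) :
    countLt (bottomRow (bumped ρ)) (v + 1) ≤ countLt (bottomRow ρ) v := by
  induction ρ using List.reverseRecOn generalizing v with
  | nil => simp [countLt]
  | append_singleton ρ x ih =>
    have ih := ih h.left
    rw [bottomRow_concat, bumped_concat]
    cases hy : nextIn (bottomRow ρ) x with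
    | none =>
      have hx : x ∉ bottomRow ρ := fun h2 => by rw [nextIn_mem_of_mem h h2] at hy; cases hy
      rw [countLt_rowIns_none hy hx]
      have := ih v
      simp
      omega
    | some y =>
      simp only [Option.toList_some]
      rw [bottomRow_concat, countLt_rowIns_some hy]
      have hy' := nextIn_eq_some.1 hy
      have hr := bumped_concat_reduced h hy
      have key : ∀ w, y ≤ w → y ∉ bottomRow (bumped ρ) →
          (∀ z ∈ bottomRow (bumped ρ), y < z → w < z) →
          countLt (bottomRow (bumped ρ)) (w + 1) + 1 ≤
            countLt (bottomRow ρ) w + if x ∉ bottomRow ρ ∧ x < w ∧ w ≤ y then 1 else 0 := by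
        intro w hw hyn hgap
        have e1 : countLt (bottomRow (bumped ρ)) (w + 1) = countLt (bottomRow (bumped ρ)) (y + 1) :=
          countLt_eq_of_gap (by omega) fun z hz hz' => hgap z hz hz'
        have e2 := countLt_succ (bottomRow (bumped ρ)) y
        rw [if_neg hyn] at e2
        have e3 := countLt_succ (bottomRow ρ) y
        rw [if_pos hy'.1] at e3
        have e4 := ih y
        rcases hw.lt_or_eq with hlt | rfl
        · have := countLt_mono (bottomRow ρ) (show y + 1 ≤ w from hlt)
          omega
        · by_cases hx : x ∈ bottomRow ρ
          · have e5 := nextIn_mem_of_mem h hx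
            rw [hy] at e5
            simp only [Option.some.injEq] at e5
            subst e5
            have e6 := countLt_succ (bottomRow ρ) x
            rw [if_pos hx] at e6
            have e7 := ih x
            omega
          · rw [if_pos ⟨hx, hy'.2.1, le_rfl⟩]
            omega
      have hv := ih v
      cases hz : nextIn (bottomRow (bumped ρ)) y with
      | none =>
        have hyn : y ∉ bottomRow (bumped ρ) := fun h2 => by
          rw [nextIn_mem_of_mem hr h2] at hz; cases hz
        rw [countLt_rowIns_none hz hyn]
        rw [nextIn_eq_none] at hz
        by_cases hyv : y < v + 1
        · rw [if_pos hyv]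
          exact key v (by omega) hyn fun z hz1 hz2 => by have := hz z hz1; omega
        · rw [if_neg hyv]; omega
      | some z =>
        rw [countLt_rowIns_some hz]
        rw [nextIn_eq_some] at hz
        split_ifs with c1
        all_goals try omega
        all_goals
          have := key v (by omega) c1.1 fun w hw hw' => by have := hz.2.2 w hw hw'; omega
          grind

theorem egShape_antitone {ρ : List ℕ} (h : IsReducedWord ρ) : Antitone (egShape ρ) := by
  refine antitone_nat_of_succ_le fun k => ?_
  induction k generalizing ρ with
  | zero =>
    rw [egShape_succ, egShape_zero, egShape_zero]
    set N := (bottomRow ρ).sup id + (bottomRow (bumped ρ)).sup id + 1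
    have h1 := countLt_bumped_le h N
    have : ∀ R : Finset ℕ, R.sup id < N → ∀ M, N ≤ M → countLt R M = R.card := by
      intro R hR M hM
      unfold countLt
      rw [Finset.filter_true_of_mem]
      intro z hz
      have := Finset.le_sup (f := id) hz
      simp only [id] at this
      omega
    rw [this _ (by omega) _ (by omega), this _ (by omega) _ (by omega)] at h1
    exact h1
  | succ k ih => exact ih h.bumped

theorem egRow_eq_empty_of_length_le {ρ : List ℕ} (h : IsReducedWord ρ) {k : ℕ}
    (hk : ρ.length ≤ k) : egRow ρ k = ∅ := by
  induction k generalizing ρ with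
  | zero =>
    rw [List.length_eq_zero_iff.1 (by omega : ρ.length = 0)]
    rfl
  | succ k ih =>
    rw [egRow_succ]
    by_cases hne : ρ = []
    · subst hne
      exact ih (by simpa using h) (by simp)
    · exact ih h.bumped (by have := bumped_length_lt h hne; omega)

theorem egShape_eq_zero_of_length_le {ρ : List ℕ} (h : IsReducedWord ρ) {k : ℕ}
    (hk : ρ.length ≤ k) : egShape ρ k = 0 := by
  rw [egShape, egRow_eq_empty_of_length_le h hk, Finset.card_empty]

theorem sum_egShape {ρ : List ℕ} (h : IsReducedWord ρ) {n : ℕ} (hn : ρ.length ≤ n) :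
    ∑ k ∈ Finset.range n, egShape ρ k = ρ.length := by
  induction n generalizing ρ with
  | zero => simp; omega
  | succ n ih =>
    rw [Finset.sum_range_succ', egShape_zero]
    simp only [egShape_succ]
    have := bumped_length ρ h
    by_cases hne : ρ = []
    · subst hne
      have := ih (by simpa using h) (by simp : ([] : List ℕ).length ≤ n)
      simpa using this
    · rw [ih h.bumped (by have := bumped_length_lt h hne; omega)]
      omega

/-! ### The first column -/

theorem mem_of_mem_bottomRow {ρ : List ℕ} {x : ℕ} (h : x ∈ bottomRow ρ) : x ∈ ρ := by
  induction ρ using List.reverseRecOn with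
  | nil => simp at h
  | append_singleton ρ y ih =>
    rw [bottomRow_concat, mem_rowIns] at h
    simp only [List.mem_append, List.mem_singleton]
    tauto

theorem exists_lt_of_mem_bumped {ρ : List ℕ} {m : ℕ} (hm : m ∈ bumped ρ) :
    ∃ r ∈ bottomRow ρ, r < m := by
  induction ρ using List.reverseRecOn with
  | nil => simp at hm
  | append_singleton ρ y ih =>
    rw [bumped_concat, List.mem_append, Option.mem_toList] at hm
    rw [bottomRow_concat]
    by_cases hm' : m ∈ bumped ρ
    · obtain ⟨r, hr, hrm⟩ := ih hm'
      by_cases hn : r ∈ rowIns (bottomRow ρ) y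
      · exact ⟨r, hn, hrm⟩
      · rw [mem_rowIns] at hn
        have : nextIn (bottomRow ρ) y = some r := by tauto
        have := nextIn_gt this
        exact ⟨y, self_mem_rowIns _ _, by omega⟩
    · have : nextIn (bottomRow ρ) y = some m := by tauto
      exact ⟨y, self_mem_rowIns _ _, nextIn_gt this⟩

theorem mem_of_mem_bumped {ρ : List ℕ} {m : ℕ} (hm : m ∈ bumped ρ) : m ∈ ρ := by
  induction ρ using List.reverseRecOn with
  | nil => simp at hm
  | append_singleton ρ y ih =>
    rw [bumped_concat, List.mem_append, Option.mem_toList] at hm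
    rcases hm with hm | hm
    · simp [ih hm]
    · exact List.mem_append_left _ (mem_of_mem_bottomRow (nextIn_mem hm))

theorem exists_le_of_mem {ρ : List ℕ} {m : ℕ} (hm : m ∈ ρ) : ∃ r ∈ bottomRow ρ, r ≤ m := by
  induction ρ using List.reverseRecOn with
  | nil => simp at hm
  | append_singleton ρ y ih =>
    rw [List.mem_append, List.mem_singleton] at hm
    rw [bottomRow_concat]
    rcases hm with hm | rfl
    · obtain ⟨r, hr, hrm⟩ := ih hm
      by_cases hn : r ∈ rowIns (bottomRow ρ) y
      · exact ⟨r, hn, hrm⟩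
      · rw [mem_rowIns] at hn
        have : nextIn (bottomRow ρ) y = some r := by tauto
        have := nextIn_gt this
        exact ⟨y, self_mem_rowIns _ _, by omega⟩
    · exact ⟨m, self_mem_rowIns _ _, le_rfl⟩

theorem bottomRow_eq_empty_iff {ρ : List ℕ} : bottomRow ρ = ∅ ↔ ρ = [] := by
  refine ⟨fun h => ?_, fun h => by rw [h]; rfl⟩
  by_contra hne
  have := bottomRow_nonempty hne
  rw [h] at this
  exact Finset.not_nonempty_empty this

/-- The entries of the first column of the Edelman–Greene tableau. -/
def egFirst (ρ : List ℕ) : Finset ℕ :=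
  (Finset.range ρ.length).biUnion fun k => (egRow ρ k).filter fun r => ∀ s ∈ egRow ρ k, r ≤ s

theorem mem_egFirst {ρ : List ℕ} (h : IsReducedWord ρ) {r : ℕ} :
    r ∈ egFirst ρ ↔ ∃ k, r ∈ egRow ρ k ∧ ∀ s ∈ egRow ρ k, r ≤ s := by
  simp only [egFirst, Finset.mem_biUnion, Finset.mem_range, Finset.mem_filter]
  refine ⟨fun ⟨k, _, h1⟩ => ⟨k, h1⟩, fun ⟨k, h1⟩ => ⟨k, ?_, h1⟩⟩
  by_contra hk
  rw [egRow_eq_empty_of_length_le h (by omega)] at h1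
  simp at h1

theorem CKEquiv.egFirst_eq {u v : List ℕ} (h : CKEquiv u v) (hu : IsReducedWord u) :
    egFirst u = egFirst v := by
  rw [egFirst, h.egRow_eq hu, h.length_eq, egFirst]

@[simp] theorem egFirst_nil : egFirst [] = ∅ := rfl

theorem mem_egFirst_succ {ρ : List ℕ} (h : IsReducedWord ρ) {r : ℕ} :
    r ∈ egFirst ρ ↔ (r ∈ bottomRow ρ ∧ ∀ s ∈ bottomRow ρ, r ≤ s) ∨ r ∈ egFirst (bumped ρ) := by
  rw [mem_egFirst h, mem_egFirst h.bumped]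
  constructor
  · rintro ⟨_ | k, hk⟩
    · exact Or.inl hk
    · exact Or.inr ⟨k, hk⟩
  · rintro (h1 | ⟨k, hk⟩)
    · exact ⟨0, h1⟩
    · exact ⟨k + 1, hk⟩

theorem mem_of_mem_egRow {ρ : List ℕ} {k r : ℕ} (h : r ∈ egRow ρ k) : r ∈ ρ := by
  induction k generalizing ρ with
  | zero => exact mem_of_mem_bottomRow h
  | succ k ih => exact mem_of_mem_bumped (ih h)

theorem mem_of_mem_egFirst {ρ : List ℕ} (h : IsReducedWord ρ) {r : ℕ} (hr : r ∈ egFirst ρ) :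
    r ∈ ρ := by
  obtain ⟨k, h1, -⟩ := (mem_egFirst h).1 hr
  exact mem_of_mem_egRow h1

theorem nil_of_forall_lt {ρ : List ℕ} {x : ℕ} (h1 : ∀ z ∈ bottomRow ρ, z < x)
    (h2 : ∀ z ∈ bottomRow ρ, x < z) : ρ = [] := by
  rw [← bottomRow_eq_empty_iff, Finset.eq_empty_iff_forall_notMem]
  intro z hz
  have := h1 z hz
  have := h2 z hz
  omega

/-- Inserting a letter smaller than the bottom row adds a box to the first column. -/
theorem egFirst_concat_of_lt {ρ : List ℕ} {x : ℕ} (h : IsReducedWord (ρ ++ [x]))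
    (hlt : ∀ z ∈ bottomRow ρ, x < z) :
    egFirst (ρ ++ [x]) = insert x (egFirst ρ) ∧ egShape ρ (boxRow ρ x) = 0 := by
  induction ρ, x, h using reduced_concat_induction with
  | none ρ x h1 hx hlt' =>
    obtain rfl := nil_of_forall_lt hlt' hlt
    have hn : nextIn (bottomRow []) x = none := by simp [nextIn_eq_none]
    refine ⟨?_, egShape_eq_zero_of_length_le h1.left (by simp)⟩
    ext r
    rw [mem_egFirst_succ h1, bumped_concat, bottomRow_concat, hn]
    simp [rowIns, nextIn]
    grind
  | some ρ x y h1 h2 hy ih =>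
    have hy' := nextIn_eq_some.1 hy
    obtain ⟨e1, e2⟩ := ih fun z hz => by
      obtain ⟨r, hr, hrz⟩ := exists_lt_of_mem_bumped (mem_of_mem_bottomRow hz)
      have := hy'.2.2 r hr (hlt r hr)
      omega
    refine ⟨?_, by rw [boxRow_some h1 hy, egShape_succ, e2]⟩
    ext r
    rw [Finset.mem_insert, mem_egFirst_succ h1, bumped_concat, bottomRow_concat, hy,
      mem_egFirst_succ h1.left]
    simp only [Option.toList_some, e1, Finset.mem_insert, mem_rowIns, hy, ne_eq, Option.some.injEq]
    have hxR : x ∉ bottomRow ρ := fun hx => lt_irrefl _ (hlt x hx)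
    have hA : (r = x ∨ r ∈ bottomRow ρ ∧ (x ∈ bottomRow ρ ∨ ¬y = r)) ∧
        (∀ s, s = x ∨ s ∈ bottomRow ρ ∧ (x ∈ bottomRow ρ ∨ ¬y = s) → r ≤ s) ↔ r = x := by grind
    have hB : (r ∈ bottomRow ρ ∧ ∀ s ∈ bottomRow ρ, r ≤ s) ↔ r = y := by grind
    rw [hA, hB]

theorem mem_egFirst_concat_of_le {ρ : List ℕ} {x y m : ℕ} (h : IsReducedWord (ρ ++ [x]))
    (hm : m ∈ bottomRow ρ) (hmx : m ≤ x) (hy : nextIn (bottomRow ρ) x = some y) (r : ℕ) :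
    r ∈ egFirst (ρ ++ [x]) ↔
      (r ∈ bottomRow ρ ∧ ∀ s ∈ bottomRow ρ, r ≤ s) ∨ r ∈ egFirst (bumped ρ ++ [y]) := by
  have hy' := nextIn_eq_some.1 hy
  rw [mem_egFirst_succ h, bumped_concat, bottomRow_concat, hy]
  simp only [Option.toList_some, mem_rowIns, hy, ne_eq, Option.some.injEq]
  have : (r = x ∨ r ∈ bottomRow ρ ∧ (x ∈ bottomRow ρ ∨ ¬y = r)) ∧
      (∀ s, s = x ∨ s ∈ bottomRow ρ ∧ (x ∈ bottomRow ρ ∨ ¬y = s) → r ≤ s) ↔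
      (r ∈ bottomRow ρ ∧ ∀ s ∈ bottomRow ρ, r ≤ s) := by
    constructor
    · rintro ⟨h1, h2⟩
      have h3 : r ≤ x := h2 x (Or.inl rfl)
      have h4 : r ≤ m := h2 m (by grind)
      refine ⟨by grind, fun s hs => ?_⟩
      by_cases hsy : y = s
      · omega
      · exact h2 s (Or.inr ⟨hs, Or.inr hsy⟩)
    · rintro ⟨h1, h2⟩
      have := h2 m hm
      grind
  rw [this]

/-- The effect of insertion on the first column. -/
theorem egFirst_concat {ρ : List ℕ} {x : ℕ} (h : IsReducedWord (ρ ++ [x])) :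
    (0 < egShape ρ (boxRow ρ x) → egFirst (ρ ++ [x]) = egFirst ρ) ∧
    (egShape ρ (boxRow ρ x) = 0 →
      ∃ r, r ∉ egFirst ρ ∧ egFirst (ρ ++ [x]) = insert r (egFirst ρ)) := by
  induction ρ, x, h using reduced_concat_induction with
  | none ρ x h1 hx hlt =>
    have hn : nextIn (bottomRow ρ) x = none := nextIn_eq_none.2 fun z hz => (hlt z hz).le
    rw [boxRow_none h1 hn, egShape_zero, Finset.card_pos]
    refine ⟨fun hne => ?_, fun h0 => ?_⟩
    · ext r
      rw [mem_egFirst_succ h1, mem_egFirst_succ h1.left, bumped_concat, bottomRow_concat]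
      simp only [mem_rowIns, hn]
      obtain ⟨z, hz⟩ := hne
      have := hlt z hz
      have h3 := this
      have : (r = x ∨ r ∈ bottomRow ρ ∧ (x ∈ bottomRow ρ ∨ none ≠ some r)) ∧
          (∀ s, s = x ∨ s ∈ bottomRow ρ ∧ (x ∈ bottomRow ρ ∨ none ≠ some s) → r ≤ s) ↔
          r ∈ bottomRow ρ ∧ ∀ s ∈ bottomRow ρ, r ≤ s := by
        grind
      rw [this]
      simp
    · rw [Finset.card_eq_zero, bottomRow_eq_empty_iff] at h0
      subst h0
      exact ⟨x, by simp, (egFirst_concat_of_lt h1 (by simp)).1⟩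
  | some ρ x y h1 h2 hy ih =>
    by_cases hlt : ∀ z ∈ bottomRow ρ, x < z
    · obtain ⟨e1, e2⟩ := egFirst_concat_of_lt h1 hlt
      refine ⟨fun h0 => by omega, fun _ => ⟨x, fun hx => ?_, e1⟩⟩
      obtain ⟨r, hr, hrx⟩ := exists_le_of_mem (mem_of_mem_egFirst h1.left hx)
      have := hlt r hr
      omega
    · push Not at hlt
      obtain ⟨m, hm, hmx⟩ := hlt
      have e1 := mem_egFirst_concat_of_le h1 hm hmx hy
      have e2 : egShape ρ (boxRow ρ x) = egShape (bumped ρ) (boxRow (bumped ρ) y) := by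
        rw [boxRow_some h1 hy]; rfl
      rw [e2]
      refine ⟨fun h0 => ?_, fun h0 => ?_⟩
      · ext r
        rw [e1, ih.1 h0, mem_egFirst_succ h1.left]
      · obtain ⟨r, hr, hr'⟩ := ih.2 h0
        refine ⟨r, ?_, ?_⟩
        · rw [mem_egFirst_succ h1.left]
          rintro (⟨hr1, hr2⟩ | hr1)
          · have hr3 : r ∈ bumped (ρ ++ [x]) := by
              rw [bumped_concat, hy]
              exact mem_of_mem_egFirst h2 (by rw [hr']; simp)
            obtain ⟨s, hs, hsr⟩ := exists_lt_of_mem_bumped hr3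
            rw [bottomRow_concat, mem_rowIns] at hs
            rcases hs with rfl | hs
            · have := hr2 m hm
              omega
            · have := hr2 s hs.1
              omega
          · exact hr hr1
        · ext r'
          rw [e1, hr', Finset.mem_insert, Finset.mem_insert, mem_egFirst_succ h1.left]
          tauto

theorem egFirst_bumped_concat {ρ : List ℕ} {x y m r : ℕ} (h : IsReducedWord (ρ ++ [x]))
    (hm : m ∈ bottomRow ρ) (hmx : m ≤ x) (hy : nextIn (bottomRow ρ) x = some y)
    (hr : egFirst (ρ ++ [x]) = insert r (egFirst ρ)) (hr0 : r ∉ egFirst ρ) :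
    egFirst (bumped ρ ++ [y]) = insert r (egFirst (bumped ρ)) ∧ r ∉ egFirst (bumped ρ) := by
  have h2 := bumped_concat_reduced h hy
  have hry : r ∈ egFirst (bumped ρ ++ [y]) ∧ r ∉ egFirst (bumped ρ) := by
    rw [mem_egFirst_succ h.left] at hr0
    have : r ∈ egFirst (ρ ++ [x]) := by rw [hr]; simp
    rw [mem_egFirst_concat_of_le h hm hmx hy] at this
    tauto
  refine ⟨?_, hry.2⟩
  have h3 := egFirst_concat h2
  rcases Nat.eq_zero_or_pos (egShape (bumped ρ) (boxRow (bumped ρ) y)) with h0 | h0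
  · obtain ⟨s, hs, hs'⟩ := h3.2 h0
    rw [hs', Finset.mem_insert] at hry
    have : r = s := by tauto
    rw [hs', this]
  · rw [h3.1 h0] at hry
    tauto

/-- Boxes successively added to the first column by a descent carry decreasing new entries. -/
theorem egFirst_concat_concat {ρ : List ℕ} {y y' r r' : ℕ}
    (h : IsReducedWord (ρ ++ [y] ++ [y'])) (hlt : y' < y)
    (hr : egFirst (ρ ++ [y]) = insert r (egFirst ρ)) (hr0 : r ∉ egFirst ρ)
    (hr' : egFirst (ρ ++ [y] ++ [y']) = insert r' (egFirst (ρ ++ [y])))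
    (hr0' : r' ∉ egFirst (ρ ++ [y])) : r' < r := by
  have small : ∀ {ρ : List ℕ} {y r : ℕ} (_ : IsReducedWord (ρ ++ [y]))
      (_ : ∀ z ∈ bottomRow ρ, y < z) (_ : egFirst (ρ ++ [y]) = insert r (egFirst ρ))
      (_ : r ∉ egFirst ρ), r = y := by
    intro ρ y r h hl hr hr0
    have := (egFirst_concat_of_lt h hl).1
    have h1 : r ∈ insert y (egFirst ρ) := by rw [← this, hr]; simp
    rw [Finset.mem_insert] at h1
    tauto
  induction ρ, y, h.left using reduced_concat_induction generalizing y' r r' with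
  | none ρ y h1 hy hly =>
    have hn : nextIn (bottomRow ρ) y = none := nextIn_eq_none.2 fun z hz => (hly z hz).le
    by_cases hne : ρ = []
    · subst hne
      obtain rfl := small h1 (by simp) hr hr0
      obtain rfl := small h (by
        simp only [bottomRow_concat, mem_rowIns, bottomRow_nil]
        simp [hlt]) hr' hr0'
      exact hlt
    · have := (egFirst_concat h1).1 (by
        rw [boxRow_none h1 hn]; exact Finset.card_pos.2 (bottomRow_nonempty hne))
      rw [this] at hr
      have : r ∈ egFirst ρ := by rw [hr]; simp
      exact absurd this hr0
  | some ρ y z h1 h2 hz ih =>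
    have hz' := nextIn_eq_some.1 hz
    have hb : bumped (ρ ++ [y]) = bumped ρ ++ [z] := by rw [bumped_concat, hz]; rfl
    by_cases hl : ∀ w ∈ bottomRow ρ, y < w
    · obtain rfl := small h1 hl hr hr0
      obtain rfl := small h (by
        intro w hw
        simp only [bottomRow_concat, mem_rowIns] at hw
        have := hl w
        grind) hr' hr0'
      exact hlt
    · push Not at hl
      obtain ⟨m, hm, hmy⟩ := hl
      have hrz := egFirst_bumped_concat h1 hm hmy hz hr hr0
      by_cases hl' : ∀ w ∈ bottomRow (ρ ++ [y]), y' < w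
      · obtain rfl := small h hl' hr' hr0'
        obtain ⟨s, hs, hs'⟩ := exists_lt_of_mem_bumped (ρ := ρ ++ [y]) (m := r) (by
          rw [hb]; exact mem_of_mem_egFirst h2 (by rw [hrz.1]; simp))
        have := hl' s hs
        omega
      · push Not at hl'
        obtain ⟨m', hm', hmy'⟩ := hl'
        have hy2 := self_mem_rowIns (bottomRow ρ) y
        rw [← bottomRow_concat] at hy2
        obtain ⟨z', hz2, hz3⟩ := exists_nextIn_le hy2 hlt
        have h4 := bumped_concat_reduced h hz2
        have hrz' := egFirst_bumped_concat h hm' hmy' hz2 hr' hr0'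
        rw [hb] at hrz' h4
        exact ih h4 (by omega) hrz.1 hrz.2 hrz'.1 hrz'.2

theorem egFirst_of_decreasing {d : List ℕ} (h : IsReducedWord d) (hd : d.Pairwise (· > ·)) :
    egFirst d = d.toFinset := by
  induction d using List.reverseRecOn with
  | nil => rfl
  | append_singleton d x ih =>
    rw [List.pairwise_append] at hd
    rw [(egFirst_concat_of_lt h fun z hz => hd.2.2 z (mem_of_mem_bottomRow hz) x (by simp)).1,
      ih h.left hd.1]
    ext
    simp

theorem egFirst_subset_concat {ρ : List ℕ} {x : ℕ} (h : IsReducedWord (ρ ++ [x])) :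
    egFirst ρ ⊆ egFirst (ρ ++ [x]) := by
  rcases Nat.eq_zero_or_pos (egShape ρ (boxRow ρ x)) with h0 | h0
  · obtain ⟨r, -, hr⟩ := (egFirst_concat h).2 h0
    rw [hr]
    exact Finset.subset_insert _ _
  · rw [(egFirst_concat h).1 h0]

theorem egFirst_subset_append {ρ : List ℕ} {u : List ℕ} (h : IsReducedWord (ρ ++ u)) :
    egFirst ρ ⊆ egFirst (ρ ++ u) := by
  induction u using List.reverseRecOn with
  | nil => simp
  | append_singleton u x ih =>
    rw [← List.append_assoc] at h ⊢
    exact (ih h.left).trans (egFirst_subset_concat h)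

theorem card_egFirst {ρ : List ℕ} (h : IsReducedWord ρ) {n : ℕ} (hn : ρ.length ≤ n) :
    (egFirst ρ).card = ((Finset.range n).filter fun i => 0 < egShape ρ i).card := by
  induction ρ using List.reverseRecOn with
  | nil => simp [egShape, egRow_eq_empty_of_length_le h]
  | append_singleton ρ x ih =>
    have ih := ih h.left (by simp at hn; omega)
    have hbox : boxRow ρ x < n := by
      by_contra hlt
      have := egShape_eq_zero_of_length_le h (k := boxRow ρ x) (by omega)
      rw [egShape_concat_apply h] at this
      simp at this
    rcases Nat.eq_zero_or_pos (egShape ρ (boxRow ρ x)) with h0 | h0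
    · obtain ⟨r, hr, hr'⟩ := (egFirst_concat h).2 h0
      rw [hr', Finset.card_insert_of_notMem hr, ih,
        ← Finset.card_insert_of_notMem (a := boxRow ρ x) (by simp [h0])]
      congr 1
      ext i
      simp only [Finset.mem_insert, Finset.mem_filter, Finset.mem_range, egShape_concat_apply h]
      split_ifs with hi <;> grind
    · rw [(egFirst_concat h).1 h0, ih]
      congr 1
      ext i
      simp only [Finset.mem_filter, Finset.mem_range, egShape_concat_apply h]
      split_ifs with hi <;> grind

/-! ### Removing corners -/

theorem exists_partner_of_valley {τ : List ℕ} {x₁ x₂ x₃ : ℕ}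
    (h : IsReducedWord (τ ++ [x₁] ++ [x₂] ++ [x₃])) (h1 : x₂ < x₁) (h2 : x₂ < x₃) :
    ∃ z₁ z₂ z₃, z₁ < z₂ ∧ z₃ < z₂ ∧
      CKEquiv (τ ++ [z₁] ++ [z₂] ++ [z₃]) (τ ++ [x₁] ++ [x₂] ++ [x₃]) := by
  simp only [List.append_assoc, List.cons_append, List.nil_append] at *
  rcases lt_trichotomy x₁ x₃ with h3 | rfl | h3
  · exact ⟨x₁, x₃, x₂, h3, h2, (CKEquiv.swap_right h1 h3 []).symm.append_left τ⟩
  · obtain rfl : x₁ = x₂ + 1 := by rcases h.braid with h | h <;> omega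
    exact ⟨x₂, x₂ + 1, x₂, h1, h1, (CKEquiv.braid x₂ []).append_left τ⟩
  · exact ⟨x₂, x₁, x₃, h1, h3, (CKEquiv.swap_left h2 h3 []).symm.append_left τ⟩

theorem exists_partner_of_peak {τ : List ℕ} {x₁ x₂ x₃ : ℕ}
    (h : IsReducedWord (τ ++ [x₁] ++ [x₂] ++ [x₃])) (h1 : x₁ < x₂) (h2 : x₃ < x₂) :
    ∃ z₁ z₂ z₃, z₂ < z₁ ∧ z₂ < z₃ ∧
      CKEquiv (τ ++ [z₁] ++ [z₂] ++ [z₃]) (τ ++ [x₁] ++ [x₂] ++ [x₃]) := by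
  simp only [List.append_assoc, List.cons_append, List.nil_append] at *
  rcases lt_trichotomy x₁ x₃ with h3 | rfl | h3
  · exact ⟨x₂, x₁, x₃, h1, h3, (CKEquiv.swap_left h3 h2 []).append_left τ⟩
  · obtain rfl : x₂ = x₁ + 1 := by rcases h.braid with h | h <;> omega
    exact ⟨x₁ + 1, x₁, x₁ + 1, h1, h1, (CKEquiv.braid x₁ []).symm.append_left τ⟩
  · exact ⟨x₁, x₃, x₂, h3, h2, (CKEquiv.swap_right h3 h1 []).append_left τ⟩

theorem corner_boxRow {ρ : List ℕ} {x : ℕ} (h : IsReducedWord (ρ ++ [x])) :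
    egShape (ρ ++ [x]) (boxRow ρ x + 1) < egShape (ρ ++ [x]) (boxRow ρ x) := by
  rw [egShape_concat_apply h, egShape_concat_apply h, if_pos rfl, if_neg (by omega)]
  have := egShape_antitone h.left (show boxRow ρ x ≤ boxRow ρ x + 1 by omega)
  omega

theorem eq_top_of_rows {a b c₁ c₂ c₃ : ℕ} (hab : a < b) (h2 : c₂ < c₃)
    (hs : ∀ k, (if k = c₁ then 1 else 0) + (if k = c₂ then 1 else 0) + (if k = c₃ then 1 else 0) =
      (if k = b - 1 then 1 else 0) + (if k = b then 1 else 0) + (if k = a then 1 else 0))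
    (hgap : c₃ ≤ a ∨ b ≤ c₃) : c₃ = b := by
  have e2 := hs c₂
  have e3 := hs c₃
  rw [if_pos rfl] at e2 e3
  split_ifs at e2 e3 <;> omega

theorem eq_bot_of_rows {a b c₁ c₂ c₃ : ℕ} (hab : a < b) (h2 : c₃ ≤ c₂)
    (hs : ∀ k, (if k = c₁ then 1 else 0) + (if k = c₂ then 1 else 0) + (if k = c₃ then 1 else 0) =
      (if k = b - 1 then 1 else 0) + (if k = a then 1 else 0) + (if k = b then 1 else 0))
    (hgap : c₃ ≤ a ∨ b ≤ c₃) : c₃ = a := by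
  have e2 := hs c₂
  have e3 := hs c₃
  rw [if_pos rfl] at e2 e3
  split_ifs at e2 e3 <;> omega

/-- Some word in the class of `ρ` ends with a letter whose box lies in row `c`. -/
def EndsInRow (ρ : List ℕ) (c : ℕ) : Prop :=
  ∃ σ x, CKEquiv (σ ++ [x]) ρ ∧ boxRow σ x = c

theorem EndsInRow.step {ρ : List ℕ} (h : IsReducedWord ρ)
    (ih : ∀ σ : List ℕ, IsReducedWord σ → σ.length < ρ.length → ∀ c,
      egShape σ (c + 1) < egShape σ c → EndsInRow σ c)
    {a b : ℕ} (hab : a < b) (ha : egShape ρ (a + 1) < egShape ρ a)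
    (hb : egShape ρ (b + 1) < egShape ρ b)
    (hgap : ∀ i, a < i → i < b → egShape ρ i ≤ egShape ρ (i + 1)) :
    EndsInRow ρ a ↔ EndsInRow ρ b := by
  have main : ∀ u v : ℕ, u ≠ v → (u = a ∧ v = b ∨ u = b ∧ v = a) → EndsInRow ρ u →
      ∃ τ x₁ x₂ x₃, CKEquiv (τ ++ [x₁] ++ [x₂] ++ [x₃]) ρ ∧ boxRow τ x₁ = b - 1 ∧
        boxRow (τ ++ [x₁]) x₂ = v ∧ boxRow (τ ++ [x₁] ++ [x₂]) x₃ = u := by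
    rintro u v huv hc ⟨σ, x₃, hσ, hu⟩
    have hr := hσ.symm.isReducedWord h
    have hlen := hσ.length_eq
    have hsh : ∀ k, egShape ρ k = egShape σ k + if k = u then 1 else 0 := fun k => by
      rw [← hσ.egShape_eq hr, egShape_concat_apply hr, hu]
    obtain ⟨σ', x₂, hσ', hv⟩ := ih σ hr.left (by simp at hlen; omega) v (by
      have := hsh v
      have := hsh (v + 1)
      rw [if_neg huv.symm] at *
      rcases hc with ⟨rfl, rfl⟩ | ⟨rfl, rfl⟩ <;> split_ifs at * <;> omega)
    have hr' := hσ'.symm.isReducedWord hr.left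
    have hlen' := hσ'.length_eq
    have hsh' : ∀ k, egShape ρ k =
        egShape σ' k + (if k = a then 1 else 0) + if k = b then 1 else 0 := fun k => by
      rw [hsh, ← hσ'.egShape_eq hr', egShape_concat_apply hr', hv]
      rcases hc with ⟨rfl, rfl⟩ | ⟨rfl, rfl⟩ <;> omega
    obtain ⟨τ, x₁, hτ, hm⟩ := ih σ' hr'.left (by simp at hlen hlen'; omega) (b - 1) (by
      have e1 := hsh' (b - 1)
      have e2 := hsh' b
      rw [Nat.sub_add_cancel (by omega)]
      rw [if_neg (by omega : b ≠ a), if_pos rfl] at e2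
      rw [if_neg (by omega : b - 1 ≠ b)] at e1
      have e3 := egShape_antitone h (show b - 1 ≤ b by omega)
      by_cases hab' : b - 1 = a
      · rw [if_pos hab'] at e1
        rw [← hab', Nat.sub_add_cancel (by omega)] at ha
        omega
      · rw [if_neg hab'] at e1
        have e4 := hgap (b - 1) (by omega) (by omega)
        omega)
    have e1 := hτ.append_right [x₂]
    refine ⟨τ, x₁, x₂, x₃, ((e1.trans hσ').append_right [x₃]).trans hσ, hm, ?_, ?_⟩
    · rw [hτ.boxRow_eq (e1.symm.isReducedWord hr'), hv]
    · rw [(e1.trans hσ').boxRow_eq (((e1.trans hσ').append_right [x₃]).symm.isReducedWord hr), hu]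
  have shapes : ∀ τ x₁ x₂ x₃, IsReducedWord (τ ++ [x₁] ++ [x₂] ++ [x₃]) → ∀ k,
      egShape (τ ++ [x₁] ++ [x₂] ++ [x₃]) k = egShape τ k + (if k = boxRow τ x₁ then 1 else 0) +
        (if k = boxRow (τ ++ [x₁]) x₂ then 1 else 0) +
        (if k = boxRow (τ ++ [x₁] ++ [x₂]) x₃ then 1 else 0) := by
    intro τ x₁ x₂ x₃ hr k
    rw [egShape_concat_apply hr, egShape_concat_apply hr.left, egShape_concat_apply hr.left.left]
  constructor
  · intro hE
    obtain ⟨τ, x₁, x₂, x₃, hτ, r1, r2, r3⟩ := main a b (by omega) (by tauto) hE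
    have hr := hτ.symm.isReducedWord h
    have o1 := boxRow_boxRow hr.left
    have o2 := boxRow_boxRow hr
    have n1 : x₁ ≠ x₂ := IsReducedWord.ne (a := τ) (b := [x₃]) (by simpa using hr)
    have n2 : x₂ ≠ x₃ := IsReducedWord.ne (a := τ ++ [x₁]) (b := []) (by simpa using hr)
    obtain ⟨z₁, z₂, z₃, h1, h2, h3⟩ := exists_partner_of_valley hr (by omega) (by omega)
    have hr' := h3.symm.isReducedWord hr
    have p2 := (boxRow_boxRow hr').2 h2
    have hs := congrFun (h3.egShape_eq hr')
    have hcor := corner_boxRow hr'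
    rw [(h3.trans hτ).egShape_eq hr'] at hcor
    refine ⟨_, _, h3.trans hτ, ?_⟩
    refine eq_top_of_rows hab p2 (c₁ := boxRow τ z₁) (fun k => ?_) ?_
    · have := (shapes _ _ _ _ hr' k).symm.trans ((hs k).trans (shapes _ _ _ _ hr k))
      rw [r1, r2, r3] at this
      omega
    · by_contra hcon
      have := hgap _ (not_le.1 fun h => hcon (Or.inl h)) (not_le.1 fun h => hcon (Or.inr h))
      omega
  · intro hE
    obtain ⟨τ, x₁, x₂, x₃, hτ, r1, r2, r3⟩ := main b a (by omega) (by tauto) hE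
    have hr := hτ.symm.isReducedWord h
    have o1 := boxRow_boxRow hr.left
    have o2 := boxRow_boxRow hr
    have n1 : x₁ ≠ x₂ := IsReducedWord.ne (a := τ) (b := [x₃]) (by simpa using hr)
    have n2 : x₂ ≠ x₃ := IsReducedWord.ne (a := τ ++ [x₁]) (b := []) (by simpa using hr)
    obtain ⟨z₁, z₂, z₃, h1, h2, h3⟩ := exists_partner_of_peak hr (by omega) (by omega)
    have hr' := h3.symm.isReducedWord hr
    have p2 := (boxRow_boxRow hr').1 h2
    have hs := congrFun (h3.egShape_eq hr')
    have hcor := corner_boxRow hr'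
    rw [(h3.trans hτ).egShape_eq hr'] at hcor
    refine ⟨_, _, h3.trans hτ, ?_⟩
    refine eq_bot_of_rows hab p2 (c₁ := boxRow τ z₁) (fun k => ?_) ?_
    · have := (shapes _ _ _ _ hr' k).symm.trans ((hs k).trans (shapes _ _ _ _ hr k))
      rw [r1, r2, r3] at this
      omega
    · by_contra hcon
      have := hgap _ (not_le.1 fun h => hcon (Or.inl h)) (not_le.1 fun h => hcon (Or.inr h))
      omega

/-- Every corner of the shape is the box of a last letter of an equivalent word. -/
theorem endsInRow_of_corner {ρ : List ℕ} (h : IsReducedWord ρ) {c : ℕ}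
    (hc : egShape ρ (c + 1) < egShape ρ c) : EndsInRow ρ c := by
  induction hn : ρ.length using Nat.strong_induction_on generalizing ρ c with
  | _ n ih =>
    have step := fun {a b : ℕ} => EndsInRow.step (a := a) (b := b) h
      (fun σ hσ hl c hc => ih _ (by omega) hσ hc rfl)
    obtain ⟨σ, x, rfl⟩ : ∃ σ x, ρ = σ ++ [x] := by
      refine ⟨ρ.dropLast, _, (List.dropLast_append_getLast (l := ρ) ?_).symm⟩
      rintro rfl
      rw [egShape_eq_zero_of_length_le h (by simp : ([] : List ℕ).length ≤ c)] at hc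
      omega
    have hl := corner_boxRow h
    have hl0 : EndsInRow (σ ++ [x]) (boxRow σ x) := ⟨σ, x, CKEquiv.refl _, rfl⟩
    generalize boxRow σ x = l at *
    rcases Nat.le_total l c with hlc | hlc
    · induction c using Nat.strong_induction_on with
      | _ c ihc =>
        rcases hlc.eq_or_lt with rfl | hlt
        · exact hl0
        · classical
          set S := (Finset.range c).filter fun a =>
            egShape (σ ++ [x]) (a + 1) < egShape (σ ++ [x]) a with hS
          have hlS : l ∈ S := by simp [hS, hlt, hl]
          obtain ⟨a, haS, hmax⟩ := S.exists_max_image id ⟨l, hlS⟩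
          have ha := haS
          simp only [hS, Finset.mem_filter, Finset.mem_range] at ha
          refine (step ha.1 ha.2 hc fun i hai hic => ?_).1 (ihc a ha.1 ha.2 (hmax l hlS))
          by_contra hlt'
          have := hmax i (by simp [hS, hic]; omega)
          simp only [id] at this
          omega
    · obtain ⟨d, rfl⟩ : ∃ d, l = c + d := ⟨l - c, by omega⟩
      induction d using Nat.strong_induction_on generalizing c with
      | _ d ihd =>
        rcases Nat.eq_zero_or_pos d with rfl | hd
        · exact hl0
        · classical
          set S := (Finset.Icc (c + 1) (c + d)).filter fun a =>
            egShape (σ ++ [x]) (a + 1) < egShape (σ ++ [x]) a with hS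
          have hlS : c + d ∈ S := by simp [hS, hl]; omega
          obtain ⟨b, hbS, hmin⟩ := S.exists_min_image id ⟨_, hlS⟩
          have hb := hbS
          simp only [hS, Finset.mem_filter, Finset.mem_Icc] at hb
          refine (step (by omega) hc hb.2 fun i hi hib => ?_).2 ?_
          · by_contra hlt'
            have := hmin i (by simp [hS]; omega)
            simp only [id] at this
            omega
          · have e : c + d = b + (c + d - b) := by omega
            exact ihd (c + d - b) (by omega) hb.2 (by rw [← e]; exact hl) (by rw [← e]; exact hl0)
              (by omega)

/-- Reduced words with the same tableau are Coxeter–Knuth equivalent. -/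
theorem ckEquiv_of_egRow_eq {ρ ρ' : List ℕ} (h : IsReducedWord ρ) (h' : IsReducedWord ρ')
    (hP : egRow ρ = egRow ρ') : CKEquiv ρ ρ' := by
  induction ρ using List.reverseRecOn generalizing ρ' with
  | nil =>
    have := congrFun hP 0
    rw [egRow_zero, egRow_zero, bottomRow_nil, eq_comm, bottomRow_eq_empty_iff] at this
    rw [this]
    exact CKEquiv.refl _
  | append_singleton σ x ih =>
    have hs : egShape (σ ++ [x]) = egShape ρ' := by
      funext k
      rw [egShape, hP, egShape]
    have hc := corner_boxRow h
    rw [hs] at hc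
    obtain ⟨σ', x', e, hb⟩ := endsInRow_of_corner h' hc
    have hr := e.symm.isReducedWord h'
    obtain ⟨rfl, hσ⟩ := concat_injective h hr hb.symm (by rw [hP, e.egRow_eq hr])
    exact ((ih h.left hr.left hσ).append_right [x]).trans e

theorem ckEquiv_of_concat {ρ ρ' : List ℕ} {x x' : ℕ} (h : IsReducedWord (ρ ++ [x]))
    (e : CKEquiv (ρ ++ [x]) (ρ' ++ [x'])) (hs : egShape ρ = egShape ρ') :
    x = x' ∧ CKEquiv ρ ρ' := by
  have h' := e.isReducedWord h
  have hb : boxRow ρ x = boxRow ρ' x' := by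
    apply boxRow_eq_of h
    rw [e.egShape_eq h, hs, egShape_concat_apply h']
    simp
  obtain ⟨rfl, hP⟩ := concat_injective h h' hb (e.egRow_eq h)
  exact ⟨rfl, ckEquiv_of_egRow_eq h.left h'.left hP⟩

/-! ### Prefixes and strips -/

theorem List.Pairwise.concat_concat {R : ℕ → ℕ → Prop} [IsTrans ℕ R] {q : List ℕ} {x y : ℕ}
    (h : (q ++ [y]).Pairwise R) (hR : R y x) : (q ++ [y] ++ [x]).Pairwise R := by
  rw [List.pairwise_append]
  refine ⟨h, List.pairwise_singleton _ _, fun a ha b hb => ?_⟩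
  rw [List.mem_singleton] at hb
  subst hb
  rw [List.mem_append, List.mem_singleton] at ha
  rcases ha with ha | rfl
  · exact _root_.trans ((List.pairwise_append.1 h).2.2 a ha y (by simp)) hR
  · exact hR

theorem egShape_le_concat {ρ : List ℕ} {x : ℕ} (h : IsReducedWord (ρ ++ [x])) (k : ℕ) :
    egShape ρ k ≤ egShape (ρ ++ [x]) k := by
  rw [egShape_concat_apply h]
  omega

theorem egShape_le_append {ρ u : List ℕ} (h : IsReducedWord (ρ ++ u)) (k : ℕ) :
    egShape ρ k ≤ egShape (ρ ++ u) k := by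
  induction u using List.reverseRecOn with
  | nil => simp
  | append_singleton u x ih =>
    rw [← List.append_assoc] at *
    exact (ih h.left).trans (egShape_le_concat h k)

/-- If two letters of a reduced word are consecutive, the row of the second box is weakly below
the row of the first box exactly when the letters increase. -/
theorem lt_iff_boxRow {ρ : List ℕ} {x y : ℕ} (h : IsReducedWord (ρ ++ [x] ++ [y])) :
    x < y ↔ boxRow (ρ ++ [x]) y ≤ boxRow ρ x := by
  have h1 := boxRow_boxRow h
  have h2 : x ≠ y := IsReducedWord.ne (a := ρ) (b := []) (by simpa using h)
  refine ⟨h1.1, fun h3 => ?_⟩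
  by_contra h4
  have := h1.2 (by omega)
  omega

/-- Removing boxes from the top, any smaller partition is the shape of an initial
factor; the complementary factor is decreasing if the skew shape is a vertical strip. -/
theorem exists_initial {ρ : List ℕ} (h : IsReducedWord ρ) {μ : ℕ → ℕ} (hμ : Antitone μ)
    (hle : ∀ k, μ k ≤ egShape ρ k) :
    ∃ p q, CKEquiv (p ++ q) ρ ∧ egShape p = μ ∧
      ((∀ k, egShape ρ k ≤ μ k + 1) → q.Pairwise (· > ·)) := by
  induction hn : ρ.length using Nat.strong_induction_on generalizing ρ with
  | _ n ih =>
    by_cases heq : egShape ρ = μ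
    · exact ⟨ρ, [], by rw [List.append_nil]; exact CKEquiv.refl _, heq, fun _ => List.Pairwise.nil⟩
    · classical
      obtain ⟨i₀, hi₀⟩ := Function.ne_iff.1 heq
      have hi₀' : μ i₀ < egShape ρ i₀ := by have := hle i₀; omega
      set S := (Finset.range n).filter fun i => μ i < egShape ρ i
      have hS : ∀ i, i ∈ S ↔ μ i < egShape ρ i := fun i => by
        simp only [S, Finset.mem_filter, Finset.mem_range, and_iff_right_iff_imp]
        intro hi
        by_contra hlt
        rw [egShape_eq_zero_of_length_le h (by omega)] at hi
        omega
      obtain ⟨i, hiS, hmax⟩ := S.exists_max_image id ⟨i₀, (hS _).2 hi₀'⟩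
      have hi := (hS i).1 hiS
      have hgt : ∀ j, i < j → egShape ρ j = μ j := fun j hj => by
        have := hle j
        by_contra hne
        have := hmax j ((hS j).2 (by omega))
        simp only [id] at this
        omega
      obtain ⟨σ, x, hσ, hrow⟩ := endsInRow_of_corner h (c := i) (by
        rw [hgt _ (by omega)]
        have := hμ (show i ≤ i + 1 by omega)
        omega)
      have hr := hσ.symm.isReducedWord h
      have hsh := fun k => (hσ.egShape_eq hr) ▸ egShape_concat_apply hr k
      rw [hrow] at hsh
      have hlen := hσ.length_eq
      rw [List.length_append, List.length_singleton] at hlen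
      obtain ⟨p, q, hpq, hp, hq⟩ := ih σ.length (by omega) hr.left (fun k => by
        have := hsh k
        have := hle k
        split_ifs at * with hk
        · subst hk; omega
        · omega) rfl
      refine ⟨p, q ++ [x], ?_, hp, fun hs => ?_⟩
      · rw [← List.append_assoc]
        exact (hpq.append_right [x]).trans hσ
      · have hq' := hq fun k => by
          have := hsh k
          have := hs k
          omega
        rcases List.eq_nil_or_concat' q with rfl | ⟨q₀, y, rfl⟩
        · exact List.pairwise_singleton _ _
        · rw [← List.append_assoc] at hpq
          have hr' := hpq.symm.isReducedWord hr.left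
          have hr2 := (hpq.append_right [x]).symm.isReducedWord hr
          apply hq'.concat_concat
          have h1 := lt_iff_boxRow hr2
          rw [hpq.boxRow_eq hr2, hrow] at h1
          have h2 : y ≠ x := IsReducedWord.ne (a := p ++ q₀) (b := []) (by simpa using hr2)
          have h3 : boxRow (p ++ q₀) y < i := by
            have e1 := egShape_concat_apply hr' (boxRow (p ++ q₀) y)
            rw [if_pos rfl, hpq.egShape_eq hr'] at e1
            have e2 := egShape_le_append hr'.left (boxRow (p ++ q₀) y)
            rw [hp] at e2
            have e3 := hsh (boxRow (p ++ q₀) y)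
            have e4 := hs (boxRow (p ++ q₀) y)
            by_contra hlt
            rcases (not_lt.1 hlt).eq_or_lt with e | e
            · rw [← e, if_pos rfl] at e3
              rw [← e] at e1 e2 e4
              omega
            · have := hgt _ e
              omega
          show x < y
          omega

/-- The complementary factor of an initial factor can be taken increasing if the skew shape is a
horizontal strip. -/
theorem exists_initial_of_horizontal {ρ : List ℕ} (h : IsReducedWord ρ) {μ : ℕ → ℕ}
    (hle : ∀ k, μ k ≤ egShape ρ k) (hs : ∀ k, egShape ρ (k + 1) ≤ μ k) :
    ∃ p q, CKEquiv (p ++ q) ρ ∧ egShape p = μ ∧ q.Pairwise (· < ·) := by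
  induction hn : ρ.length using Nat.strong_induction_on generalizing ρ with
  | _ n ih =>
    by_cases heq : egShape ρ = μ
    · exact ⟨ρ, [], by rw [List.append_nil]; exact CKEquiv.refl _, heq, List.Pairwise.nil⟩
    · classical
      obtain ⟨i₀, hi₀⟩ := Function.ne_iff.1 heq
      have hex : ∃ i, μ i < egShape ρ i := ⟨i₀, by have := hle i₀; omega⟩
      obtain ⟨i, hi, hmin⟩ : ∃ i, μ i < egShape ρ i ∧ ∀ j < i, egShape ρ j = μ j :=
        ⟨Nat.find hex, Nat.find_spec hex, fun j hj => by
          have := Nat.find_min hex hj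
          have := hle j
          omega⟩
      obtain ⟨σ, x, hσ, hrow⟩ := endsInRow_of_corner h (c := i) (by have := hs i; omega)
      have hr := hσ.symm.isReducedWord h
      have hsh := fun k => (hσ.egShape_eq hr) ▸ egShape_concat_apply hr k
      rw [hrow] at hsh
      have hlen := hσ.length_eq
      rw [List.length_append, List.length_singleton] at hlen
      obtain ⟨p, q, hpq, hp, hq⟩ := ih σ.length (by omega) hr.left (fun k => by
        have := hsh k
        have := hle k
        split_ifs at * with hk
        · subst hk; omega
        · omega) (fun k => by
          have := hsh (k + 1)
          have := hs k
          omega) rfl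
      refine ⟨p, q ++ [x], ?_, hp, ?_⟩
      · rw [← List.append_assoc]
        exact (hpq.append_right [x]).trans hσ
      · rcases List.eq_nil_or_concat' q with rfl | ⟨q₀, y, rfl⟩
        · exact List.pairwise_singleton _ _
        · rw [← List.append_assoc] at hpq
          have hr' := hpq.symm.isReducedWord hr.left
          have hr2 := (hpq.append_right [x]).symm.isReducedWord hr
          apply hq.concat_concat
          refine (lt_iff_boxRow hr2).2 ?_
          rw [hpq.boxRow_eq hr2, hrow]
          have e1 := egShape_concat_apply hr' (boxRow (p ++ q₀) y)
          rw [if_pos rfl, hpq.egShape_eq hr'] at e1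
          have e2 := egShape_le_append hr'.left (boxRow (p ++ q₀) y)
          rw [hp] at e2
          have e3 := hsh (boxRow (p ++ q₀) y)
          by_contra hlt
          have := hmin _ (not_le.1 hlt)
          omega

theorem egShape_eq_of_lt_boxRow {u b : List ℕ} {x : ℕ} (h : IsReducedWord (u ++ b ++ [x]))
    (hb : (b ++ [x]).Pairwise (· < ·)) {i : ℕ} (hi : i < boxRow (u ++ b) x) :
    egShape (u ++ b) i = egShape u i := by
  induction b using List.reverseRecOn generalizing x with
  | nil => simp
  | append_singleton b y ih =>
    rw [← List.append_assoc] at *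
    have h1 := (lt_iff_boxRow h).1 ((List.pairwise_append.1 hb).2.2 y (by simp) x (by simp))
    rw [egShape_concat_apply h.left, if_neg (by omega)]
    exact ih h.left (List.pairwise_append.1 hb).1 (by omega)

theorem egShape_eq_of_boxRow_le {u b : List ℕ} {x : ℕ} (h : IsReducedWord (u ++ b ++ [x]))
    (hb : (b ++ [x]).Pairwise (· > ·)) {i : ℕ} (hi : boxRow (u ++ b) x ≤ i) :
    egShape (u ++ b) i = egShape u i := by
  induction b using List.reverseRecOn generalizing x with
  | nil => simp
  | append_singleton b y ih =>
    rw [← List.append_assoc] at *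
    have h1 := (boxRow_boxRow h).2 ((List.pairwise_append.1 hb).2.2 y (by simp) x (by simp))
    rw [egShape_concat_apply h.left, if_neg (by omega)]
    exact ih h.left (List.pairwise_append.1 hb).1 (by omega)

/-- Appending an increasing word adds a horizontal strip. -/
theorem egShape_append_succ_le {u b : List ℕ} (h : IsReducedWord (u ++ b))
    (hb : b.Pairwise (· < ·)) (i : ℕ) : egShape (u ++ b) (i + 1) ≤ egShape u i := by
  induction b using List.reverseRecOn with
  | nil => rw [List.append_nil] at *; exact egShape_antitone h (by omega)
  | append_singleton b x ih =>
    rw [← List.append_assoc] at *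
    have h1 := ih h.left (List.pairwise_append.1 hb).1
    rw [egShape_concat_apply h]
    split_ifs with hi
    · have h2 := egShape_eq_of_lt_boxRow h hb (i := i) (by omega)
      have h3 := egShape_antitone h (show i ≤ i + 1 by omega)
      rw [egShape_concat_apply h, egShape_concat_apply h, if_pos hi, if_neg (by omega)] at h3
      omega
    · omega

/-- Appending a decreasing word adds a vertical strip. -/
theorem egShape_append_le {u d : List ℕ} (h : IsReducedWord (u ++ d))
    (hd : d.Pairwise (· > ·)) (i : ℕ) : egShape (u ++ d) i ≤ egShape u i + 1 := by
  induction d using List.reverseRecOn with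
  | nil => simp
  | append_singleton d x ih =>
    rw [← List.append_assoc] at *
    have h1 := ih h.left (List.pairwise_append.1 hd).1
    rw [egShape_concat_apply h]
    split_ifs with hi
    · rw [egShape_eq_of_boxRow_le h hd hi.ge]
    · omega

theorem boxRow_concat_of_increasing {u b : List ℕ} {x : ℕ} (h : IsReducedWord (u ++ b ++ [x]))
    (hb : (b ++ [x]).Pairwise (· < ·)) (i : ℕ) :
    boxRow (u ++ b) x = i ↔
      egShape (u ++ b ++ [x]) i ≠ egShape u i ∧
        ∀ j < i, egShape (u ++ b ++ [x]) j = egShape u j := by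
  have key : egShape (u ++ b ++ [x]) (boxRow (u ++ b) x) ≠ egShape u (boxRow (u ++ b) x) ∧
      ∀ j < boxRow (u ++ b) x, egShape (u ++ b ++ [x]) j = egShape u j := by
    refine ⟨?_, fun j hj => ?_⟩
    · rw [egShape_concat_apply h, if_pos rfl]
      have := egShape_le_append h.left (boxRow (u ++ b) x)
      omega
    · rw [egShape_concat_apply h, if_neg (by omega), egShape_eq_of_lt_boxRow h hb hj, add_zero]
  refine ⟨fun e => e ▸ key, fun ⟨h1, h2⟩ => ?_⟩
  rcases lt_trichotomy (boxRow (u ++ b) x) i with hlt | e | hlt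
  · exact absurd (h2 _ hlt) key.1
  · exact e
  · exact absurd (key.2 _ hlt) h1

/-- An increasing right factor is determined by the class and the shape of the left factor. -/
theorem right_factor_unique {u u' b b' : List ℕ} (h : IsReducedWord (u ++ b))
    (e : CKEquiv (u ++ b) (u' ++ b')) (hb : b.Pairwise (· < ·)) (hb' : b'.Pairwise (· < ·))
    (hs : egShape u = egShape u') : b = b' ∧ CKEquiv u u' := by
  induction b using List.reverseRecOn generalizing b' with
  | nil =>
    have h' := e.isReducedWord h
    rcases List.eq_nil_or_concat' b' with rfl | ⟨b', x', rfl⟩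
    · simpa using e
    · have h1 := e.egShape_eq h
      rw [← List.append_assoc] at h1 h'
      have h2 := egShape_concat_apply h' (boxRow (u' ++ b') x')
      have h3 := egShape_le_append h'.left (boxRow (u' ++ b') x')
      rw [← h1, List.append_nil, hs, if_pos rfl] at h2
      omega
  | append_singleton b x ih =>
    have h' := e.isReducedWord h
    rcases List.eq_nil_or_concat' b' with rfl | ⟨b', x', rfl⟩
    · have h1 := e.egShape_eq h
      rw [← List.append_assoc] at h1 h
      have h2 := egShape_concat_apply h (boxRow (u ++ b) x)
      have h3 := egShape_le_append h.left (boxRow (u ++ b) x)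
      rw [h1, List.append_nil, ← hs, if_pos rfl] at h2
      omega
    · rw [← List.append_assoc] at h h' e
      rw [← List.append_assoc] at e
      have h1 : boxRow (u ++ b) x = boxRow (u' ++ b') x' := by
        rw [boxRow_concat_of_increasing h hb, e.egShape_eq h, hs,
          ← boxRow_concat_of_increasing h' hb']
      obtain ⟨rfl, h2⟩ := concat_injective h h' h1 (e.egRow_eq h)
      obtain ⟨rfl, h3⟩ := ih h.left (ckEquiv_of_egRow_eq h.left h'.left h2)
        (List.pairwise_append.1 hb).1 (List.pairwise_append.1 hb').1
      exact ⟨rfl, h3⟩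

/-! ### Reversal transposes the shape -/

theorem egShape_append_reverse_le {p : List ℕ} (k : ℕ) (hp : ∀ i, egShape p i ≤ k) {u : List ℕ}
    (h : IsReducedWord (u ++ p.reverse)) (j : ℕ) :
    egShape (u ++ p.reverse) (j + k) ≤ egShape u j := by
  have hpr : IsReducedWord p := by simpa using h.right.reverse
  induction k generalizing u p j with
  | zero =>
    have h1 := sum_egShape hpr le_rfl
    rw [Finset.sum_eq_zero fun i _ => Nat.le_zero.1 (hp i), eq_comm, List.length_eq_zero_iff] at h1
    simp [h1]
  | succ k ih =>
    obtain ⟨p', d, e, hs, hd⟩ := exists_initial hpr (μ := fun i => min k (egShape p i))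
      (fun i j hij => min_le_min_left _ (egShape_antitone hpr hij)) fun i => min_le_right _ _
    have e' := (e.reverse.append_left u).symm
    rw [List.reverse_append, ← List.append_assoc] at e'
    have hr := e'.isReducedWord h
    have h1 := ih (fun i => by rw [hs]; exact min_le_left _ _) hr (j + 1)
      (e.symm.isReducedWord hpr).left
    have h2 := egShape_append_succ_le hr.left (by
      rw [List.pairwise_reverse]
      exact hd fun i => by have := hp i; omega) j
    rw [e'.egShape_eq h, show j + (k + 1) = j + 1 + k by omega]
    exact h1.trans h2

theorem egShape_append_reverse_le_add {p : List ℕ} (k : ℕ) (hp : ∀ i, k ≤ i → egShape p i = 0)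
    {u : List ℕ} (h : IsReducedWord (u ++ p.reverse)) (j : ℕ) :
    egShape (u ++ p.reverse) j ≤ egShape u j + k := by
  have hpr : IsReducedWord p := by simpa using h.right.reverse
  induction k generalizing u p with
  | zero =>
    have h1 := sum_egShape hpr le_rfl
    rw [Finset.sum_eq_zero fun i _ => hp i (by omega), eq_comm, List.length_eq_zero_iff] at h1
    simp [h1]
  | succ k ih =>
    obtain ⟨p', b, e, hs, hb⟩ := exists_initial_of_horizontal hpr
      (μ := fun i => if i < k then egShape p i else 0)
      (fun i => by split_ifs <;> omega) (fun i => by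
        split_ifs with hi
        · exact egShape_antitone hpr (by omega)
        · exact (hp _ (by omega)).le)
    have e' := (e.reverse.append_left u).symm
    rw [List.reverse_append, ← List.append_assoc] at e'
    have hr := e'.isReducedWord h
    have h1 := ih (fun i hi => by rw [hs]; exact if_neg (by omega)) hr
      (e.symm.isReducedWord hpr).left
    have h2 := egShape_append_le hr.left (List.pairwise_reverse.2 hb) j
    rw [e'.egShape_eq h]
    omega

theorem sum_min_egShape {ρ : List ℕ} (h : IsReducedWord ρ) {n : ℕ} (hn : ρ.length ≤ n) (k : ℕ) :
    ∑ i ∈ Finset.range n, min k (egShape ρ i) = ∑ j ∈ Finset.range k, egShape ρ.reverse j := by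
  apply le_antisymm
  · obtain ⟨p, q, e, hs, -⟩ := exists_initial h (μ := fun i => min k (egShape ρ i))
      (fun i j hij => min_le_min_left _ (egShape_antitone h hij)) fun i => min_le_right _ _
    have hr := e.symm.isReducedWord h
    have hl := e.length_eq
    have e' := e.symm.reverse
    rw [List.reverse_append] at e'
    have h1 := egShape_append_reverse_le k (fun i => by rw [hs]; exact min_le_left _ _)
      (e'.isReducedWord h.reverse)
    rw [← e'.egShape_eq h.reverse] at h1
    have h2 := Finset.sum_le_sum fun j (_ : j ∈ Finset.range n) => h1 j
    rw [List.length_append] at hl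
    rw [sum_egShape hr.right.reverse (by simp; omega), List.length_reverse] at h2
    have h3 := sum_egShape h.reverse (n := k + n) (by simp; omega)
    rw [Finset.sum_range_add, List.length_reverse] at h3
    have h4 := sum_egShape hr.left (n := n) (by omega)
    rw [hs] at h4
    simp only [add_comm _ k] at h2 h4
    omega
  · have hr := h.reverse
    obtain ⟨p, q, e, hs, -⟩ := exists_initial hr
      (μ := fun i => if i < k then egShape ρ.reverse i else 0)
      (fun i j hij => by
        have := egShape_antitone hr hij
        dsimp only
        split_ifs <;> omega) (fun i => by split_ifs <;> omega)
    have hr' := e.symm.isReducedWord hr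
    have hl := e.length_eq
    rw [List.length_append, List.length_reverse] at hl
    have e' := e.symm.reverse
    rw [List.reverse_append, List.reverse_reverse] at e'
    have h1 := egShape_append_reverse_le_add k (fun i hi => by rw [hs]; exact if_neg (by omega))
      (e'.isReducedWord h)
    rw [← e'.egShape_eq h] at h1
    have h2 := sum_egShape h hn
    have h3 := sum_egShape hr'.right.reverse (n := n) (by simp; omega)
    have h4 := sum_egShape hr'.left (n := k + n) (by omega)
    rw [List.length_reverse] at h3
    rw [hs, Finset.sum_range_add, Finset.sum_congr rfl (g := fun j => egShape ρ.reverse j)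
      (fun i hi => if_pos (Finset.mem_range.1 hi)),
      Finset.sum_eq_zero (s := Finset.range n) (fun i _ => if_neg (by omega)), add_zero] at h4
    have h5 : ∑ i ∈ Finset.range n, egShape ρ i ≤
        ∑ i ∈ Finset.range n, (egShape q.reverse i + min k (egShape ρ i)) :=
      Finset.sum_le_sum fun i _ => by have := h1 i; omega
    rw [Finset.sum_add_distrib] at h5
    omega

theorem egShape_reverse {ρ : List ℕ} (h : IsReducedWord ρ) {n : ℕ} (hn : ρ.length ≤ n) (k : ℕ) :
    egShape ρ.reverse k = ((Finset.range n).filter fun i => k < egShape ρ i).card := by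
  have h1 := sum_min_egShape h hn k
  have h2 := sum_min_egShape h hn (k + 1)
  rw [Finset.sum_range_succ, ← h1] at h2
  rw [Finset.card_filter]
  have h3 : ∑ i ∈ Finset.range n, min (k + 1) (egShape ρ i) =
      ∑ i ∈ Finset.range n, (min k (egShape ρ i) + if k < egShape ρ i then 1 else 0) :=
    Finset.sum_congr rfl fun i _ => by split_ifs <;> omega
  rw [Finset.sum_add_distrib] at h3
  omega

theorem lt_egShape_reverse_iff {ρ : List ℕ} (h : IsReducedWord ρ) {i k : ℕ} :
    i < egShape ρ.reverse k ↔ k < egShape ρ i := by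
  rw [egShape_reverse h (n := ρ.length + i + 1) (by omega)]
  constructor
  · intro h1
    by_contra h2
    have : ((Finset.range (ρ.length + i + 1)).filter fun i => k < egShape ρ i) ⊆
        Finset.range i := fun j hj => by
      rw [Finset.mem_filter] at hj
      rw [Finset.mem_range]
      by_contra h3
      have := egShape_antitone h (not_lt.1 h3)
      omega
    have := Finset.card_le_card this
    rw [Finset.card_range] at this
    omega
  · intro h1
    have : Finset.range (i + 1) ⊆
        (Finset.range (ρ.length + i + 1)).filter fun i => k < egShape ρ i := fun j hj => by
      rw [Finset.mem_range] at hj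
      rw [Finset.mem_filter, Finset.mem_range]
      have := egShape_antitone h (show j ≤ i by omega)
      exact ⟨by omega, by omega⟩
    have := Finset.card_le_card this
    rw [Finset.card_range] at this
    omega

/-! ### Prepending letters -/

theorem egShape_right_le {u v : List ℕ} (h : IsReducedWord (u ++ v)) (i : ℕ) :
    egShape v i ≤ egShape (u ++ v) i := by
  by_contra hlt
  have h1 := (lt_egShape_reverse_iff h.right).2 (not_le.1 hlt)
  have h2 := h.reverse
  rw [List.reverse_append] at h2
  have h3 := egShape_le_append h2 (egShape (u ++ v) i)
  rw [← List.reverse_append] at h3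
  have := (lt_egShape_reverse_iff h).1 (h1.trans_le h3)
  omega

/-- Prepending a decreasing word adds a vertical strip. -/
theorem egShape_decreasing_append_le {d v : List ℕ} (h : IsReducedWord (d ++ v))
    (hd : d.Pairwise (· > ·)) (i : ℕ) : egShape (d ++ v) i ≤ egShape v i + 1 := by
  by_contra hlt
  have h1 := (lt_egShape_reverse_iff h).2 (not_le.1 hlt)
  have h2 := h.reverse
  rw [List.reverse_append] at h2
  have h3 := egShape_append_succ_le h2 (List.pairwise_reverse.2 hd) (egShape v i)
  rw [← List.reverse_append] at h3
  have := (lt_egShape_reverse_iff h.right).1 (h1.trans_le h3)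
  omega

/-! ### Column factors -/

/-- The column (counted from zero) of the box added by inserting `x` after `ρ`. -/
noncomputable def boxCol (ρ : List ℕ) (x : ℕ) : ℕ := egShape ρ (boxRow ρ x)

theorem CKEquiv.boxCol_eq {ρ σ : List ℕ} {x : ℕ} (h : CKEquiv ρ σ)
    (hr : IsReducedWord (ρ ++ [x])) : boxCol ρ x = boxCol σ x := by
  rw [boxCol, h.boxRow_eq hr, h.egShape_eq hr.left, boxCol]

theorem lt_iff_boxCol {ρ : List ℕ} {x y : ℕ} (h : IsReducedWord (ρ ++ [x] ++ [y])) :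
    x < y ↔ boxCol ρ x < boxCol (ρ ++ [x]) y := by
  rw [lt_iff_boxRow h, boxCol, boxCol]
  constructor
  · intro h1
    have h2 := egShape_antitone h.left h1
    rw [egShape_concat_apply h.left, if_pos rfl] at h2
    omega
  · intro h1
    by_contra h2
    rw [egShape_concat_apply h.left, if_neg (by omega)] at h1
    have := egShape_antitone h.left.left (not_le.1 h2).le
    omega

/-- Prepending letters moves the box of the last letter weakly to the right. -/
theorem boxCol_le_append_left {d ρ : List ℕ} {x : ℕ} (h : IsReducedWord (d ++ ρ ++ [x])) :
    boxCol ρ x ≤ boxCol (d ++ ρ) x := by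
  induction hn : ρ.length using Nat.strong_induction_on generalizing ρ x with
  | _ n ih =>
    have hx : IsReducedWord (ρ ++ [x]) := by rw [List.append_assoc] at h; exact h.right
    rcases Nat.eq_zero_or_pos (boxCol ρ x) with h0 | h0
    · omega
    · classical
      have hex : ∃ k, egShape ρ k < boxCol ρ x :=
        ⟨ρ.length, by rw [egShape_eq_zero_of_length_le hx.left le_rfl]; exact h0⟩
      obtain ⟨k, hk, hmin⟩ : ∃ k, egShape ρ k < boxCol ρ x ∧ ∀ j < k, boxCol ρ x ≤ egShape ρ j :=
        ⟨Nat.find hex, Nat.find_spec hex, fun j hj => not_lt.1 (Nat.find_min hex hj)⟩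
      have hrk : boxRow ρ x < k := by
        by_contra hlt
        have := egShape_antitone hx.left (not_lt.1 hlt)
        rw [boxCol] at hk
        omega
      obtain ⟨i, rfl⟩ : ∃ i, k = i + 1 := ⟨k - 1, by omega⟩
      have hi := hmin i (by omega)
      have hi' : egShape ρ i ≤ boxCol ρ x := egShape_antitone hx.left (by omega)
      obtain ⟨σ, y, e, hrow⟩ := endsInRow_of_corner hx.left (c := i) (by omega)
      have e1 := (e.append_left d).append_right [x]
      rw [← List.append_assoc] at e1
      have hr := e1.symm.isReducedWord h
      have hr2 : IsReducedWord (σ ++ [y] ++ [x]) := by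
        simpa using IsReducedWord.right (a := d) (by simpa using hr)
      have hlen := e.length_eq
      rw [List.length_append, List.length_singleton] at hlen
      have h1 := ih σ.length (by omega) (x := y) hr.left rfl
      have hyx : y < x := (lt_iff_boxRow hr2).2 (by rw [e.boxRow_eq hr2, hrow]; omega)
      have h2 := (lt_iff_boxCol hr).1 hyx
      have e2 := e.append_left d
      rw [← List.append_assoc] at e2
      rw [e2.boxCol_eq hr] at h2
      have h3 : boxCol ρ x = boxCol σ y + 1 := by
        have h4 := egShape_concat_apply hr2.left i
        rw [← hrow, if_pos rfl, e.egShape_eq hr2.left, hrow] at h4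
        rw [boxCol.eq_def σ, hrow]
        omega
      omega

/-- `d` is the decreasing left factor of `ρ` that removes one box from every row of length at
least `j`. -/
def IsCol (j : ℕ) (ρ d : List ℕ) : Prop :=
  d.Pairwise (· > ·) ∧ ∃ v, CKEquiv (d ++ v) ρ ∧
    ∀ i, egShape v i = egShape ρ i - if j ≤ egShape ρ i then 1 else 0

theorem IsCol.congr {j : ℕ} {ρ σ d : List ℕ} (hd : IsCol j ρ d) (e : CKEquiv ρ σ)
    (h : IsReducedWord ρ) : IsCol j σ d := by
  obtain ⟨hd, v, e', hv⟩ := hd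
  exact ⟨hd, v, e'.trans e, by rw [← e.egShape_eq h]; exact hv⟩

theorem IsCol.concat {j : ℕ} {ρ d : List ℕ} {x : ℕ} (hd : IsCol j ρ d)
    (h : IsReducedWord (ρ ++ [x])) (hj : 1 ≤ j) (hx : boxCol ρ x + 1 ≠ j) :
    IsCol j (ρ ++ [x]) d := by
  obtain ⟨hd, v, e, hv⟩ := hd
  have hr := (e.append_right [x]).symm.isReducedWord h
  have hr2 : IsReducedWord (v ++ [x]) := by rw [List.append_assoc] at hr; exact hr.right
  refine ⟨hd, v ++ [x], by simpa using e.append_right [x], fun i => ?_⟩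
  have hrow : boxRow v x = boxRow ρ x := by
    by_contra hne
    have h1 := egShape_right_le (u := d) (v := v ++ [x]) (by simpa using hr) (boxRow v x)
    rw [← List.append_assoc, (e.append_right [x]).egShape_eq hr, egShape_concat_apply h,
      egShape_concat_apply hr2, if_pos rfl, if_neg hne, hv] at h1
    have h2 := boxCol_le_append_left hr
    rw [e.boxCol_eq hr, boxCol, hv] at h2
    have h3 := egShape_decreasing_append_le (d := d) (v := v ++ [x]) (by simpa using hr) hd
      (boxRow ρ x)
    rw [← List.append_assoc, (e.append_right [x]).egShape_eq hr, egShape_concat_apply h,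
      egShape_concat_apply hr2, if_pos rfl, if_neg (Ne.symm hne), hv] at h3
    rw [boxCol] at h2 hx
    split_ifs at * <;> omega
  rw [egShape_concat_apply h, egShape_concat_apply hr2, hrow, hv]
  rw [boxCol] at hx
  by_cases hi : i = boxRow ρ x
  · subst hi
    simp only [if_true]
    split_ifs <;> omega
  · simp only [if_neg hi, add_zero]

theorem IsCol.append {j : ℕ} {ρ d q : List ℕ} (hd : IsCol j ρ d) (h : IsReducedWord (ρ ++ q))
    (hj : 1 ≤ j) (hq : ∀ i, egShape (ρ ++ q) i < j ∨ egShape (ρ ++ q) i = egShape ρ i) :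
    IsCol j (ρ ++ q) d := by
  induction q using List.reverseRecOn with
  | nil => simpa using hd
  | append_singleton q x ih =>
    rw [← List.append_assoc] at *
    have h1 := fun i => egShape_le_append h.left i
    have h2 := fun i => egShape_concat_apply h i
    refine (ih h.left fun i => ?_).concat h hj fun hx => ?_
    · have := h1 i
      have := h2 i
      have := hq i
      omega
    · rw [boxCol] at hx
      have h3 := h2 (boxRow (ρ ++ q) x)
      rw [if_pos rfl] at h3
      have := h1 (boxRow (ρ ++ q) x)
      have := hq (boxRow (ρ ++ q) x)
      omega

theorem IsCol.unique {j : ℕ} {ρ d d' : List ℕ} (h : IsReducedWord ρ) (hd : IsCol j ρ d)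
    (hd' : IsCol j ρ d') : d = d' := by
  obtain ⟨hd, v, e, hv⟩ := hd
  obtain ⟨hd', v', e', hv'⟩ := hd'
  have hs : egShape v = egShape v' := funext fun i => by rw [hv, hv']
  have hr := e.symm.isReducedWord h
  have hr' := e'.symm.isReducedWord h
  have e2 := (e.trans e'.symm).reverse
  have hr2 := hr.reverse
  rw [List.reverse_append] at e2 hr2
  rw [List.reverse_append] at e2
  have h1 := right_factor_unique hr2 e2 (List.pairwise_reverse.2 hd) (List.pairwise_reverse.2 hd')
    (funext fun k => by
      rw [egShape_reverse hr.right (n := v.length + v'.length) (by omega),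
        egShape_reverse hr'.right (n := v.length + v'.length) (by omega), hs])
  exact List.reverse_injective h1.1

/-- The first column of the shape is a column factor. -/
theorem exists_isCol_one {ρ : List ℕ} (h : IsReducedWord ρ) {j : ℕ} (hj : 1 ≤ j)
    (hρ : ∀ i, egShape ρ i = 0 ∨ j ≤ egShape ρ i) :
    ∃ d, IsCol j ρ d ∧ egFirst ρ = d.toFinset := by
  obtain ⟨p, q, e, hs, hq⟩ := exists_initial_of_horizontal h.reverse
    (μ := fun i => egShape ρ.reverse (i + 1))
    (fun k => egShape_antitone h.reverse (by omega)) (fun k => le_rfl)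
  have hr := e.symm.isReducedWord h.reverse
  have e' := e.reverse
  rw [List.reverse_append, List.reverse_reverse] at e'
  have hr' := e'.symm.isReducedWord h
  have hv : ∀ i, egShape p.reverse i = egShape ρ i - 1 := fun i => by
    have key : ∀ k, k < egShape p.reverse i ↔ k + 1 < egShape ρ i := fun k => by
      rw [lt_egShape_reverse_iff hr.left, hs, lt_egShape_reverse_iff h]
    have k1 := key (egShape p.reverse i)
    have k2 := key (egShape p.reverse i - 1)
    omega
  have hd : q.reverse.Pairwise (· > ·) := List.pairwise_reverse.2 hq
  refine ⟨q.reverse, ⟨hd, p.reverse, e', fun i => ?_⟩, ?_⟩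
  · rw [hv]
    rcases hρ i with h0 | h0
    · rw [h0]; split_ifs <;> omega
    · rw [if_pos h0]
  · rw [← egFirst_of_decreasing hr'.left hd, ← e'.egFirst_eq hr']
    symm
    apply Finset.eq_of_subset_of_card_le (egFirst_subset_append hr')
    rw [egFirst_of_decreasing hr'.left hd, e'.egFirst_eq hr', card_egFirst h le_rfl,
      List.toFinset_card_of_nodup (hd.imp fun hab => (ne_of_gt hab))]
    have h1 := sum_egShape h le_rfl
    have h2 := sum_egShape hr'.right (n := ρ.length) (by
      have := e'.length_eq
      rw [List.length_append] at this
      omega)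
    have h3 := e'.length_eq
    rw [List.length_append] at h3
    have h4 : ∑ i ∈ Finset.range ρ.length, egShape ρ i = ∑ i ∈ Finset.range ρ.length,
        (egShape p.reverse i + if 0 < egShape ρ i then 1 else 0) :=
      Finset.sum_congr rfl fun i _ => by rw [hv]; split_ifs <;> omega
    rw [Finset.sum_add_distrib] at h4
    rw [Finset.card_filter]
    omega

/-- `p` is an initial factor of a word in the class of `ρ` whose shape consists of the rows of
length at least `j`. -/
def IsPre (j : ℕ) (ρ p : List ℕ) : Prop :=
  ∃ q, CKEquiv (p ++ q) ρ ∧ ∀ i, egShape p i = if j ≤ egShape ρ i then egShape ρ i else 0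

theorem exists_isPre {ρ : List ℕ} (h : IsReducedWord ρ) (j : ℕ) : ∃ p, IsPre j ρ p := by
  obtain ⟨p, q, e, hs, -⟩ := exists_initial h
    (μ := fun i => if j ≤ egShape ρ i then egShape ρ i else 0) (fun i k hik => by
      have := egShape_antitone h hik
      dsimp only
      split_ifs <;> omega) (fun i => by split_ifs <;> omega)
  exact ⟨p, q, e, congrFun hs⟩

theorem IsPre.exists_isCol {j : ℕ} {ρ p : List ℕ} (h : IsReducedWord ρ) (hj : 1 ≤ j)
    (hp : IsPre j ρ p) : ∃ d, IsCol j ρ d ∧ egFirst p = d.toFinset := by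
  obtain ⟨q, e, hs⟩ := hp
  have hr := e.symm.isReducedWord h
  obtain ⟨d, hd, hF⟩ := exists_isCol_one hr.left hj fun i => by
    rw [hs]
    split_ifs <;> omega
  refine ⟨d, (hd.append hr hj fun i => ?_).congr e hr, hF⟩
  rw [e.egShape_eq hr, hs]
  split_ifs <;> omega

/-- The entries indexing the rows of length at least `j` of the weak insertion tableau. -/
noncomputable def egCol (j : ℕ) (ρ : List ℕ) : Finset ℕ := by
  classical exact if h : ∃ d, IsCol j ρ d then h.choose.toFinset else ∅

theorem IsCol.egCol_eq {j : ℕ} {ρ d : List ℕ} (hd : IsCol j ρ d) (h : IsReducedWord ρ) :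
    egCol j ρ = d.toFinset := by
  have hex : ∃ d, IsCol j ρ d := ⟨d, hd⟩
  rw [egCol, dif_pos hex, hex.choose_spec.unique h hd]

theorem IsPre.egCol_eq {j : ℕ} {ρ p : List ℕ} (hp : IsPre j ρ p) (h : IsReducedWord ρ)
    (hj : 1 ≤ j) : egCol j ρ = egFirst p := by
  obtain ⟨d, hd, hF⟩ := hp.exists_isCol h hj
  rw [hd.egCol_eq h, hF]

theorem CKEquiv.egCol_eq {ρ σ : List ℕ} (e : CKEquiv ρ σ) (h : IsReducedWord ρ) {j : ℕ}
    (hj : 1 ≤ j) : egCol j ρ = egCol j σ := by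
  obtain ⟨p, hp⟩ := exists_isPre h j
  obtain ⟨d, hd, -⟩ := hp.exists_isCol h hj
  rw [hd.egCol_eq h, (hd.congr e h).egCol_eq (e.isReducedWord h)]

theorem egCol_one {ρ : List ℕ} (h : IsReducedWord ρ) : egCol 1 ρ = egFirst ρ :=
  IsPre.egCol_eq ⟨[], by rw [List.append_nil]; exact CKEquiv.refl _, fun i => by
    split_ifs <;> omega⟩ h le_rfl

theorem egCol_succ_subset {ρ : List ℕ} (h : IsReducedWord ρ) {j : ℕ} (hj : 1 ≤ j) :
    egCol (j + 1) ρ ⊆ egCol j ρ := by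
  obtain ⟨p, hp⟩ := exists_isPre h j
  have hp' := hp
  obtain ⟨q, e, hs⟩ := hp'
  have hr := e.symm.isReducedWord h
  obtain ⟨p', hp'⟩ := exists_isPre hr.left (j + 1)
  have hp'' := hp'
  obtain ⟨q', e', hs'⟩ := hp''
  have hr' := e'.symm.isReducedWord hr.left
  have h1 : IsPre (j + 1) ρ p' := by
    refine ⟨q' ++ q, ?_, fun i => ?_⟩
    · rw [← List.append_assoc]
      exact (e'.append_right q).trans e
    · rw [hs', hs]
      split_ifs <;> omega
  rw [hp.egCol_eq h hj, h1.egCol_eq h (by omega), ← e'.egFirst_eq hr']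
  exact egFirst_subset_append hr'

theorem card_egCol {ρ : List ℕ} (h : IsReducedWord ρ) {j : ℕ} (hj : 1 ≤ j) {n : ℕ}
    (hn : ρ.length ≤ n) :
    (egCol j ρ).card = ((Finset.range n).filter fun i => j ≤ egShape ρ i).card := by
  obtain ⟨p, hp⟩ := exists_isPre h j
  rw [hp.egCol_eq h hj]
  obtain ⟨q, e, hs⟩ := hp
  have hr := e.symm.isReducedWord h
  have hl := e.length_eq
  rw [List.length_append] at hl
  rw [card_egFirst hr.left (n := n) (by omega)]
  congr 1
  ext i
  simp only [Finset.mem_filter, hs]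
  split_ifs <;> simp <;> omega

/-! ### Adding a row -/

theorem eq_nil_of_egShape {p : List ℕ} (h : IsReducedWord p) (hp : ∀ i, egShape p i = 0) :
    p = [] := by
  have h1 := sum_egShape h le_rfl
  rwa [Finset.sum_eq_zero fun i _ => hp i, eq_comm, List.length_eq_zero_iff] at h1

theorem egShape_nil (i : ℕ) : egShape [] i = 0 := by
  induction i with
  | zero => rfl
  | succ i ih => exact ih

/-- An increasing word appended below which no row changes fills the first empty row. -/
theorem egShape_fill {p b : List ℕ} (h : IsReducedWord (p ++ b)) (hb : b.Pairwise (· < ·)) {a : ℕ}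
    (hp : ∀ i, a ≤ i → egShape p i = 0) (hs : ∀ i < a, egShape (p ++ b) i = egShape p i) :
    (∀ i, egShape (p ++ b) i = egShape p i + if i = a then b.length else 0) ∧
      (b ≠ [] → ∃ r ∉ egFirst p, egFirst (p ++ b) = insert r (egFirst p)) := by
  induction b using List.reverseRecOn with
  | nil => simp
  | append_singleton b x ih =>
    have h2 := egShape_append_succ_le h hb
    rw [← List.append_assoc] at h hs h2
    have h1 := egShape_concat_apply h
    have h0 := egShape_le_append h.left
    obtain ⟨ih1, ih2⟩ := ih h.left (List.pairwise_append.1 hb).1 fun i hi => by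
      have := hs i hi
      have := h1 i
      have := h0 i
      omega
    have hr : boxRow (p ++ b) x = a := by
      by_contra hne
      have e1 := h1 (boxRow (p ++ b) x)
      rw [if_pos rfl, ih1, if_neg hne] at e1
      rcases lt_or_gt_of_ne hne with hlt | hlt
      · have := hs _ hlt
        omega
      · have := h2 (boxRow (p ++ b) x - 1)
        rw [Nat.sub_add_cancel (by omega), hp (boxRow (p ++ b) x - 1) (by omega)] at this
        omega
    rw [← List.append_assoc]
    refine ⟨fun i => ?_, fun _ => ?_⟩
    · rw [h1, ih1, hr, List.length_append, List.length_singleton]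
      split_ifs <;> omega
    · have h3 := egFirst_concat h
      rw [hr, ih1, if_pos rfl, hp a le_rfl] at h3
      rcases List.eq_nil_or_concat' b with rfl | ⟨b', y, hb'⟩
      · simpa using h3.2 (by simp)
      · rw [h3.1 (by simp [hb'])]
        exact ih2 (by simp [hb'])

theorem egShape_increasing {b : List ℕ} (h : IsReducedWord b) (hb : b.Pairwise (· < ·)) (i : ℕ) :
    egShape b i = if i = 0 then b.length else 0 := by
  have := (egShape_fill (p := []) (a := 0) h hb (fun i _ => egShape_nil i) (by simp)).1 i
  simpa [egShape_nil] using this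

theorem exists_increasing_initial {w : List ℕ} (h : IsReducedWord w) {c : ℕ}
    (hc : c ≤ egShape w 0) :
    ∃ b q, CKEquiv (b ++ q) w ∧ b.Pairwise (· < ·) ∧ b.length = c := by
  obtain ⟨b, q, e, hs, -⟩ := exists_initial h (μ := fun i => if i = 0 then c else 0)
    (fun i j hij => by dsimp only; split_ifs <;> omega) (fun i => by
      split_ifs with hi
      · rwa [hi]
      · omega)
  have hr := e.symm.isReducedWord h
  obtain ⟨p, b', e', hs', hb'⟩ := exists_initial_of_horizontal hr.left (μ := fun _ => 0)
    (fun k => by omega) (fun k => by rw [hs]; simp)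
  have hr' := e'.symm.isReducedWord hr.left
  rw [eq_nil_of_egShape hr'.left (congrFun hs'), List.nil_append] at e' hr'
  refine ⟨b', q, (e'.append_right q).trans e, hb', ?_⟩
  have h1 := egShape_increasing hr' hb' 0
  rw [e'.egShape_eq hr', hs] at h1
  simpa using h1.symm

theorem lt_of_two_rows {p b b' : List ℕ} {m r r' : ℕ} (h : IsReducedWord (p ++ b ++ b'))
    (hb : b.Pairwise (· < ·)) (hb' : b'.Pairwise (· < ·)) (hlen : b'.length = b.length)
    (hne : b ≠ []) (hp : ∀ i, m ≤ i → egShape p i = 0)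
    (hs : ∀ i < m, egShape (p ++ b) i = egShape p i)
    (hs' : ∀ i < m + 1, egShape (p ++ b ++ b') i = egShape (p ++ b) i)
    (hr : egFirst (p ++ b) = insert r (egFirst p))
    (hr' : egFirst (p ++ b ++ b') = insert r' (egFirst (p ++ b))) : r' < r := by
  obtain ⟨f1, -⟩ := egShape_fill h.left hb hp hs
  have hw : IsReducedWord (b ++ b') := by rw [List.append_assoc] at h; exact h.right
  have w1 : ∀ i, egShape (b ++ b') (i + 2) = 0 := fun i => by
    have := egShape_append_succ_le hw hb' (i + 1)
    rw [egShape_increasing hw.left hb] at this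
    simpa using this
  have w0 : egShape (b ++ b') 0 = b.length := by
    apply le_antisymm
    · obtain ⟨b₀, q, e, hb₀, hl⟩ := exists_increasing_initial hw le_rfl
      have e1 := e.append_left p
      rw [← List.append_assoc, ← List.append_assoc] at e1
      have h1 := e1.symm.isReducedWord h
      have h2 := egShape_le_append h1
      rw [e1.egShape_eq h1] at h2
      have h3 := (egShape_fill h1.left hb₀ hp fun i hi => by
        have := h2 i
        have := hs i hi
        have := hs' i (by omega)
        have := egShape_le_append h1.left i
        omega).1 m
      have h4 := h2 m
      rw [hs' m (by omega), f1, if_pos rfl] at h4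
      rw [if_pos rfl] at h3
      omega
    · have := egShape_le_append hw 0
      rwa [egShape_increasing hw.left hb, if_pos rfl] at this
  have w2 : egShape (b ++ b') 1 = b.length := by
    have h1 := sum_egShape hw (n := 2 + (b ++ b').length) (by omega)
    rw [Finset.sum_range_add, Finset.sum_eq_zero (s := Finset.range (b ++ b').length)
      (fun i _ => by rw [add_comm]; exact w1 i), Finset.sum_range_succ, Finset.sum_range_one,
      w0, List.length_append] at h1
    omega
  obtain ⟨z₁, b₁, rfl⟩ := List.exists_cons_of_ne_nil hne
  have hrev : (z₁ :: b₁ ++ b').reverse = b'.reverse ++ b₁.reverse ++ [z₁] := by simp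
  have hred := hw.reverse
  have hsh : ∀ k, egShape (b'.reverse ++ b₁.reverse ++ [z₁]) k =
      if k < (z₁ :: b₁).length then 2 else 0 := fun k => by
    have key : ∀ i, i < egShape (z₁ :: b₁ ++ b').reverse k ↔ k < egShape (z₁ :: b₁ ++ b') i :=
      fun i => lt_egShape_reverse_iff hw
    rw [← hrev]
    have k0 := key 0
    have k1 := key 1
    have k2 := key 2
    rw [w0] at k0
    rw [w2] at k1
    rw [w1 0] at k2
    split_ifs <;> omega
  rw [hrev] at hred
  have hrow : boxRow (b'.reverse ++ b₁.reverse) z₁ + 1 = (z₁ :: b₁).length := by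
    have := corner_boxRow hred
    rw [hsh, hsh] at this
    split_ifs at this <;> omega
  have hsh0 := fun k => egShape_concat_apply hred k
  have hlb : (z₁ :: b₁).length = b₁.length + 1 := rfl
  obtain ⟨w', z₂, e, hz₂⟩ := endsInRow_of_corner hred.left (c := b₁.length) (by
    have h1 := hsh0 b₁.length
    have h2 := hsh0 (b₁.length + 1)
    rw [hsh] at h1 h2
    split_ifs at h1 h2 <;> omega)
  have e1 := (e.append_right [z₁])
  have hred1 := e1.symm.isReducedWord hred
  have hz : z₂ < z₁ := (lt_iff_boxRow hred1).2 (by rw [e.boxRow_eq hred1, hz₂]; omega)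
  have e2 : CKEquiv (p ++ [z₁] ++ [z₂] ++ w'.reverse) (p ++ z₁ :: b₁ ++ b') := by
    have := e1.reverse.append_left p
    simpa using this
  have hR := e2.symm.isReducedWord h
  have hm : boxRow p z₁ = m := by
    apply boxRow_eq_of hR.left.left
    have h1 : IsReducedWord (p ++ [z₁]) := hR.left.left
    have h2 : IsReducedWord (p ++ [z₁] ++ b₁) := by simpa using h.left
    have h3 := (egShape_fill h1 (List.pairwise_singleton _ _) hp fun i hi => by
      have e3 := egShape_le_append h2 i
      have e4 := egShape_le_append h1 i
      have e5 := hs i hi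
      simp only [List.append_assoc, List.cons_append, List.nil_append] at e3 e4 e5
      omega).1 m
    rw [h3]
    simp
  obtain ⟨s, hs0, hs1⟩ := (egFirst_concat hR.left.left).2 (by rw [hm]; exact hp m le_rfl)
  obtain ⟨s', hs0', hs1'⟩ := (egFirst_concat hR.left).2 (by
    have h1 := (boxRow_boxRow hR.left).2 hz
    rw [egShape_concat_apply hR.left.left, if_neg (by omega), hp _ (by omega)])
  have hlt := egFirst_concat_concat hR.left hz hs1 hs0 hs1' hs0'
  have e3 : egFirst (p ++ [z₁]) ⊆ egFirst (p ++ z₁ :: b₁) := by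
    have := egFirst_subset_append (ρ := p ++ [z₁]) (u := b₁) (by simpa using h.left)
    simpa using this
  have e4 := egFirst_subset_append hR
  rw [e2.egFirst_eq hR, hr', hs1'] at e4
  have hsr : s = r := by
    have := e3 (hs1 ▸ Finset.mem_insert_self s _)
    rw [hr, Finset.mem_insert] at this
    exact this.resolve_right hs0
  have hsr' : s' = r' := by
    have := e4 (Finset.mem_insert_self s' _)
    rw [hr, ← hsr, ← hs1, Finset.mem_insert] at this
    exact this.resolve_right hs0'
  omega

theorem lt_of_fill {p b : List ℕ} {a c r s : ℕ} (h : IsReducedWord (p ++ b))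
    (hb : b.Pairwise (· < ·)) (hlen : b.length = c) (hc : 1 ≤ c)
    (hp : ∀ i, a ≤ i → egShape p i = 0) (hpc : ∀ i < a, c ≤ egShape p i)
    (hs : ∀ i < a, egShape (p ++ b) i = egShape p i)
    (hr : egFirst (p ++ b) = insert r (egFirst p))
    (h1 : s ∈ egFirst p) (h2 : s ∉ egCol (c + 1) p) : r < s := by
  induction a generalizing p b r s with
  | zero =>
    rw [eq_nil_of_egShape h.left fun i => hp i (by omega)] at h1
    simp at h1
  | succ a ih =>
    by_cases hca : c + 1 ≤ egShape p a
    · refine absurd h1 ?_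
      rw [← IsPre.egCol_eq (j := c + 1) ⟨[], by rw [List.append_nil]; exact CKEquiv.refl _,
        fun i => ?_⟩ h.left (by omega)]
      · exact h2
      · rcases Nat.lt_or_ge i (a + 1) with hi | hi
        · rw [if_pos (hca.trans (egShape_antitone h.left (by omega)))]
        · rw [hp i hi]; simp
    · have hca' : egShape p a = c := by have := hpc a (by omega); omega
      obtain ⟨p₃, b₃, e, hs₃, hb₃⟩ := exists_initial_of_horizontal h.left
        (μ := fun i => if i < a then egShape p i else 0)
        (fun i => by split_ifs <;> omega) (fun i => by
          split_ifs with hi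
          · exact egShape_antitone h.left (by omega)
          · exact (hp _ (by omega)).le)
      have hred := e.symm.isReducedWord h.left
      have hs₃' : ∀ i, egShape p₃ i = if i < a then egShape p i else 0 := congrFun hs₃
      have hp₃ : ∀ i, a ≤ i → egShape p₃ i = 0 := fun i hi => by
        rw [hs₃', if_neg (by omega)]
      have hf : ∀ i < a, egShape (p₃ ++ b₃) i = egShape p₃ i := fun i hi => by
        rw [e.egShape_eq hred, hs₃', if_pos hi]
      obtain ⟨f1, f2⟩ := egShape_fill hred hb₃ hp₃ hf
      have hl : b₃.length = c := by
        have := f1 a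
        rw [e.egShape_eq hred, hp₃ a le_rfl, if_pos rfl] at this
        omega
      obtain ⟨r₃, hr₃, hF⟩ := f2 (by rintro rfl; simp at hl; omega)
      have e1 := e.append_right b
      have hred1 := e1.symm.isReducedWord h
      have hlt : r < r₃ := by
        refine lt_of_two_rows hred1 hb₃ hb (by omega) (by rintro rfl; simp at hl; omega) hp₃ hf
          (fun i hi => ?_) hF ?_
        · rw [e1.egShape_eq hred1, hs i hi, e.egShape_eq hred]
        · rw [e1.egFirst_eq hred1, hr, e.egFirst_eq hred]
      rw [← e.egFirst_eq hred, hF, Finset.mem_insert] at h1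
      rcases h1 with rfl | h1
      · exact hlt
      · refine hlt.trans (ih hred hb₃ hl hp₃ (fun i hi => ?_) hf hF h1 fun h3 => h2 ?_)
        · rw [hs₃', if_pos hi]
          exact hpc i (by omega)
        · obtain ⟨p', hp'⟩ := exists_isPre hred.left (c + 1)
          rw [hp'.egCol_eq hred.left (by omega)] at h3
          obtain ⟨q', e', hs'⟩ := hp'
          rw [IsPre.egCol_eq (p := p') ⟨q' ++ b₃, ?_, fun i => ?_⟩ h.left (by omega)]
          · exact h3
          · rw [← List.append_assoc]
            exact (e'.append_right b₃).trans e
          · rw [hs', hs₃']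
            rcases Nat.lt_trichotomy i a with hi | rfl | hi
            · rw [if_pos hi]
            · simp [hca']
            · rw [hp i (by omega)]; simp

theorem exists_fill_of_concat {ρ : List ℕ} {x : ℕ} (h : IsReducedWord (ρ ++ [x])) :
    ∃ p b, b.Pairwise (· < ·) ∧ b.length = boxCol ρ x + 1 ∧ IsReducedWord (p ++ b) ∧
      IsPre (boxCol ρ x + 1) ρ p ∧ IsPre (boxCol ρ x + 1) (ρ ++ [x]) (p ++ b) ∧
      (∀ i, egShape p i = if i < boxRow ρ x then egShape ρ i else 0) ∧
      (∀ i < boxRow ρ x, boxCol ρ x + 1 ≤ egShape ρ i) ∧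
      (∀ i < boxRow ρ x, egShape (p ++ b) i = egShape p i) := by
  obtain ⟨p, hp⟩ := exists_isPre h.left (boxCol ρ x + 1)
  have hx := fun i => egShape_concat_apply h i
  have hge : ∀ i < boxRow ρ x, boxCol ρ x + 1 ≤ egShape ρ i := fun i hi => by
    have := egShape_antitone h hi.le
    rw [hx, hx, if_pos rfl, if_neg (by omega)] at this
    exact this
  have hlt : ∀ i, boxRow ρ x ≤ i → egShape ρ i ≤ boxCol ρ x := fun i hi =>
    egShape_antitone h.left hi
  have hp' := hp
  obtain ⟨q, e, hs⟩ := hp'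
  have hsp : ∀ i, egShape p i = if i < boxRow ρ x then egShape ρ i else 0 := fun i => by
    rw [hs]
    split_ifs with h1 h2 h2
    · rfl
    · have := hlt i (by omega); omega
    · have := hge i h2; omega
    · rfl
  have e1 : CKEquiv (p ++ (q ++ [x])) (ρ ++ [x]) := by
    rw [← List.append_assoc]
    exact e.append_right [x]
  have hr := e1.symm.isReducedWord h
  have hc : boxCol ρ x + 1 ≤ egShape (q ++ [x]) 0 := by
    by_contra hlt'
    have h1 := egShape_append_reverse_le_add (p := (q ++ [x]).reverse) (u := p) (boxCol ρ x)
      (fun i hi => by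
        by_contra hne
        have := (lt_egShape_reverse_iff hr.right).1 (Nat.pos_of_ne_zero hne)
        omega) (by simpa using hr) (boxRow ρ x)
    rw [List.reverse_reverse, e1.egShape_eq hr, hx, if_pos rfl, hsp, if_neg (by omega),
      ← boxCol] at h1
    omega
  obtain ⟨b, q', e2, hb, hl⟩ := exists_increasing_initial hr.right hc
  have e3 : CKEquiv (p ++ b ++ q') (ρ ++ [x]) := by
    rw [List.append_assoc]
    exact (e2.append_left p).trans e1
  have hr3 := e3.symm.isReducedWord h
  have hsb : ∀ i < boxRow ρ x, egShape (p ++ b) i = egShape p i := fun i hi => by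
    have h1 := egShape_le_append hr3 i
    have h2 := egShape_le_append hr3.left i
    rw [e3.egShape_eq hr3, hx, if_neg (by omega)] at h1
    have h3 := hsp i
    rw [if_pos hi] at h3
    omega
  have hf := (egShape_fill hr3.left hb (fun i hi => by rw [hsp, if_neg (by omega)]) hsb).1
  refine ⟨p, b, hb, hl, hr3.left, hp, ⟨q', e3, fun i => ?_⟩, hsp, hge, hsb⟩
  rw [hf, hx, hsp, hl]
  rcases Nat.lt_trichotomy i (boxRow ρ x) with hi | rfl | hi
  · simp [hi, hi.ne, hge i hi]
  · rw [← boxCol]; simp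
  · have := hlt i (by omega)
    simp [hi.ne', hi.not_gt, this]

theorem egCol_concat {ρ : List ℕ} {x : ℕ} (h : IsReducedWord (ρ ++ [x])) :
    ∃ r ∉ egCol (boxCol ρ x + 1) ρ,
      egCol (boxCol ρ x + 1) (ρ ++ [x]) = insert r (egCol (boxCol ρ x + 1) ρ) ∧
      ∀ s ∈ egCol (boxCol ρ x + 1) ρ, s ∉ egCol (boxCol ρ x + 2) ρ → r < s := by
  obtain ⟨p, b, hb, hl, hr, hp, hpb, hsp, hge, hsb⟩ := exists_fill_of_concat h
  have hp0 : ∀ i, boxRow ρ x ≤ i → egShape p i = 0 := fun i hi => by rw [hsp, if_neg (by omega)]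
  obtain ⟨r, h1, h2⟩ := (egShape_fill hr hb hp0 hsb).2 (by rintro rfl; simp at hl)
  rw [hp.egCol_eq h.left (by omega), hpb.egCol_eq h (by omega)]
  refine ⟨r, h1, h2, fun s hs hs' => ?_⟩
  refine lt_of_fill hr hb hl (by omega) hp0 (fun i hi => ?_) hsb h2 hs fun h3 => hs' ?_
  · rw [hsp, if_pos hi]; exact hge i hi
  · obtain ⟨p', hp'⟩ := exists_isPre hr.left (boxCol ρ x + 2)
    rw [hp'.egCol_eq hr.left (by omega)] at h3
    obtain ⟨q', e', hs'⟩ := hp'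
    obtain ⟨q, e, hs⟩ := hp
    rw [IsPre.egCol_eq (p := p') ⟨q' ++ q, ?_, fun i => ?_⟩ h.left (by omega)]
    · exact h3
    · rw [← List.append_assoc]
      exact (e'.append_right q).trans e
    · rw [hs', hs]
      split_ifs <;> omega

theorem egCol_concat_of_ne {ρ : List ℕ} {x : ℕ} (h : IsReducedWord (ρ ++ [x])) {j : ℕ} (hj : 1 ≤ j)
    (hx : boxCol ρ x + 1 ≠ j) : egCol j (ρ ++ [x]) = egCol j ρ := by
  obtain ⟨p, hp⟩ := exists_isPre h.left j
  obtain ⟨d, hd, -⟩ := hp.exists_isCol h.left hj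
  rw [hd.egCol_eq h.left, (hd.concat h hj hx).egCol_eq h]

/-- The weak composition recorded by the columns `egCol`: `r` lies in the first
`egComp ρ r` columns. -/
noncomputable def egComp (ρ : List ℕ) (r : ℕ) : ℕ :=
  Nat.findGreatest (fun j => r ∈ egCol j ρ) ρ.length

theorem egCol_anti {ρ : List ℕ} (h : IsReducedWord ρ) {i j : ℕ} (hi : 1 ≤ i) (hij : i ≤ j) :
    egCol j ρ ⊆ egCol i ρ := by
  induction j, hij using Nat.le_induction with
  | base => exact subset_rfl
  | succ j hij ih => exact (egCol_succ_subset h (hi.trans hij)).trans ih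

theorem egShape_le_length {ρ : List ℕ} (h : IsReducedWord ρ) (k : ℕ) :
    egShape ρ k ≤ ρ.length := by
  by_cases hk : k < ρ.length
  · rw [← sum_egShape h le_rfl]
    exact Finset.single_le_sum (f := egShape ρ) (fun _ _ => Nat.zero_le _) (Finset.mem_range.2 hk)
  · rw [egShape_eq_zero_of_length_le h (by omega)]
    exact Nat.zero_le _

theorem le_length_of_mem_egCol {ρ : List ℕ} (h : IsReducedWord ρ) {j r : ℕ} (hj : 1 ≤ j)
    (hr : r ∈ egCol j ρ) : j ≤ ρ.length := by
  by_contra hlt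
  have := card_egCol h hj le_rfl
  rw [Finset.filter_false_of_mem fun i _ => by have := egShape_le_length h i; omega,
    Finset.card_empty, Finset.card_eq_zero] at this
  rw [this] at hr
  simp at hr

theorem le_egComp_iff {ρ : List ℕ} (h : IsReducedWord ρ) {j r : ℕ} (hj : 1 ≤ j) :
    j ≤ egComp ρ r ↔ r ∈ egCol j ρ := by
  refine ⟨fun hle => ?_, fun hr => Nat.le_findGreatest (le_length_of_mem_egCol h hj hr) hr⟩
  have hne : egComp ρ r ≠ 0 := by omega
  exact egCol_anti h hj hle (Nat.findGreatest_of_ne_zero (P := fun j => r ∈ egCol j ρ) rfl hne)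

theorem egComp_eq_of {ρ σ : List ℕ} (h : IsReducedWord ρ) (h' : IsReducedWord σ) {r s : ℕ}
    (hc : ∀ j, 1 ≤ j → (r ∈ egCol j ρ ↔ s ∈ egCol j σ)) : egComp ρ r = egComp σ s := by
  have key : ∀ j, j ≤ egComp ρ r ↔ j ≤ egComp σ s := fun j => by
    rcases Nat.eq_zero_or_pos j with rfl | hj
    · simp
    · rw [le_egComp_iff h hj, le_egComp_iff h' hj, hc j hj]
  exact le_antisymm ((key _).1 le_rfl) ((key _).2 le_rfl)

theorem CKEquiv.egComp_eq {ρ σ : List ℕ} (e : CKEquiv ρ σ) (h : IsReducedWord ρ) :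
    egComp ρ = egComp σ :=
  funext fun r => egComp_eq_of h (e.isReducedWord h) fun j hj => by rw [e.egCol_eq h hj]

@[simp]
theorem egComp_nil (r : ℕ) : egComp [] r = 0 := rfl

theorem egComp_concat {ρ : List ℕ} {x : ℕ} (h : IsReducedWord (ρ ++ [x])) :
    ∃ r, egComp ρ r = boxCol ρ x ∧
      (∀ s, egComp (ρ ++ [x]) s = egComp ρ s + if s = r then 1 else 0) ∧
      ∀ s < r, egComp ρ s ≠ boxCol ρ x + 1 := by
  obtain ⟨r, hr, hi, hlt⟩ := egCol_concat h
  have hne := fun j hj hx => egCol_concat_of_ne h (j := j) hj hx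
  have h1 : egComp ρ r = boxCol ρ x := by
    refine le_antisymm ?_ ?_
    · by_contra hc
      exact hr ((le_egComp_iff h.left (by omega)).1 (by omega))
    · rcases Nat.eq_zero_or_pos (boxCol ρ x) with h0 | h0
      · omega
      · rw [le_egComp_iff h.left h0, ← hne _ h0 (by omega)]
        refine egCol_succ_subset h h0 ?_
        rw [hi]
        exact Finset.mem_insert_self _ _
  have h2 : egComp (ρ ++ [x]) r = boxCol ρ x + 1 := by
    refine le_antisymm ?_ ?_
    · by_contra hc
      have : r ∈ egCol (boxCol ρ x + 2) (ρ ++ [x]) :=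
        (le_egComp_iff h (by omega)).1 (by omega)
      rw [hne _ (by omega) (by omega), ← le_egComp_iff h.left (by omega)] at this
      omega
    · rw [le_egComp_iff h (by omega), hi]
      exact Finset.mem_insert_self _ _
  refine ⟨r, h1, fun s => ?_, fun s hs he => ?_⟩
  · split_ifs with hs
    · rw [hs, h1, h2]
    · refine egComp_eq_of h h.left fun j hj => ?_
      by_cases hj' : boxCol ρ x + 1 = j
      · rw [← hj', hi, Finset.mem_insert, or_iff_right hs]
      · rw [hne j hj hj']
  · refine hs.not_gt (hlt s ?_ fun hm => ?_)
    · rw [← le_egComp_iff h.left (by omega), he]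
    · rw [← le_egComp_iff h.left (by omega)] at hm
      omega

theorem egShape_eq_of_egComp {ρ σ : List ℕ} (h : IsReducedWord ρ) (h' : IsReducedWord σ)
    (he : egComp ρ = egComp σ) : egShape ρ = egShape σ := by
  have hc : ∀ j, 1 ≤ j → egCol j ρ = egCol j σ := fun j hj => by
    ext r
    rw [← le_egComp_iff h hj, ← le_egComp_iff h' hj, he]
  have key : ∀ ρ : List ℕ, IsReducedWord ρ → ∀ j i, 1 ≤ j →
      (j ≤ egShape ρ i ↔ i < (egCol j ρ).card) := fun ρ h j i hj => by
    rw [card_egCol h hj le_rfl]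
    have hd : ∀ a b, a ≤ b → j ≤ egShape ρ b → j ≤ egShape ρ a := fun a b hab hb =>
      hb.trans (egShape_antitone h hab)
    have hmem : ∀ a, a ∈ (Finset.range ρ.length).filter (fun i => j ≤ egShape ρ i) ↔
        j ≤ egShape ρ a := fun a => by
      rw [Finset.mem_filter, Finset.mem_range, and_iff_right_iff_imp]
      intro ha
      by_contra hlt
      rw [egShape_eq_zero_of_length_le h (by omega)] at ha
      omega
    constructor
    · intro hi
      refine Nat.lt_of_succ_le ((Finset.card_range (i + 1)).symm.le.trans
        (Finset.card_le_card fun a ha => ?_))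
      rw [hmem]
      exact hd a i (by rw [Finset.mem_range] at ha; omega) hi
    · intro hi
      by_contra hlt
      refine hi.not_ge ((Finset.card_le_card fun a ha => ?_).trans (Finset.card_range i).le)
      rw [hmem] at ha
      rw [Finset.mem_range]
      by_contra hia
      exact hlt (hd i a (by omega) ha)
  funext i
  have key' : ∀ j, j ≤ egShape ρ i ↔ j ≤ egShape σ i := fun j => by
    rcases Nat.eq_zero_or_pos j with rfl | hj
    · simp
    · rw [key ρ h j i hj, key σ h' j i hj, hc j hj]
  exact le_antisymm ((key' _).1 le_rfl) ((key' _).2 le_rfl)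

theorem ckEquiv_of_egComp {ρ ρ' : List ℕ} {x x' : ℕ} (h : IsReducedWord (ρ ++ [x]))
    (e : CKEquiv (ρ ++ [x]) (ρ' ++ [x'])) (hA : egComp ρ = egComp ρ') :
    x = x' ∧ CKEquiv ρ ρ' :=
  ckEquiv_of_concat h e (egShape_eq_of_egComp h.left (e.isReducedWord h).left hA)

theorem exists_concat_of_egComp {ρ : List ℕ} (h : IsReducedWord ρ) {r : ℕ} (hr : 0 < egComp ρ r)
    (hmin : ∀ s < r, egComp ρ s ≠ egComp ρ r) :
    ∃ σ x, CKEquiv (σ ++ [x]) ρ ∧ boxCol σ x + 1 = egComp ρ r ∧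
      ∀ s, egComp ρ s = egComp σ s + if s = r then 1 else 0 := by
  obtain ⟨c, hc⟩ : ∃ c, egComp ρ r = c + 1 := ⟨_, (Nat.succ_pred_eq_of_pos hr).symm⟩
  obtain ⟨a, ha, ha'⟩ : ∃ a, egShape ρ a = c + 1 ∧ egShape ρ (a + 1) < egShape ρ a := by
    have hss : egCol (c + 2) ρ ⊂ egCol (c + 1) ρ := by
      refine (Finset.ssubset_iff_of_subset (egCol_succ_subset h (by omega))).2 ⟨r, ?_, ?_⟩
      · rw [← le_egComp_iff h (by omega), hc]
      · rw [← le_egComp_iff h (by omega), hc]; omega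
    have hlt := Finset.card_lt_card hss
    rw [card_egCol h (by omega) le_rfl, card_egCol h (by omega) le_rfl] at hlt
    have hex : ∃ a, egShape ρ a = c + 1 := by
      by_contra hne
      push Not at hne
      refine hlt.ne (congrArg _ (Finset.filter_congr fun i _ => ?_))
      have := hne i
      omega
    have hP : ∃ a, egShape ρ (a + 1) < c + 1 :=
      ⟨ρ.length, by rw [egShape_eq_zero_of_length_le h (by omega)]; omega⟩
    classical
    obtain ⟨a, ha⟩ := hex
    have hge : ∀ i ≤ Nat.find hP, c + 1 ≤ egShape ρ i := fun i hi => by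
      rcases i with _ | i
      · exact ha.symm.le.trans (egShape_antitone h (Nat.zero_le a))
      · exact not_lt.1 (Nat.find_min hP hi)
    have hs := Nat.find_spec hP
    have hm : a ≤ Nat.find hP := by
      by_contra hlt'
      have := egShape_antitone h (show Nat.find hP + 1 ≤ a by omega)
      omega
    have h1 := egShape_antitone h hm
    have h2 := hge _ le_rfl
    exact ⟨Nat.find hP, by omega, by omega⟩
  obtain ⟨σ, x, e, hx⟩ := endsInRow_of_corner h ha'
  have hr' := e.symm.isReducedWord h
  have hbc : boxCol σ x = c := by
    have := egShape_concat_apply hr' a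
    rw [e.egShape_eq hr', if_pos hx.symm, ha] at this
    rw [boxCol, hx]
    omega
  obtain ⟨r', h1, h2, h3⟩ := egComp_concat hr'
  rw [e.egComp_eq hr'] at h2
  have h4 := h2 r'
  rw [if_pos rfl, h1, hbc] at h4
  have h5 := h2 r
  have : r' = r := by
    rcases Nat.lt_trichotomy r' r with hlt | heq | hlt
    · exact absurd (by rw [h4, hc]) (hmin r' hlt)
    · exact heq
    · rw [if_neg hlt.ne, add_zero] at h5
      exact absurd (by omega) (h3 r hlt)
  subst this
  exact ⟨σ, x, e, by omega, h2⟩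

theorem forall_le_iff_egComp {ρ : List ℕ} (h : IsReducedWord ρ) (k : ℕ) :
    (∀ x ∈ ρ, k ≤ x) ↔ ∀ r < k, egComp ρ r = 0 := by
  constructor
  · intro hk r hr
    by_contra hne
    have := (le_egComp_iff h le_rfl).1 (Nat.one_le_iff_ne_zero.2 hne)
    rw [egCol_one h] at this
    have := hk r (mem_of_mem_egFirst h this)
    omega
  · intro hk x hx
    obtain ⟨r, hr, hrx⟩ := exists_le_of_mem hx
    have hm := Finset.min'_mem (bottomRow ρ) ⟨r, hr⟩
    have hmin : ∀ s ∈ bottomRow ρ, (bottomRow ρ).min' ⟨r, hr⟩ ≤ s := fun s hs =>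
      Finset.min'_le _ s hs
    have h1 : (bottomRow ρ).min' ⟨r, hr⟩ ∈ egCol 1 ρ := by
      rw [egCol_one h, mem_egFirst_succ h]
      exact Or.inl ⟨hm, hmin⟩
    rw [← le_egComp_iff h le_rfl] at h1
    refine le_trans ?_ ((hmin r hr).trans hrx)
    by_contra hlt
    have := hk _ (not_le.1 hlt)
    omega

/-- The boxes of `α` outside `β` lie in distinct columns, and no row of `β` below a row with a box
in the (0-based) column `c` ends in column `c`. -/
structure KeyStrip (β α : ℕ → ℕ) : Prop where
  le : ∀ r, β r ≤ α r
  col : ∀ r r' c, β r ≤ c → c < α r → β r' ≤ c → c < α r' → r = r'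
  row : ∀ r r' c, r < r' → β r' ≤ c → c < α r' → β r ≠ c + 1

theorem KeyStrip.mono {β γ α : ℕ → ℕ} (h : KeyStrip β α) (h1 : ∀ r, β r ≤ γ r)
    (h2 : ∀ r, γ r ≤ α r) : KeyStrip β γ where
  le := h1
  col r r' c a b a' b' := h.col r r' c a (b.trans_le (h2 r)) a' (b'.trans_le (h2 r'))
  row r r' c hr a b := h.row r r' c hr a (b.trans_le (h2 r'))

theorem KeyStrip.refl (α : ℕ → ℕ) : KeyStrip α α where
  le _ := le_rfl
  col r r' c a b := by omega
  row r r' c hr a b := by omega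

theorem egComp_le_append {u b : List ℕ} (h : IsReducedWord (u ++ b)) (r : ℕ) :
    egComp u r ≤ egComp (u ++ b) r := by
  induction b using List.reverseRecOn with
  | nil => rw [List.append_nil]
  | append_singleton b x ih =>
    rw [← List.append_assoc] at h ⊢
    obtain ⟨s, -, h2, -⟩ := egComp_concat h
    rw [h2]
    exact (ih h.left).trans (Nat.le_add_right _ _)

theorem keyStrip_concat {u b : List ℕ} {x : ℕ} (h : IsReducedWord (u ++ b ++ [x]))
    (hb : (b ++ [x]).Pairwise (· < ·)) :
    KeyStrip (egComp u) (egComp (u ++ b ++ [x])) ∧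
      ∀ r c, egComp u r ≤ c → c < egComp (u ++ b ++ [x]) r → c ≤ boxCol (u ++ b) x := by
  induction b using List.reverseRecOn generalizing x with
  | nil =>
    rw [List.append_nil] at h ⊢
    obtain ⟨s, h1, h2, h3⟩ := egComp_concat h
    refine ⟨⟨fun r => by rw [h2]; omega, fun r r' c a b a' b' => ?_, fun r r' c hr a b => ?_⟩,
      fun r c a b => ?_⟩
    · rw [h2] at b b'
      split_ifs at b b' <;> omega
    · rw [h2] at b
      split_ifs at b with hs
      · subst hs
        have := h3 r hr
        omega
      · omega
    · rw [h2] at b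
      split_ifs at b with hs
      · subst hs; omega
      · omega
  | append_singleton b y ih =>
    rw [← List.append_assoc] at h ⊢
    have hyx : y < x := by
      rw [List.append_assoc, List.pairwise_append] at hb
      have := hb.2.1
      simpa using this
    have hc := (lt_iff_boxCol h).1 hyx
    obtain ⟨ih1, ih2⟩ := ih h.left (hb.sublist (List.sublist_append_left _ _))
    obtain ⟨s, h1, h2, h3⟩ := egComp_concat h
    have hle := egComp_le_append (u := u) (b := b ++ [y]) (by
      rw [← List.append_assoc]; exact h.left)
    rw [← List.append_assoc] at hle
    have hcase : ∀ r c, egComp u r ≤ c → c < egComp (u ++ b ++ [y] ++ [x]) r →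
        (r = s ∧ c = boxCol (u ++ b ++ [y]) x) ∨
        (c < egComp (u ++ b ++ [y]) r ∧ c < boxCol (u ++ b ++ [y]) x) := fun r c ha hb' => by
      rw [h2] at hb'
      by_cases hlt : c < egComp (u ++ b ++ [y]) r
      · exact Or.inr ⟨hlt, (ih2 r c ha hlt).trans_lt hc⟩
      · split_ifs at hb' with hs
        · subst hs; exact Or.inl ⟨rfl, by omega⟩
        · omega
    refine ⟨⟨fun r => ?_, fun r r' c a b a' b' => ?_, fun r r' c hr a b he => ?_⟩,
      fun r c a b => ?_⟩
    · rw [h2]; exact (hle r).trans (Nat.le_add_right _ _)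
    · rcases hcase r c a b with ⟨e1, e2⟩ | ⟨e1, e2⟩ <;>
        rcases hcase r' c a' b' with ⟨e3, e4⟩ | ⟨e3, e4⟩
      · rw [e1, e3]
      · omega
      · omega
      · exact ih1.col r r' c a e1 a' e3
    · rcases hcase r' c a b with ⟨e1, e2⟩ | ⟨e1, e2⟩
      · subst e1
        have h4 := h3 r hr
        have h5 := hle r
        have h6 := ih2 r (c + 1) he.le (by omega)
        omega
      · exact ih1.row r r' c hr a e1 he
    · rcases hcase r c a b with ⟨e1, e2⟩ | ⟨e1, e2⟩ <;> omega

theorem keyStrip_append {u b : List ℕ} (h : IsReducedWord (u ++ b)) (hb : b.Pairwise (· < ·)) :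
    KeyStrip (egComp u) (egComp (u ++ b)) := by
  rcases List.eq_nil_or_concat' b with rfl | ⟨b, x, rfl⟩
  · rw [List.append_nil]
    exact KeyStrip.refl _
  · rw [← List.append_assoc] at h ⊢
    exact (keyStrip_concat h hb).1

theorem length_eq_of_egComp {ρ σ : List ℕ} (h : IsReducedWord ρ) (h' : IsReducedWord σ)
    (he : egComp ρ = egComp σ) : ρ.length = σ.length := by
  have h1 := sum_egShape h (le_max_left ρ.length σ.length)
  rw [egShape_eq_of_egComp h h' he, sum_egShape h' (le_max_right _ _)] at h1
  exact h1.symm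

theorem egComp_support_finite (ρ : List ℕ) : {r | egComp ρ r ≠ 0}.Finite := by
  refine ((Finset.range (ρ.length + 1)).biUnion fun j => egCol j ρ).finite_toSet.subset
    fun r hr => ?_
  simp only [Finset.coe_biUnion, Set.mem_iUnion, Finset.mem_coe, Finset.mem_range]
  exact ⟨egComp ρ r, Nat.lt_succ_of_le (Nat.findGreatest_le _),
    Nat.findGreatest_of_ne_zero (P := fun j => r ∈ egCol j ρ) rfl hr⟩

/-- A key strip is peeled off by a strictly increasing block. -/
theorem exists_append_of_keyStrip {ρ : List ℕ} (h : IsReducedWord ρ) {β : ℕ → ℕ}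
    (hs : KeyStrip β (egComp ρ)) :
    ∃ u b, CKEquiv (u ++ b) ρ ∧ b.Pairwise (· < ·) ∧ egComp u = β := by
  induction hn : ρ.length generalizing ρ with
  | zero =>
    rw [List.length_eq_zero_iff] at hn
    subst hn
    exact ⟨[], [], CKEquiv.refl _, List.Pairwise.nil, funext fun r => by
      have := hs.le r
      rw [egComp_nil] at this ⊢
      omega⟩
  | succ n ih =>
    by_cases hne : ∃ r, β r < egComp ρ r
    · obtain ⟨r, hr, hmax⟩ : ∃ r, β r < egComp ρ r ∧
          ∀ s, β s < egComp ρ s → egComp ρ s ≤ egComp ρ r := by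
        obtain ⟨r, hr, hmax⟩ := Set.exists_max_image {r | β r < egComp ρ r} (egComp ρ)
          ((egComp_support_finite ρ).subset fun r (hr : β r < egComp ρ r) => by
            show egComp ρ r ≠ 0
            omega) hne
        exact ⟨r, hr, hmax⟩
      obtain ⟨σ, x, e, hc, hA⟩ := exists_concat_of_egComp h (r := r) (by omega) fun s hsr he => by
        have h1 := hs.row s r (egComp ρ r - 1) hsr (by omega) (by omega)
        have h2 := hs.le s
        exact hsr.ne (hs.col s r (egComp ρ r - 1) (by omega) (by omega) (by omega) (by omega))
      have hr' := e.symm.isReducedWord h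
      have hle : ∀ s, β s ≤ egComp σ s := fun s => by
        have h1 := hs.le s
        have h2 := hA s
        split_ifs at h2 with hsr
        · subst hsr; omega
        · omega
      obtain ⟨u, b, e', hb, hu⟩ := ih hr'.left
        (hs.mono hle fun s => by rw [hA]; exact Nat.le_add_right _ _)
        (by have := e.length_eq; simp at this; omega)
      have e2 := (e'.append_right [x]).trans e
      have hr2 := e2.symm.isReducedWord h
      refine ⟨u, b ++ [x], by rw [← List.append_assoc]; exact e2, ?_, hu⟩
      rcases List.eq_nil_or_concat' b with rfl | ⟨b, y, rfl⟩
      · simp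
      · refine hb.concat_concat ?_
        rw [← List.append_assoc] at hr2 e'
        rw [lt_iff_boxCol hr2, e'.boxCol_eq hr2]
        obtain ⟨r₁, h1, h2, -⟩ := egComp_concat hr2.left
        have h3 := egComp_le_append hr2.left.left r₁
        have h4 := h2 r₁
        rw [if_pos rfl, e'.egComp_eq hr2.left] at h4
        have h5 := hA r₁
        have h6 := hA r
        rw [if_pos rfl] at h6
        rw [hu] at h3
        have h7 := hmax r₁ (by omega)
        by_contra hlt
        have h8 : egComp σ r = boxCol (u ++ b) y := by split_ifs at h5 <;> omega
        have := hs.col r r₁ (boxCol (u ++ b) y) (by omega) (by omega) (by omega) (by omega)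
        subst this
        omega
    · push Not at hne
      exact ⟨ρ, [], by rw [List.append_nil]; exact CKEquiv.refl _, List.Pairwise.nil,
        funext fun r => le_antisymm (hne r) (hs.le r)⟩

theorem append_unique {u u' b b' : List ℕ} (h : IsReducedWord (u ++ b))
    (e : CKEquiv (u ++ b) (u' ++ b')) (hb : b.Pairwise (· < ·)) (hb' : b'.Pairwise (· < ·))
    (hA : egComp u = egComp u') : b = b' ∧ CKEquiv u u' := by
  have h' := e.isReducedWord h
  have hl : b.length = b'.length := by
    have h1 := e.length_eq
    have h2 := length_eq_of_egComp h.left h'.left hA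
    rw [List.length_append, List.length_append] at h1
    omega
  induction b using List.reverseRecOn generalizing b' with
  | nil =>
    obtain rfl := List.length_eq_zero_iff.1 hl.symm
    rw [List.append_nil, List.append_nil] at e
    exact ⟨rfl, e⟩
  | append_singleton b x ih =>
    rcases List.eq_nil_or_concat' b' with rfl | ⟨b', x', rfl⟩
    · simp at hl
    rw [← List.append_assoc] at h e
    rw [← List.append_assoc] at h' e
    obtain ⟨s1, m1⟩ := keyStrip_concat h hb
    obtain ⟨s2, m2⟩ := keyStrip_concat h' hb'
    obtain ⟨r, h1, h2, -⟩ := egComp_concat h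
    obtain ⟨r', h1', h2', -⟩ := egComp_concat h'
    have hE := e.egComp_eq h
    have l1 := egComp_le_append h.left r
    have l2 := egComp_le_append h'.left r'
    have a1 := h2 r
    have a2 := h2' r'
    rw [if_pos rfl] at a1 a2
    have c1 := m2 r (boxCol (u ++ b) x) (by rw [← hA]; omega) (by rw [← hE]; omega)
    have c2 := m1 r' (boxCol (u' ++ b') x') (by rw [hA]; omega) (by rw [hE]; omega)
    have hrr : r = r' := s1.col r r' (boxCol (u ++ b) x) (by omega) (by omega)
      (by rw [hA]; omega) (by rw [hE]; omega)
    subst hrr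
    have hA' : egComp (u ++ b) = egComp (u' ++ b') := funext fun s => by
      have b1 := h2 s
      have b2 := h2' s
      rw [hE] at b1
      omega
    obtain ⟨rfl, e'⟩ := ckEquiv_of_egComp h e hA'
    obtain ⟨rfl, e''⟩ := ih h.left e' (hb.sublist (List.sublist_append_left _ _))
      (hb'.sublist (List.sublist_append_left _ _)) h'.left (by simpa using hl)
    exact ⟨rfl, e''⟩

theorem eq_nil_of_topIdx_lt {f : ℕ → List ℕ} (hf : {i | f i ≠ []}.Finite) {i : ℕ}
    (hi : topIdx f < i) : f i = [] := by
  by_contra hne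
  exact hi.not_ge (le_csSup hf.bddAbove hne)

theorem range_filter_le {t i : ℕ} (hi : i ≤ t) :
    ((List.range (t + 1)).filter fun j => decide (i ≤ j)) =
      i :: (List.range (t + 1)).filter fun j => decide (i + 1 ≤ j) := by
  induction t, hi using Nat.le_induction with
  | base =>
    have hnil : ∀ k, i ≤ k → ((List.range i).filter fun j => decide (k ≤ j)) = [] := fun k hk =>
      List.filter_eq_nil_iff.2 fun a ha => by
        have := List.mem_range.1 ha
        simp only [decide_eq_true_eq]
        omega
    rw [List.range_succ, List.filter_append, List.filter_append, hnil i le_rfl,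
      hnil (i + 1) (Nat.le_succ i)]
    simp
  | succ t hi ih =>
    rw [List.range_succ, List.filter_append, List.filter_append, ih]
    simp [hi, hi.trans (Nat.le_succ t)]

theorem factWordGe_eq_nil {f : ℕ → List ℕ} {i : ℕ} (hi : topIdx f < i) :
    factWordGe f i = [] := by
  rw [factWordGe, List.filter_eq_nil_iff.2 fun a ha => by simp at ha ⊢; omega]
  rfl

theorem factWordGe_succ {f : ℕ → List ℕ} (hf : {i | f i ≠ []}.Finite) (i : ℕ) :
    factWordGe f i = factWordGe f (i + 1) ++ f i := by
  rcases Nat.lt_or_ge (topIdx f) i with hi | hi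
  · rw [factWordGe_eq_nil hi, factWordGe_eq_nil (by omega), eq_nil_of_topIdx_lt hf hi]
    rfl
  · have key : ∀ l : List (List ℕ), l.foldr (· ++ ·) [] = l.flatten := fun l => by
      induction l with
      | nil => rfl
      | cons a l ih => rw [List.foldr_cons, ih, List.flatten_cons]
    rw [factWordGe, factWordGe, List.filter_reverse, List.filter_reverse, key, key,
      range_filter_le hi]
    simp

theorem factWordGe_unique {f : ℕ → List ℕ} (hf : {i | f i ≠ []}.Finite) {W : ℕ → List ℕ}
    (hW : ∀ i, W i = W (i + 1) ++ f i) {N : ℕ} (hN : ∀ i, N ≤ i → W i = []) (i : ℕ) :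
    factWordGe f i = W i := by
  have key : ∀ n i, max N (topIdx f + 1) ≤ i + n → factWordGe f i = W i := fun n => by
    induction n with
    | zero => exact fun i hi => by rw [factWordGe_eq_nil (by omega), hN i (by omega)]
    | succ n ih => exact fun i hi => by rw [factWordGe_succ hf, hW, ih (i + 1) (by omega)]
  exact key _ i (Nat.le_add_left _ _)

theorem mem_factWordGe {f : ℕ → List ℕ} (hf : {i | f i ≠ []}.Finite) {i x : ℕ}
    (hx : x ∈ factWordGe f i) : ∃ j, i ≤ j ∧ x ∈ f j := by
  by_contra! hne
  have key : ∀ n i, topIdx f + 1 ≤ i + n → x ∈ factWordGe f i → ∃ j, i ≤ j ∧ x ∈ f j := fun n => by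
    induction n with
    | zero => exact fun i hi hx => by rw [factWordGe_eq_nil (by omega)] at hx; simp at hx
    | succ n ih =>
      intro i hi hx
      rw [factWordGe_succ hf, List.mem_append] at hx
      rcases hx with hx | hx
      · obtain ⟨j, h1, h2⟩ := ih (i + 1) (by omega) hx
        exact ⟨j, by omega, h2⟩
      · exact ⟨i, le_rfl, hx⟩
  obtain ⟨j, h1, h2⟩ := key (topIdx f + 1) i (Nat.le_add_left _ _) hx
  exact hne j h1 h2

theorem IsReducedWord.factWordGe {f : ℕ → List ℕ} (hf : {i | f i ≠ []}.Finite)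
    (h : IsReducedWord (factWord f)) (i : ℕ) : IsReducedWord (factWordGe f i) := by
  induction i with
  | zero => exact h
  | succ i ih =>
    rw [factWordGe_succ hf] at ih
    exact ih.left

/-- An increasing factorization is determined by the Coxeter–Knuth class of its word and the
weak compositions of its partial words. -/
theorem factorization_unique {f f' : ℕ → List ℕ} (hf : {i | f i ≠ []}.Finite)
    (hf' : {i | f' i ≠ []}.Finite) (hi : ∀ i, (f i).Pairwise (· < ·))
    (hi' : ∀ i, (f' i).Pairwise (· < ·)) (h : IsReducedWord (factWord f))
    (e : CKEquiv (factWord f) (factWord f'))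
    (hA : ∀ i, egComp (factWordGe f i) = egComp (factWordGe f' i)) : f = f' := by
  have key : ∀ i, CKEquiv (factWordGe f i) (factWordGe f' i) ∧
      (CKEquiv (factWordGe f i) (factWordGe f' i) →
        f i = f' i ∧ CKEquiv (factWordGe f (i + 1)) (factWordGe f' (i + 1))) := fun i => by
    have hs : CKEquiv (factWordGe f i) (factWordGe f' i) →
        f i = f' i ∧ CKEquiv (factWordGe f (i + 1)) (factWordGe f' (i + 1)) := fun e => by
      have hr := h.factWordGe hf i
      rw [factWordGe_succ hf] at hr
      rw [factWordGe_succ hf, factWordGe_succ hf'] at e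
      exact append_unique hr e (hi i) (hi' i) (hA (i + 1))
    refine ⟨?_, hs⟩
    clear hs
    induction i with
    | zero => exact e
    | succ i ih =>
      have hr := h.factWordGe hf i
      rw [factWordGe_succ hf] at hr
      rw [factWordGe_succ hf, factWordGe_succ hf'] at ih
      exact (append_unique hr ih (hi i) (hi' i) (hA (i + 1))).2
  exact funext fun i => ((key i).2 (key i).1).1

theorem eq_nil_of_egComp {ρ : List ℕ} (h : IsReducedWord ρ) (hA : ∀ r, egComp ρ r = 0) :
    ρ = [] :=
  List.length_eq_zero_iff.1 (length_eq_of_egComp h (σ := [])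
    (show IsReducedWord ([] : List ℕ) from (show IsReducedWord ([] ++ ρ) from h).left)
    (funext fun r => by rw [hA, egComp_nil]))

theorem exists_factorization {ρ : List ℕ} (h : IsReducedWord ρ) {α : ℕ → ℕ → ℕ} {N : ℕ}
    (h0 : α 0 = egComp ρ) (hα : ∀ i, KeyStrip (α (i + 1)) (α i)) (hN : ∀ i r, N ≤ i → α i r = 0) :
    ∃ f : ℕ → List ℕ, {i | f i ≠ []}.Finite ∧ (∀ i, (f i).Pairwise (· < ·)) ∧
      CKEquiv (factWord f) ρ ∧ ∀ i, egComp (factWordGe f i) = α i := by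
  induction N generalizing α ρ with
  | zero =>
    have hw := factWordGe_unique (f := fun _ => []) (by simp) (W := fun _ => []) (fun _ => rfl)
      (N := 0) fun _ _ => rfl
    refine ⟨fun _ => [], by simp, fun _ => List.Pairwise.nil, ?_, fun i => funext fun r => ?_⟩
    · rw [factWord, hw, eq_nil_of_egComp h fun r => by rw [← h0, hN 0 r le_rfl]]
      exact CKEquiv.refl _
    · rw [hw, egComp_nil, hN i r (Nat.zero_le i)]
  | succ N ih =>
    obtain ⟨u, b, e, hb, hu⟩ := exists_append_of_keyStrip h (h0 ▸ hα 0)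
    have hr := e.symm.isReducedWord h
    obtain ⟨f, hf, hi, e', hA⟩ := ih hr.left (α := fun i => α (i + 1)) hu.symm
      (fun i => hα (i + 1)) fun i r hi => hN (i + 1) r (by omega)
    let g : ℕ → List ℕ := fun i => Nat.casesOn i b f
    have hg : {i | g i ≠ []}.Finite := by
      refine ((hf.image Nat.succ).insert 0).subset fun i hi => ?_
      rcases i with _ | i
      · exact Set.mem_insert _ _
      · exact Set.mem_insert_of_mem _ ⟨i, hi, rfl⟩
    have hs : ∀ i, factWordGe f i = factWordGe g (i + 1) :=
      factWordGe_unique hf (fun i => factWordGe_succ hg (i + 1)) (N := topIdx g) fun i hi =>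
        factWordGe_eq_nil (by omega)
    have h1 : CKEquiv (factWord g) ρ := by
      rw [factWord, factWordGe_succ hg, ← hs]
      exact (e'.append_right b).trans e
    refine ⟨g, hg, fun i => ?_, h1, fun i => ?_⟩
    · rcases i with _ | i
      · exact hb
      · exact hi i
    · rcases i with _ | i
      · rw [h0]
        exact h1.egComp_eq (h1.symm.isReducedWord h)
      · rw [← hs, hA]

theorem runFact_flatten (ρ : List ℕ) : (runFact ρ).flatten = ρ := by
  induction ρ with
  | nil => rfl
  | cons a ρ ih =>
    rw [runFact]
    cases hr : runFact ρ with
    | nil =>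
      rw [hr] at ih
      rw [← ih]
      rfl
    | cons r rs =>
      rw [hr] at ih
      dsimp only
      split_ifs <;> rw [← ih] <;> simp

theorem runFact_pairwise (ρ : List ℕ) : ∀ b ∈ runFact ρ, b ≠ [] ∧ b.Pairwise (· < ·) := by
  induction ρ with
  | nil => simp [runFact]
  | cons a ρ ih =>
    rw [runFact]
    cases hr : runFact ρ with
    | nil => simp
    | cons r rs =>
      rw [hr] at ih
      dsimp only
      have h1 := ih r List.mem_cons_self
      have h2 := fun b hb => ih b (List.mem_cons_of_mem _ hb)
      split_ifs with ha
      · intro b hb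
        rcases List.mem_cons.1 hb with rfl | hb
        · refine ⟨List.cons_ne_nil _ _, List.pairwise_cons.2 ⟨fun x hx => ?_, h1.2⟩⟩
          obtain ⟨-, h1⟩ := h1
          cases r with
          | nil => simp at hx
          | cons y r =>
            rcases List.mem_cons.1 hx with rfl | hx
            · exact ha
            · exact lt_trans ha (List.rel_of_pairwise_cons h1 hx)
        · exact h2 b hb
      · intro b hb
        rcases List.mem_cons.1 hb with rfl | hb
        · simp
        · exact ih b hb

theorem headI_le_of_mem {b : List ℕ} (hb : b.Pairwise (· < ·)) {x : ℕ} (hx : x ∈ b) :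
    b.headI ≤ x := by
  cases b with
  | nil => simp at hx
  | cons y b =>
    rcases List.mem_cons.1 hx with rfl | hx
    · exact le_rfl
    · exact (List.rel_of_pairwise_cons hb hx).le

theorem runFact_append {b ρ : List ℕ} (hne : b ≠ []) (hb : b.Pairwise (· < ·))
    (hr : ∀ r ∈ (runFact ρ).head?, ∀ x ∈ b, r.headI ≤ x) :
    runFact (b ++ ρ) = b :: runFact ρ := by
  induction b with
  | nil => exact absurd rfl hne
  | cons a b ih =>
    cases b with
    | nil =>
      rw [List.singleton_append, runFact]
      cases hρ : runFact ρ with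
      | nil => rfl
      | cons r rs =>
        rw [hρ] at hr
        have := hr r rfl a List.mem_cons_self
        dsimp only
        rw [if_neg (not_lt.2 this)]
    | cons c b =>
      have ih' := ih (List.cons_ne_nil _ _) hb.of_cons
        fun r hr' x hx => hr r hr' x (List.mem_cons_of_mem _ hx)
      rw [List.cons_append, runFact, ih']
      exact if_pos (List.rel_of_pairwise_cons hb List.mem_cons_self)

theorem runFact_eq {l : List (List ℕ)} (hl : ∀ b ∈ l, b ≠ [] ∧ b.Pairwise (· < ·))
    (hd : l.Pairwise fun b b' => b'.headI < b.headI) : runFact l.flatten = l := by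
  induction l with
  | nil => rfl
  | cons b l ih =>
    have hb := hl b List.mem_cons_self
    have ih' := ih (fun c hc => hl c (List.mem_cons_of_mem _ hc)) hd.of_cons
    rw [List.flatten_cons, runFact_append hb.1 hb.2, ih']
    rw [ih']
    intro r hr x hx
    exact (List.rel_of_pairwise_cons hd (List.mem_of_mem_head? hr)).le.trans
      (headI_le_of_mem hb.2 hx)

theorem length_wdtRowsAux (p : ℤ) (l : List (List ℕ)) : (wdtRowsAux p l).length = l.length := by
  induction l generalizing p with
  | nil => rfl
  | cons b l ih => rw [wdtRowsAux, List.length_cons, ih, List.length_cons]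

theorem length_wdtRows (l : List (List ℕ)) : (wdtRows l).length = l.length := by
  cases l with
  | nil => rfl
  | cons b l => rw [wdtRows, List.length_cons, length_wdtRowsAux, List.length_cons]

theorem wdtRowsAux_lt {p : ℤ} {l : List (List ℕ)} : ∀ r ∈ wdtRowsAux p l, r < p := by
  induction l generalizing p with
  | nil => simp [wdtRowsAux]
  | cons b l ih =>
    intro r hr
    rw [wdtRowsAux, List.mem_cons] at hr
    rcases hr with rfl | hr
    · omega
    · have := ih r hr
      omega

theorem wdtRowsAux_pairwise (p : ℤ) (l : List (List ℕ)) :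
    (wdtRowsAux p l).Pairwise (· > ·) := by
  induction l generalizing p with
  | nil => exact List.Pairwise.nil
  | cons b l ih => exact List.pairwise_cons.2 ⟨wdtRowsAux_lt, ih _⟩

theorem wdtRows_pairwise (l : List (List ℕ)) : (wdtRows l).Pairwise (· > ·) := by
  cases l with
  | nil => exact List.Pairwise.nil
  | cons b l => exact List.pairwise_cons.2 ⟨wdtRowsAux_lt, wdtRowsAux_pairwise _ _⟩

theorem wdtRowsAux_le_headI (p : ℤ) (l : List (List ℕ)) :
    ∀ q ∈ (wdtRowsAux p l).zip l, q.1 ≤ (q.2.headI : ℤ) := by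
  induction l generalizing p with
  | nil => simp [wdtRowsAux]
  | cons b l ih =>
    intro q hq
    rw [wdtRowsAux, List.zip_cons_cons, List.mem_cons] at hq
    rcases hq with rfl | hq
    · exact min_le_right _ _
    · exact ih _ q hq

theorem wdtRows_le_headI (l : List (List ℕ)) :
    ∀ q ∈ (wdtRows l).zip l, q.1 ≤ (q.2.headI : ℤ) := by
  cases l with
  | nil => simp [wdtRows]
  | cons b l =>
    intro q hq
    rw [wdtRows, List.zip_cons_cons, List.mem_cons] at hq
    rcases hq with rfl | hq
    · exact le_rfl
    · exact wdtRowsAux_le_headI _ _ q hq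

theorem wdtRowsAux_eq {p : ℕ} {l : List (List ℕ)} (hp : ∀ b ∈ l, b.headI < p)
    (hd : l.Pairwise fun b b' => b'.headI < b.headI) :
    wdtRowsAux p l = l.map fun b => (b.headI : ℤ) := by
  induction l generalizing p with
  | nil => rfl
  | cons b l ih =>
    have := hp b List.mem_cons_self
    rw [wdtRowsAux, show min ((p : ℤ) - 1) (b.headI : ℤ) = (b.headI : ℤ) by omega,
      ih (fun c hc => List.rel_of_pairwise_cons hd hc) hd.of_cons, List.map_cons]

theorem wdtRows_eq {l : List (List ℕ)} (hd : l.Pairwise fun b b' => b'.headI < b.headI) :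
    wdtRows l = l.map fun b => (b.headI : ℤ) := by
  cases l with
  | nil => rfl
  | cons b l =>
    rw [wdtRows, wdtRowsAux_eq (fun c hc => List.rel_of_pairwise_cons hd hc) hd.of_cons,
      List.map_cons]

/-- The block in row `r` of a list of blocks labelled by rows. -/
def rowBlock (L : List (ℤ × List ℕ)) (r : ℤ) : List ℕ :=
  match L.find? (fun p => decide (p.1 = r)) with
  | some p => p.2
  | none => []

theorem rowBlock_cons (p : ℤ × List ℕ) (L : List (ℤ × List ℕ)) (r : ℤ) :
    rowBlock (p :: L) r = if p.1 = r then p.2 else rowBlock L r := by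
  by_cases h : p.1 = r <;> simp [rowBlock, h]

theorem mem_of_rowBlock_ne_nil {L : List (ℤ × List ℕ)} {r : ℤ} (h : rowBlock L r ≠ []) :
    (r, rowBlock L r) ∈ L := by
  induction L with
  | nil => exact absurd rfl h
  | cons p L ih =>
    rw [rowBlock_cons] at h ⊢
    split_ifs at h ⊢ with hp
    · rw [← hp]
      exact List.mem_cons_self
    · exact List.mem_cons_of_mem _ (ih h)

theorem weakDesTab_eq (ρ : List ℕ) (r : ℤ) (c : ℕ) :
    weakDesTab ρ r c =
      if c = 0 then 0 else (rowBlock ((wdtRows (runFact ρ)).zip (runFact ρ)) r).getD (c - 1) 0 := by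
  rw [weakDesTab, rowBlock]
  congr 1
  cases List.find? _ _ <;> rfl

theorem filter_rowBlock {L : List (ℤ × List ℕ)} (hL : L.Pairwise fun p q => p.1 > q.1) (i : ℤ) :
    ((L.filter fun p => decide (i ≤ p.1)).map Prod.snd).flatten =
      ((L.filter fun p => decide (i + 1 ≤ p.1)).map Prod.snd).flatten ++ rowBlock L i := by
  induction L with
  | nil => rfl
  | cons p L ih =>
    have ih' := ih hL.of_cons
    rw [rowBlock_cons, List.filter_cons, List.filter_cons]
    rcases lt_trichotomy p.1 i with h | h | h
    · rw [if_neg (by simpa using h), if_neg (by simp; omega), if_neg h.ne, ih']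
    · have hnil : ∀ j, i ≤ j → (L.filter fun p => decide (j ≤ p.1)) = [] := fun j hj =>
        List.filter_eq_nil_iff.2 fun q hq => by
          have := List.rel_of_pairwise_cons hL hq
          simp only [decide_eq_true_eq]
          omega
      rw [if_pos (by simpa using h.ge), if_neg (by simp; omega), if_pos h, hnil i le_rfl,
        hnil _ (by omega)]
      simp
    · rw [if_pos (by simpa using h.le), if_pos (by simp; omega), if_neg h.ne']
      simp only [List.map_cons, List.flatten_cons, ih', List.append_assoc]

theorem mem_of_egComp_ne_zero {ρ : List ℕ} (h : IsReducedWord ρ) {r : ℕ} (hr : egComp ρ r ≠ 0) :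
    r ∈ ρ := by
  have := (le_egComp_iff h le_rfl).1 (Nat.one_le_iff_ne_zero.2 hr)
  rw [egCol_one h] at this
  exact mem_of_mem_egFirst h this

theorem egComp_zero {ρ : List ℕ} (h : IsReducedWord ρ) : egComp ρ 0 = 0 := by
  by_contra hne
  have := h.1 0 (mem_of_egComp_ne_zero h hne)
  omega

theorem sum_egComp {ρ : List ℕ} (h : IsReducedWord ρ) {N : ℕ} (hN : ∀ x ∈ ρ, x < N) :
    ∑ r ∈ Finset.range N, egComp ρ r = ρ.length := by
  induction ρ using List.reverseRecOn with
  | nil => simp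
  | append_singleton ρ x ih =>
    obtain ⟨s, -, h2, -⟩ := egComp_concat h
    have hs : s < N := hN s (mem_of_egComp_ne_zero h (by rw [h2, if_pos rfl]; omega))
    rw [Finset.sum_congr rfl fun r _ => h2 r, Finset.sum_add_distrib,
      ih h.left fun y hy => hN y (List.mem_append_left _ hy), Finset.sum_ite_eq' _ s,
      if_pos (Finset.mem_range.2 hs), List.length_append, List.length_singleton]

theorem NonVirtual.weakDesTab_eq_zero {σ : List ℕ} (hv : NonVirtual σ) {r : ℤ} (hr : r ≤ 0)
    (c : ℕ) : weakDesTab σ r c = 0 := by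
  rw [weakDesTab_eq]
  by_cases hne : rowBlock ((wdtRows (runFact σ)).zip (runFact σ)) r = []
  · simp [hne]
  · have := hv r (List.of_mem_zip (mem_of_rowBlock_ne_nil hne)).1
    omega

theorem NonVirtual.exists_factorization {σ : List ℕ} (hv : NonVirtual σ) :
    ∃ g : ℕ → List ℕ, {i | g i ≠ []}.Finite ∧ (∀ i, (g i).Pairwise (· < ·)) ∧ g 0 = [] ∧
      (∀ i, ∀ x ∈ g i, i ≤ x) ∧ factWord g = σ ∧
      ∀ (r c : ℕ), weakDesTab σ r c = if c = 0 then 0 else (g r).getD (c - 1) 0 := by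
  set L := (wdtRows (runFact σ)).zip (runFact σ) with hL
  have hlen := length_wdtRows (runFact σ)
  have hfst : L.map Prod.fst = wdtRows (runFact σ) := List.map_fst_zip hlen.le
  have hsnd : L.map Prod.snd = runFact σ := List.map_snd_zip hlen.ge
  have hpw : L.Pairwise fun p q => p.1 > q.1 := by
    have := wdtRows_pairwise (runFact σ)
    rw [← hfst, List.pairwise_map] at this
    exact this
  have hmem : ∀ p ∈ L, 1 ≤ p.1 ∧ p.2.Pairwise (· < ·) ∧ p.1 ≤ (p.2.headI : ℤ) := fun p hp => by
    refine ⟨hv _ ?_, (runFact_pairwise σ _ ?_).2, wdtRows_le_headI _ p hp⟩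
    · rw [← hfst]; exact List.mem_map_of_mem hp
    · rw [← hsnd]; exact List.mem_map_of_mem hp
  let g : ℕ → List ℕ := fun r => rowBlock L r
  have hg : ∀ r : ℕ, g r ≠ [] → ((r : ℤ), g r) ∈ L := fun r hr => mem_of_rowBlock_ne_nil hr
  have hfin : {i | g i ≠ []}.Finite := by
    refine Set.Finite.of_finite_image (f := fun i : ℕ => ((i : ℤ), g i))
      (L.toFinset.finite_toSet.subset ?_) fun a _ b _ hab => by simpa using congrArg Prod.fst hab
    rintro _ ⟨i, hi, rfl⟩
    simpa using hg i hi
  refine ⟨g, hfin, fun i => ?_, ?_, fun i x hx => ?_, ?_, fun r c => weakDesTab_eq σ r c⟩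
  · by_cases h : g i = []
    · rw [h]; exact List.Pairwise.nil
    · exact (hmem _ (hg i h)).2.1
  · by_contra h
    have := (hmem _ (hg 0 h)).1
    simp at this
  · have h := hmem _ (hg i (List.ne_nil_of_mem hx))
    have := headI_le_of_mem h.2.1 hx
    have h3 : (i : ℤ) ≤ ((g i).headI : ℤ) := h.2.2
    omega
  · obtain ⟨N, hN⟩ : ∃ N : ℕ, ∀ p ∈ L, p.1 < N := by
      obtain ⟨M, hM⟩ := (L.map Prod.fst).toFinset.finite_toSet.bddAbove
      refine ⟨(M + 1).toNat, fun p hp => ?_⟩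
      have : p.1 ≤ M := hM (by simpa using ⟨p.2, hp⟩)
      omega
    have := factWordGe_unique hfin
      (W := fun i => ((L.filter fun p => decide ((i : ℤ) ≤ p.1)).map Prod.snd).flatten)
      (fun i => by
        have := filter_rowBlock hpw i
        push_cast
        exact this) (N := N) (fun i hi => by
        rw [List.filter_eq_nil_iff.2 fun p hp => by
          have := hN p hp
          simp only [decide_eq_true_eq]
          omega]
        rfl) 0
    rw [factWord, this, List.filter_eq_self.2 fun p hp => by
      have := (hmem p hp).1
      simp only [decide_eq_true_eq]
      omega, hsnd, runFact_flatten]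

theorem setOf_getD_ne_zero {b : List ℕ} (hb : ∀ x ∈ b, x ≠ 0) (c : ℕ) :
    (if c = 0 then 0 else b.getD (c - 1) 0) ≠ 0 ↔ 1 ≤ c ∧ c ≤ b.length := by
  split_ifs with hc
  · simp [hc]
  · rcases Nat.lt_or_ge (c - 1) b.length with hlt | hge
    · rw [List.getD_eq_getElem _ _ hlt]
      exact iff_of_true (hb _ (List.getElem_mem hlt)) (by omega)
    · rw [List.getD_eq_default _ _ hge]
      exact iff_of_false (by simp) (by omega)

theorem ncard_setOf_one_le (n : ℕ) : Set.ncard {c : ℕ | 1 ≤ c ∧ c ≤ n} = n := by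
  have : {c : ℕ | 1 ≤ c ∧ c ≤ n} = (Finset.Icc 1 n : Finset ℕ) := by
    ext c
    simp
  rw [this, Set.ncard_coe_finset]
  simp

theorem desComp_eq_length {σ : List ℕ} {r : ℕ} {b : List ℕ} (hb : ∀ x ∈ b, x ≠ 0)
    (hw : ∀ c : ℕ, weakDesTab σ r c = if c = 0 then 0 else b.getD (c - 1) 0) :
    desComp σ r = b.length := by
  rw [desComp, shapeOf]
  simp_rw [hw, setOf_getD_ne_zero hb, ncard_setOf_one_le]

theorem mem_factWordGe_of_mem {f : ℕ → List ℕ} (hf : {i | f i ≠ []}.Finite) {i j x : ℕ}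
    (hij : i ≤ j) (hx : x ∈ f j) : x ∈ factWordGe f i := by
  obtain ⟨n, rfl⟩ := Nat.exists_eq_add_of_le hij
  induction n generalizing i with
  | zero => rw [factWordGe_succ hf]; exact List.mem_append_right _ hx
  | succ n ih =>
    rw [factWordGe_succ hf]
    exact List.mem_append_left _ (ih (i := i + 1) (by omega) (by rwa [Nat.add_right_comm i 1 n]))

theorem egComp_factWordGe_le {f : ℕ → List ℕ} (hf : {i | f i ≠ []}.Finite)
    (h : IsReducedWord (factWord f)) {i j : ℕ} (hij : i ≤ j) (r : ℕ) :
    egComp (factWordGe f j) r ≤ egComp (factWordGe f i) r := by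
  induction j, hij using Nat.le_induction with
  | base => exact le_rfl
  | succ j hij ih =>
    refine le_trans ?_ ih
    have := h.factWordGe hf j
    rw [factWordGe_succ hf j] at this ⊢
    exact egComp_le_append this r

theorem sum_length_add {g : ℕ → List ℕ} (hg : {i | g i ≠ []}.Finite) (h0 : g 0 = []) (k : ℕ) :
    ∑ i ∈ Finset.Icc 1 k, (g i).length + (factWordGe g (k + 1)).length = (factWord g).length := by
  induction k with
  | zero => rw [factWord, factWordGe_succ hg 0, h0]; simp
  | succ k ih =>
    rw [factWordGe_succ hg, List.length_append] at ih
    rw [Finset.sum_Icc_succ_top (by omega)]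
    omega

/-- The weak descent composition of a non-virtual word dominates `egComp`, with equality only
if the rows of its weak descent tableau cut out the rows of `egComp`. -/
theorem egComp_dominance {σ : List ℕ} (h : IsReducedWord σ) {g : ℕ → List ℕ}
    (hg : {i | g i ≠ []}.Finite) (h0 : g 0 = []) (hm : ∀ i, ∀ x ∈ g i, i ≤ x)
    (hσ : factWord g = σ) (k : ℕ) :
    ∑ i ∈ Finset.Icc 1 k, egComp σ i ≤ ∑ i ∈ Finset.Icc 1 k, (g i).length ∧
      (∑ i ∈ Finset.Icc 1 k, egComp σ i = ∑ i ∈ Finset.Icc 1 k, (g i).length →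
        ∀ r, egComp (factWordGe g (k + 1)) r = if k + 1 ≤ r then egComp σ r else 0) := by
  have hr : IsReducedWord (factWordGe g (k + 1)) := IsReducedWord.factWordGe hg (hσ ▸ h) _
  have hz : ∀ r < k + 1, egComp (factWordGe g (k + 1)) r = 0 :=
    (forall_le_iff_egComp hr (k + 1)).1 fun x hx => by
      obtain ⟨j, h1, h2⟩ := mem_factWordGe hg hx
      exact h1.trans (hm j x h2)
  have hle : ∀ r, egComp (factWordGe g (k + 1)) r ≤ egComp σ r := fun r => by
    rw [← hσ]
    exact egComp_factWordGe_le hg (hσ ▸ h) (Nat.zero_le _) r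
  obtain ⟨N, hkN, hN⟩ : ∃ N, k < N ∧ ∀ x ∈ σ, x < N := by
    obtain ⟨M, hM⟩ := σ.toFinset.finite_toSet.bddAbove
    refine ⟨max M k + 1, by omega, fun x hx => ?_⟩
    have : x ≤ M := hM (by simpa using hx)
    omega
  have hN' : ∀ x ∈ factWordGe g (k + 1), x < N := fun x hx => hN x (by
    obtain ⟨j, h1, h2⟩ := mem_factWordGe hg hx
    rw [← hσ]
    exact mem_factWordGe_of_mem hg (Nat.zero_le j) h2)
  have hsum := sum_length_add hg h0 k
  rw [hσ, ← sum_egComp h hN, ← sum_egComp hr hN'] at hsum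
  have hI : ∑ i ∈ Finset.Icc 1 k, egComp σ i =
      ∑ i ∈ Finset.range N, if 1 ≤ i ∧ i ≤ k then egComp σ i else 0 := by
    rw [← Finset.sum_filter]
    refine Finset.sum_congr (Finset.ext fun i => ?_) fun _ _ => rfl
    simp only [Finset.mem_Icc, Finset.mem_filter, Finset.mem_range]
    omega
  have hterm : ∀ i ∈ Finset.range N, (if 1 ≤ i ∧ i ≤ k then egComp σ i else 0) +
      egComp (factWordGe g (k + 1)) i ≤ egComp σ i := fun i _ => by
    split_ifs with hi
    · rw [hz i (by omega), add_zero]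
    · rw [zero_add]; exact hle i
  have hS := Finset.sum_le_sum hterm
  rw [Finset.sum_add_distrib, ← hI] at hS
  refine ⟨by omega, fun he r => ?_⟩
  have heq := (Finset.sum_eq_sum_iff_of_le hterm).1 (by
    rw [Finset.sum_add_distrib, ← hI]
    omega)
  split_ifs with hkr
  · by_cases hrN : r < N
    · have := heq r (Finset.mem_range.2 hrN)
      rw [if_neg (by omega), zero_add] at this
      exact this
    · have : egComp σ r = 0 := by
        by_contra hne
        exact hrN (hN r (mem_of_egComp_ne_zero h hne))
      have := hle r
      omega
  · exact hz r (by omega)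

theorem keyStrip_restrict (α : ℕ → ℕ) (i : ℕ) :
    KeyStrip (fun r => if i + 1 ≤ r then α r else 0) (fun r => if i ≤ r then α r else 0) where
  le r := by split_ifs <;> omega
  col r r' c a b a' b' := by split_ifs at a b a' b' <;> omega
  row r r' c hr a b he := by split_ifs at a b he <;> omega

theorem rowBlock_map {g : ℕ → List ℕ} {l : List ℕ} (r : ℕ) :
    rowBlock (l.map fun i : ℕ => ((i : ℤ), g i)) r = if r ∈ l then g r else [] := by
  induction l with
  | nil => rfl
  | cons a l ih =>
    rw [List.map_cons, rowBlock_cons, ih]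
    by_cases har : a = r
    · simp [har]
    · simp [har, Ne.symm har]

/-- Every Coxeter–Knuth class of reduced words contains a non-virtual word with weak descent
composition `egComp`. -/
theorem exists_desComp_eq {ρ : List ℕ} (h : IsReducedWord ρ) :
    ∃ τ, CKEquiv τ ρ ∧ NonVirtual τ ∧ desComp τ = egComp ρ := by
  obtain ⟨N, hN⟩ := (egComp_support_finite ρ).bddAbove
  obtain ⟨g, hg, hi, e, hA⟩ := exists_factorization h
    (α := fun i r => if i ≤ r then egComp ρ r else 0) (N := N + 1)
    (by simp) (keyStrip_restrict _) (fun i r hir => by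
      split_ifs with h1
      · by_contra hne
        have : r ≤ N := hN hne
        omega
      · rfl)
  have hτ := e.symm.isReducedWord h
  have hW := fun i => IsReducedWord.factWordGe hg hτ i
  have hlen : ∀ i, (g i).length = egComp ρ i := fun i => by
    obtain ⟨M, hM, hiM⟩ : ∃ M, (∀ x ∈ factWordGe g i, x < M) ∧ i < M := by
      obtain ⟨M, hM⟩ := (factWordGe g i).toFinset.finite_toSet.bddAbove
      refine ⟨max M i + 1, fun x hx => ?_, by omega⟩
      have : x ≤ M := hM (by simpa using hx)
      omega
    have h1 := sum_egComp (hW i) hM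
    have h2 := sum_egComp (hW (i + 1)) (N := M) fun x hx => hM x (by
      rw [factWordGe_succ hg]
      exact List.mem_append_left _ hx)
    have h3 : ∀ r, egComp (factWordGe g i) r =
        egComp (factWordGe g (i + 1)) r + if r = i then egComp ρ i else 0 := fun r => by
      rw [hA, hA]
      dsimp only
      rcases Nat.lt_trichotomy r i with hr | rfl | hr
      · rw [if_neg (by omega), if_neg (by omega), if_neg (by omega)]
      · rw [if_pos le_rfl, if_neg (by omega), if_pos rfl, zero_add]
      · rw [if_pos (by omega), if_pos (by omega), if_neg (by omega), add_zero]
    rw [Finset.sum_congr rfl fun r _ => h3 r, Finset.sum_add_distrib, h2, Finset.sum_ite_eq' _ i,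
      if_pos (Finset.mem_range.2 hiM), factWordGe_succ hg i, List.length_append] at h1
    omega
  have hge : ∀ i, ∀ x ∈ factWordGe g i, i ≤ x := fun i =>
    (forall_le_iff_egComp (hW i) i).2 fun r hr => by
      rw [hA]
      exact if_neg (by omega)
  have hhead : ∀ i, g i ≠ [] → (g i).headI = i := fun i hne => by
    refine le_antisymm ?_ ?_
    · have hx : ¬ ∀ x ∈ factWordGe g i, i + 1 ≤ x := fun hall => by
        have := (forall_le_iff_egComp (hW i) (i + 1)).1 hall i (Nat.lt_succ_self i)
        rw [hA] at this
        dsimp only at this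
        rw [if_pos le_rfl, ← hlen, List.length_eq_zero_iff] at this
        exact hne this
      push Not at hx
      obtain ⟨x, hx, hlt⟩ := hx
      rw [factWordGe_succ hg, List.mem_append] at hx
      rcases hx with hx | hx
      · have := hge (i + 1) x hx
        omega
      · exact (headI_le_of_mem (hi i) hx).trans (by omega)
    · refine hge i _ ?_
      rw [factWordGe_succ hg]
      refine List.mem_append_right _ ?_
      cases hgi : g i with
      | nil => exact absurd hgi hne
      | cons a b => exact List.mem_cons_self
  have h0 : g 0 = [] := by
    rw [← List.length_eq_zero_iff, hlen, egComp_zero h]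
  set l := (List.range (topIdx g + 1)).reverse.filter fun i => decide (g i ≠ []) with hl
  have hmem : ∀ i, i ∈ l ↔ g i ≠ [] := fun i => by
    rw [hl, List.mem_filter, List.mem_reverse, List.mem_range, decide_eq_true_eq,
      and_iff_right_iff_imp]
    intro hne
    by_contra hlt
    exact hne (eq_nil_of_topIdx_lt hg (by omega))
  have hlp : l.Pairwise (· > ·) := by
    refine List.Pairwise.filter _ ?_
    rw [List.pairwise_reverse]
    exact List.pairwise_lt_range
  have hflat : (l.map g).flatten = factWord g := by
    have key : ∀ m : List ℕ, ((m.filter fun i => decide (g i ≠ [])).map g).flatten =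
        (m.map g).foldr (· ++ ·) [] := fun m => by
      induction m with
      | nil => rfl
      | cons a m ih =>
        rw [List.map_cons, List.foldr_cons, ← ih, List.filter_cons]
        by_cases ha : g a = []
        · rw [if_neg (by simpa using ha), ha, List.nil_append]
        · rw [if_pos (by simpa using ha), List.map_cons, List.flatten_cons]
    rw [hl, key, factWord, factWordGe, List.filter_eq_self.2 fun a _ => by simp]
  have hd : (l.map g).Pairwise fun b b' => b'.headI < b.headI := by
    rw [List.pairwise_map]
    refine hlp.imp_of_mem fun {a b} ha hb hab => ?_
    rw [hhead a ((hmem a).1 ha), hhead b ((hmem b).1 hb)]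
    exact hab
  have hrun : runFact (factWord g) = l.map g := by
    rw [← hflat]
    refine runFact_eq (fun b hb => ?_) hd
    obtain ⟨i, hil, rfl⟩ := List.mem_map.1 hb
    exact ⟨(hmem i).1 hil, hi i⟩
  have hrows : wdtRows (runFact (factWord g)) = l.map fun i : ℕ => (i : ℤ) := by
    rw [hrun, wdtRows_eq hd, List.map_map]
    refine List.map_congr_left fun i hil => ?_
    rw [Function.comp_apply, hhead i ((hmem i).1 hil)]
  refine ⟨factWord g, e, fun r hr => ?_, funext fun r => ?_⟩
  · rw [hrows] at hr
    obtain ⟨i, hil, rfl⟩ := List.mem_map.1 hr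
    have : i ≠ 0 := by
      rintro rfl
      exact (hmem 0).1 hil h0
    omega
  · rw [← hlen]
    refine desComp_eq_length (fun x hx => ?_) fun c => ?_
    · have := hτ.1 x (mem_factWordGe_of_mem hg (Nat.zero_le r) hx)
      omega
    · rw [weakDesTab_eq, hrows, hrun, List.zip_map', rowBlock_map]
      by_cases hr : g r = []
      · simp [hr]
      · rw [if_pos ((hmem r).2 hr)]

theorem compLE.antisymm {μ ν : ℕ → ℕ} (h : compLE μ ν) (h' : compLE ν μ) (h0 : μ 0 = ν 0) :
    μ = ν := by
  have he : ∀ k, ∑ i ∈ Finset.Icc 1 k, μ i = ∑ i ∈ Finset.Icc 1 k, ν i := fun k =>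
    le_antisymm (h k) (h' k)
  funext k
  rcases k with _ | k
  · exact h0
  · have h1 := he (k + 1)
    rw [Finset.sum_Icc_succ_top (by omega), Finset.sum_Icc_succ_top (by omega), he k] at h1
    omega

theorem desComp_zero {σ : List ℕ} (hv : NonVirtual σ) : desComp σ 0 = 0 := by
  rw [desComp, shapeOf]
  simp [hv.weakDesTab_eq_zero]

theorem NonVirtual.compLE_desComp {σ : List ℕ} (h : IsReducedWord σ) (hv : NonVirtual σ) :
    compLE (egComp σ) (desComp σ) := fun k => by
  obtain ⟨g, hg, hi, h0, hm, hσ, hw⟩ := hv.exists_factorization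
  refine (egComp_dominance h hg h0 hm hσ k).1.trans_eq (Finset.sum_congr rfl fun r _ => ?_)
  refine (desComp_eq_length (fun x hx => ?_) (hw r)).symm
  have := h.1 x (hσ ▸ mem_factWordGe_of_mem hg (Nat.zero_le r) hx)
  omega

theorem NonVirtual.eq_of_desComp_eq {σ τ : List ℕ} (h : IsReducedWord σ) (e : CKEquiv σ τ)
    (hv : NonVirtual σ) (hv' : NonVirtual τ) (hd : desComp σ = egComp σ)
    (hd' : desComp τ = egComp σ) : σ = τ := by
  have h' := e.isReducedWord h
  have hE := e.egComp_eq h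
  have key : ∀ σ : List ℕ, IsReducedWord σ → NonVirtual σ → desComp σ = egComp σ →
      ∃ g : ℕ → List ℕ, {i | g i ≠ []}.Finite ∧ (∀ i, (g i).Pairwise (· < ·)) ∧ factWord g = σ ∧
        ∀ i r, egComp (factWordGe g i) r = if i ≤ r then egComp σ r else 0 := fun σ h hv hd => by
    obtain ⟨g, hg, hi, h0, hm, hσ, hw⟩ := hv.exists_factorization
    refine ⟨g, hg, hi, hσ, fun i => ?_⟩
    rcases i with _ | i
    · intro r
      rw [← factWord, hσ, if_pos (Nat.zero_le r)]
    · refine (egComp_dominance h hg h0 hm hσ i).2 (Finset.sum_congr rfl fun r _ => ?_)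
      rw [← hd]
      refine desComp_eq_length (fun x hx => ?_) (hw r)
      have := h.1 x (hσ ▸ mem_factWordGe_of_mem hg (Nat.zero_le r) hx)
      omega
  obtain ⟨g, hg, hi, hσ, hA⟩ := key σ h hv hd
  obtain ⟨g', hg', hi', hσ', hA'⟩ := key τ h' hv' (hd'.trans hE)
  rw [← hσ, ← hσ'] at e ⊢
  rw [factorization_unique hg hg' hi hi' (hσ ▸ h) e fun i => funext fun r => by
    rw [hA, hA', hE]]

theorem Yamanouchi.desComp_eq {σ : List ℕ} (hY : Yamanouchi σ) : desComp σ = egComp σ := by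
  obtain ⟨h, hv, hmin⟩ := hY
  obtain ⟨τ, e, hv', hd⟩ := exists_desComp_eq h
  refine compLE.antisymm ?_ (hv.compLE_desComp h) ?_
  · rw [← hd]
    exact hmin τ hv' e.symm
  · rw [desComp_zero hv, egComp_zero h]

theorem Yamanouchi.unique {σ τ : List ℕ} (hσ : Yamanouchi σ) (hτ : Yamanouchi τ)
    (e : CKEquiv σ τ) : σ = τ :=
  hσ.2.1.eq_of_desComp_eq hσ.1 e hτ.2.1 hσ.desComp_eq
    (by rw [hτ.desComp_eq, e.egComp_eq hσ.1])

theorem exists_yamanouchi {ρ : List ℕ} (h : IsReducedWord ρ) :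
    ∃ σ, Yamanouchi σ ∧ CKEquiv ρ σ := by
  obtain ⟨τ, e, hv, hd⟩ := exists_desComp_eq h
  have hr := e.symm.isReducedWord h
  refine ⟨τ, ⟨hr, hv, fun σ hσ e' => ?_⟩, e.symm⟩
  rw [hd, ← e.egComp_eq hr, e'.egComp_eq hr]
  exact hσ.compLE_desComp (e'.isReducedWord hr)

theorem hatRho_spec {ρ : List ℕ} (h : IsReducedWord ρ) :
    Yamanouchi (hatRho ρ) ∧ CKEquiv ρ (hatRho ρ) := by
  rw [hatRho, dif_pos (exists_yamanouchi h)]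
  exact (exists_yamanouchi h).choose_spec

theorem hatRho_eq {ρ σ : List ℕ} (h : IsReducedWord ρ) (hσ : Yamanouchi σ) (e : CKEquiv ρ σ) :
    hatRho ρ = σ :=
  (hatRho_spec h).1.unique hσ ((hatRho_spec h).2.symm.trans e)

theorem desComp_hatRho {ρ : List ℕ} (h : IsReducedWord ρ) : desComp (hatRho ρ) = egComp ρ := by
  rw [(hatRho_spec h).1.desComp_eq, (hatRho_spec h).2.egComp_eq h]

theorem hatP_eq_zero {ρ : List ℕ} (h : IsReducedWord ρ) {r : ℤ} (hr : r ≤ 0) (c : ℕ) :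
    hatP ρ r c = 0 :=
  (hatRho_spec h).1.2.1.weakDesTab_eq_zero hr c

theorem hatP_ne_zero_iff {ρ : List ℕ} (h : IsReducedWord ρ) (r c : ℕ) :
    hatP ρ r c ≠ 0 ↔ 1 ≤ c ∧ c ≤ egComp ρ r := by
  obtain ⟨⟨hr, hv, -⟩, -⟩ := hatRho_spec h
  obtain ⟨g, hg, hi, h0, hm, hσ, hw⟩ := hv.exists_factorization
  have hpos : ∀ x ∈ g r, x ≠ 0 := fun x hx => by
    have := hr.1 x (hσ ▸ mem_factWordGe_of_mem hg (Nat.zero_le r) hx)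
    omega
  rw [hatP, hw, setOf_getD_ne_zero hpos, ← desComp_hatRho h, desComp_eq_length hpos (hw r)]

/-- The entries of `T` are recorded by the nested compositions `A 1, A 2, …`: the boxes of row `r`
with entry at least `i` are those in the first `A i r` columns. -/
structure HasLevels (T : Tableau) (A : ℕ → ℕ → ℕ) : Prop where
  nonpos : ∀ (r : ℤ) (c : ℕ), r ≤ 0 → T r c = 0
  col_zero : ∀ r : ℤ, T r 0 = 0
  le_iff : ∀ i r c : ℕ, 1 ≤ i → 1 ≤ c → (i ≤ T r c ↔ c ≤ A i r)

theorem HasLevels.ext {T T' : Tableau} {A : ℕ → ℕ → ℕ} (h : HasLevels T A)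
    (h' : HasLevels T' A) : T = T' := by
  funext r c
  rcases Nat.eq_zero_or_pos c with rfl | hc
  · rw [h.col_zero, h'.col_zero]
  rcases le_or_gt r 0 with hr | hr
  · rw [h.nonpos r c hr, h'.nonpos r c hr]
  lift r to ℕ using hr.le
  have key : ∀ i, 1 ≤ i → (i ≤ T r c ↔ i ≤ T' r c) := fun i hi =>
    (h.le_iff i r c hi hc).trans (h'.le_iff i r c hi hc).symm
  refine le_antisymm ?_ ?_
  · rcases Nat.eq_zero_or_pos (T r c) with h0 | h0
    · omega
    · exact (key _ h0).1 le_rfl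
  · rcases Nat.eq_zero_or_pos (T' r c) with h0 | h0
    · omega
    · exact (key _ h0).2 le_rfl

theorem HasLevels.eq {T : Tableau} {A A' : ℕ → ℕ → ℕ} (h : HasLevels T A)
    (h' : HasLevels T A') {i : ℕ} (hi : 1 ≤ i) : A i = A' i := by
  funext r
  have key : ∀ c, 1 ≤ c → (c ≤ A i r ↔ c ≤ A' i r) := fun c hc =>
    (h.le_iff i r c hi hc).symm.trans (h'.le_iff i r c hi hc)
  refine le_antisymm ?_ ?_
  · rcases Nat.eq_zero_or_pos (A i r) with h0 | h0
    · omega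
    · exact (key _ h0).1 le_rfl
  · rcases Nat.eq_zero_or_pos (A' i r) with h0 | h0
    · omega
    · exact (key _ h0).2 le_rfl

theorem HasLevels.shapeOf_eq {T : Tableau} {A : ℕ → ℕ → ℕ} (h : HasLevels T A) :
    shapeOf T = A 1 := by
  funext r
  rw [shapeOf, ← ncard_setOf_one_le (A 1 r)]
  congr 1
  ext c
  rcases Nat.eq_zero_or_pos c with rfl | hc
  · simp [h.col_zero]
  · simp only [Set.mem_ofPred_eq]
    rw [← Nat.one_le_iff_ne_zero, h.le_iff 1 r c le_rfl hc]
    exact ⟨fun hle => ⟨hc, hle⟩, fun hle => hle.2⟩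

theorem HasLevels.isKeyTableau {T : Tableau} {A : ℕ → ℕ → ℕ} (h : HasLevels T A)
    (hA : ∀ i, 1 ≤ i → KeyStrip (A (i + 1)) (A i)) (hfin : {r | A 1 r ≠ 0}.Finite) :
    IsKeyTableau T := by
  have hpos : ∀ (r : ℤ) (c : ℕ), T r c ≠ 0 → 1 ≤ c ∧ ∃ n : ℕ, r = n := fun r c hne => by
    refine ⟨Nat.one_le_iff_ne_zero.2 fun hc => hne ?_, ?_⟩
    · rw [hc, h.col_zero]
    · have : 0 ≤ r := by
        by_contra hr
        exact hne (h.nonpos r c (by omega))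
      exact ⟨r.toNat, by omega⟩
  have hstep : ∀ (r : ℤ) (c : ℕ), 1 ≤ c → T r (c + 1) ≤ T r c := fun r c hc => by
    by_cases hne : T r (c + 1) = 0
    · omega
    · obtain ⟨-, n, rfl⟩ := hpos r _ hne
      have hi := Nat.one_le_iff_ne_zero.2 hne
      have := (h.le_iff _ n (c + 1) hi (by omega)).1 le_rfl
      exact (h.le_iff _ n c hi hc).2 (by omega)
  have hlev : ∀ (n c : ℕ), 1 ≤ c → T n c ≠ 0 →
      A (T n c + 1) n ≤ c - 1 ∧ c - 1 < A (T n c) n := fun n c hc hne => by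
    have h1 := (h.le_iff _ n c (Nat.one_le_iff_ne_zero.2 hne) hc).1 le_rfl
    have h2 := mt (h.le_iff (T n c + 1) n c (by omega) hc).2 (by omega)
    omega
  refine ⟨h.nonpos, h.col_zero, ?_, fun r c hc hne hz => ?_, fun r c hc _ => hstep r c hc,
    fun r r' c hr hne hne' he => ?_, fun r r' c hr hne hne' hlt => ?_⟩
  · obtain ⟨R, hR⟩ := hfin.bddAbove
    refine (((Finset.range (R + 1)).biUnion fun r =>
      (Finset.range (A 1 r + 1)).image fun c => ((r : ℤ), c)).finite_toSet).subset ?_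
    rintro ⟨r, c⟩ hne
    obtain ⟨hc, n, rfl⟩ := hpos r c hne
    have hle := (h.le_iff 1 n c le_rfl hc).1 (Nat.one_le_iff_ne_zero.2 hne)
    have hn : n ≤ R := hR (show A 1 n ≠ 0 by omega)
    simp only [Finset.coe_biUnion, Set.mem_iUnion, Finset.mem_coe, Finset.mem_image,
      Finset.mem_range]
    exact ⟨n, by omega, c, by omega, rfl⟩
  · have := hstep r c hc
    omega
  · obtain ⟨hc, n, rfl⟩ := hpos r c hne
    obtain ⟨-, n', rfl⟩ := hpos r' c hne'
    have h1 := hlev n c hc hne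
    have h2 := hlev n' c hc hne'
    rw [← he] at h2
    exact hr (congrArg _ ((hA _ (Nat.one_le_iff_ne_zero.2 hne)).col n n' (c - 1) h1.1 h1.2
      h2.1 h2.2))
  · obtain ⟨hc, n, rfl⟩ := hpos r c hne
    obtain ⟨-, n', rfl⟩ := hpos r' c hne'
    have h2 := hlev n' c hc hne'
    have h3 := (hA _ (Nat.one_le_iff_ne_zero.2 hne')).row n n' (c - 1) (by omega) h2.1 h2.2
    have h4 := (h.le_iff (T n' c + 1) n c (by omega) hc).1 hlt
    have h5 := (h.le_iff (T n' c + 1) n (c + 1) (by omega) (by omega)).2 (by omega)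
    omega

theorem IsKeyTableau.exists_hasLevels {T : Tableau} (hT : IsKeyTableau T) :
    ∃ A, HasLevels T A := by
  obtain ⟨hr, hc0, hfin, hleft, hdec, -, -⟩ := hT
  obtain ⟨C, hC⟩ := (hfin.image Prod.snd).bddAbove
  have hbd : ∀ (r c : ℕ), T r c ≠ 0 → c ≤ C := fun r c hne =>
    hC ⟨((r : ℤ), c), hne, rfl⟩
  have hstep : ∀ (r : ℕ) (c : ℕ), 1 ≤ c → T r (c + 1) ≤ T r c := fun r c hc => by
    by_cases hne : T r (c + 1) = 0
    · omega
    · exact hdec r c hc hne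
  have hanti : ∀ r c c' : ℕ, 1 ≤ c → c ≤ c' → T r c' ≤ T r c := fun r c c' hc hcc => by
    induction c', hcc using Nat.le_induction with
    | base => exact le_rfl
    | succ c' hcc ih => exact (hstep r c' (hc.trans hcc)).trans ih
  refine ⟨fun i r => Nat.findGreatest (fun c => i ≤ T r c) C, hr, hc0, fun i r c hi hc => ?_⟩
  refine ⟨fun hle => Nat.le_findGreatest (hbd r c (by omega)) hle, fun hle => ?_⟩
  exact (Nat.findGreatest_of_ne_zero (P := fun c => i ≤ T r c) rfl (by omega)).trans
    (hanti r c _ hc hle)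

theorem HasLevels.keyStrip {T : Tableau} {A : ℕ → ℕ → ℕ} (h : HasLevels T A)
    (hT : IsKeyTableau T) {i : ℕ} (hi : 1 ≤ i) : KeyStrip (A (i + 1)) (A i) := by
  obtain ⟨-, -, -, -, -, hcol, hrow⟩ := hT
  have hbox : ∀ r c, A (i + 1) r ≤ c → c < A i r → T r (c + 1) = i := fun r c h1 h2 => by
    have h3 := (h.le_iff i r (c + 1) hi (by omega)).2 h2
    have h4 := mt (h.le_iff (i + 1) r (c + 1) (by omega) (by omega)).1 (by omega)
    omega
  refine ⟨fun r => ?_, fun r r' c h1 h2 h1' h2' => ?_, fun r r' c hr h1 h2 he => ?_⟩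
  · rcases Nat.eq_zero_or_pos (A (i + 1) r) with h0 | h0
    · omega
    · have := (h.le_iff (i + 1) r _ (by omega) h0).2 le_rfl
      exact (h.le_iff i r _ hi h0).1 (by omega)
  · have hb := hbox r c h1 h2
    have hb' := hbox r' c h1' h2'
    by_contra hne
    exact hcol r r' (c + 1) (by omega) (by omega) (by omega) (hb.trans hb'.symm)
  · have hb := hbox r' c h1 h2
    have hge := (h.le_iff (i + 1) r (c + 1) (by omega) (by omega)).2 he.ge
    have h3 := (hrow r r' (c + 1) (by omega) (by omega) (by omega) (by omega)).2
    have h4 := (h.le_iff (i + 1) r (c + 1 + 1) (by omega) (by omega)).1 (by omega)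
    omega

theorem hasLevels_hatQfact {f : ℕ → List ℕ} (hf : {i | f i ≠ []}.Finite)
    (h : IsReducedWord (factWord f)) :
    HasLevels (hatQfact f) fun i => egComp (factWordGe f i) where
  nonpos r c hr := by
    simp [hatQfact, fun i => hatP_eq_zero (h.factWordGe hf i) hr c]
  col_zero r := by
    have h0 : ∀ i, hatP (factWordGe f i) r 0 = 0 := fun i => by
      simp [hatP, weakDesTab]
    simp [hatQfact, h0]
  le_iff i r c hi hc := by
    have hS : {i : ℕ | 1 ≤ i ∧ hatP (factWordGe f i) r c ≠ 0 ∧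
          hatP (factWordGe f (i + 1)) r c = 0} =
        {i : ℕ | 1 ≤ i ∧ c ≤ egComp (factWordGe f i) r ∧
          ¬ c ≤ egComp (factWordGe f (i + 1)) r} := by
      ext j
      have hj := hatP_ne_zero_iff (h.factWordGe hf j) r c
      have hj' := hatP_ne_zero_iff (h.factWordGe hf (j + 1)) r c
      simp only [Set.mem_ofPred_eq]
      tauto
    have hbd : ∀ j, c ≤ egComp (factWordGe f j) r → j ≤ topIdx f := fun j hj => by
      by_contra hlt
      rw [factWordGe_eq_nil (by omega), egComp_nil] at hj
      simp at hj
      omega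
    rw [hatQfact, hS]
    constructor
    · intro hle
      have hmem := Nat.sSup_mem (s := {i : ℕ | 1 ≤ i ∧ c ≤ egComp (factWordGe f i) r ∧
          ¬ c ≤ egComp (factWordGe f (i + 1)) r}) ?_ ⟨topIdx f, fun j hj => hbd j hj.2.1⟩
      · exact hmem.2.1.trans (egComp_factWordGe_le hf h hle r)
      · by_contra hne
        rw [Set.not_nonempty_iff_eq_empty] at hne
        rw [hne, csSup_empty] at hle
        exact absurd hle (by simpa using Nat.pos_iff_ne_zero.1 hi)
    · intro hle
      set P : ℕ → Prop := fun j => c ≤ egComp (factWordGe f j) r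
      have h1 : i ≤ Nat.findGreatest P (topIdx f) := Nat.le_findGreatest (hbd i hle) hle
      refine h1.trans (le_csSup ⟨topIdx f, fun j hj => hbd j hj.2.1⟩
        ⟨hi.trans h1, ?_, fun hP => ?_⟩)
      · exact Nat.findGreatest_of_ne_zero (P := P) rfl (by omega)
      · have := Nat.le_findGreatest (P := P) (hbd _ hP) hP
        omega

theorem factWordGe_one {f : ℕ → List ℕ} (hf : {i | f i ≠ []}.Finite) (h0 : f 0 = []) :
    factWordGe f 1 = factWord f := by
  rw [factWord, factWordGe_succ hf 0, h0, List.append_nil]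

theorem keyStrip_factWordGe {f : ℕ → List ℕ} (hf : {i | f i ≠ []}.Finite)
    (hi : ∀ i, (f i).Pairwise (· < ·)) (h : IsReducedWord (factWord f)) (i : ℕ) :
    KeyStrip (egComp (factWordGe f (i + 1))) (egComp (factWordGe f i)) := by
  have := h.factWordGe hf i
  rw [factWordGe_succ hf i] at this ⊢
  exact keyStrip_append this (hi i)

/-- A factorization is flagged if and only if its recording tableau is. -/
theorem flaggedTab_hatQfact_iff {f : ℕ → List ℕ} {φ : ℕ → ℕ} (hφ : IsFlag φ)
    (hf : {i | f i ≠ []}.Finite) (hi : ∀ i, (f i).Pairwise (· < ·)) (h0 : f 0 = [])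
    (h : IsReducedWord (factWord f)) : FlaggedTab φ (hatQfact f) ↔ FlaggedFact φ f := by
  have hL := hasLevels_hatQfact hf h
  constructor
  · intro hT i hne
    have hi1 : 1 ≤ i := Nat.one_le_iff_ne_zero.2 fun hz => hne (hz ▸ h0)
    have hk : (f i).headI ∈ factWordGe f i := by
      refine mem_factWordGe_of_mem hf le_rfl ?_
      cases hfi : f i with
      | nil => exact absurd hfi hne
      | cons a b => exact List.mem_cons_self
    obtain ⟨r, hr, hne'⟩ : ∃ r < (f i).headI + 1, egComp (factWordGe f i) r ≠ 0 := by
      by_contra! hall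
      have := (forall_le_iff_egComp (h.factWordGe hf i) _).2 hall _ hk
      omega
    have hr0 : 1 ≤ r := Nat.one_le_iff_ne_zero.2 fun hz =>
      hne' (hz ▸ egComp_zero (h.factWordGe hf i))
    exact ((hL.le_iff i r 1 hi1 le_rfl).2 (Nat.one_le_iff_ne_zero.2 hne')).trans
      ((hT r 1).trans (hφ.1 _ _ hr0 (by omega)))
  · intro hF r c
    rcases Nat.eq_zero_or_pos (hatQfact f r c) with hz | hpos
    · omega
    have hc : 1 ≤ c := Nat.one_le_iff_ne_zero.2 fun hz => by
      rw [hz, hL.col_zero] at hpos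
      omega
    have hle : c ≤ egComp (factWordGe f (hatQfact f r c)) r := (hL.le_iff _ r c hpos hc).1 le_rfl
    obtain ⟨j, hij, hj⟩ := mem_factWordGe hf
      (mem_of_egComp_ne_zero (h.factWordGe hf (hatQfact f r c)) (r := r) (by omega))
    have hne := List.ne_nil_of_mem hj
    have hhead : (f j).headI ∈ factWord f := by
      refine mem_factWordGe_of_mem hf (Nat.zero_le j) ?_
      cases hfj : f j with
      | nil => exact absurd hfj hne
      | cons a b => exact List.mem_cons_self
    exact hij.trans ((hF j hne).trans (hφ.1 _ _ (h.1 _ hhead) (headI_le_of_mem (hi j) hj)))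

noncomputable section

attribute [local instance] Classical.propDecidable

/-- Theorem `flagged bijection`.
Let `w ∈ S∞` and let `φ` be a flag.  The weak Edelman–Greene insertion map
`ρ^• ↦ (P̂(ρ^•), Q̂(ρ^•))` — where `P̂(ρ^•)` is (identified with) the unique Yamanouchi
reduced word Coxeter–Knuth equivalent to the underlying word of `ρ^•` — is a bijection from
`RFC(w, φ)` onto the disjoint union `⊔_α YR_α(w) × SSKT(α, φ)`, over all weak compositions
`α` such that `YR_α(w)` is nonempty. -/
theorem weak_EG_flagged_bijection (w : Equiv.Perm ℕ) (hw : FinitaryPerm w)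
    (φ : ℕ → ℕ) (hφ : IsFlag φ) :
    Set.BijOn (fun f => (hatRho (factWord f), hatQfact f)) (RFCset w φ)
      {p : List ℕ × Tableau |
        IsReducedWordFor w p.1 ∧ Yamanouchi p.1 ∧ p.2 ∈ SSKT (desComp p.1) φ} := by
  refine ⟨?_, ?_, ?_⟩
  · rintro f ⟨h0, hf, hi, hF, h, hwf⟩
    replace hi := fun i => List.isChain_iff_pairwise.1 (hi i)
    have hL := hasLevels_hatQfact hf h
    obtain ⟨hY, e⟩ := hatRho_spec h
    refine ⟨⟨e.isReducedWord h, e.wordPerm_eq ▸ hwf⟩, hY,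
      hL.isKeyTableau (fun i _ => keyStrip_factWordGe hf hi h i) (egComp_support_finite _), ?_,
      (flaggedTab_hatQfact_iff hφ hf hi h0 h).2 hF⟩
    rw [hL.shapeOf_eq, factWordGe_one hf h0]
    exact (desComp_hatRho h).symm
  · rintro f ⟨h0, hf, hi, -, h, -⟩ f' ⟨h0', hf', hi', -, h', -⟩ heq
    obtain ⟨hR, hQ⟩ := Prod.ext_iff.1 heq
    dsimp only at hR hQ
    have hL := hasLevels_hatQfact hf h
    have hL' := hasLevels_hatQfact hf' h'
    rw [← hQ] at hL'
    refine factorization_unique hf hf' (fun i => List.isChain_iff_pairwise.1 (hi i))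
      (fun i => List.isChain_iff_pairwise.1 (hi' i)) h
      ((hatRho_spec h).2.trans (hR ▸ (hatRho_spec h').2.symm)) fun i => ?_
    rcases i with _ | i
    · have := hL.eq hL' le_rfl
      rwa [factWordGe_one hf h0, factWordGe_one hf' h0'] at this
    · exact hL.eq hL' (by omega)
  · rintro ⟨σ, T⟩ ⟨⟨hσ, hwσ⟩, hY, hT, hsh, hfl⟩
    dsimp only at hσ hwσ hY hT hsh hfl
    obtain ⟨A, hL⟩ := hT.exists_hasLevels
    have hA1 : A 1 = egComp σ := by
      rw [← hL.shapeOf_eq, hsh, hY.desComp_eq]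
    obtain ⟨N, hN⟩ := (hT.2.2.1.image fun p => T p.1 p.2).bddAbove
    obtain ⟨f, hf, hi, e, hα⟩ := exists_factorization hσ (α := fun i => A (max i 1)) (N := N + 1)
      hA1 (fun i => by
        rcases i with _ | i
        · exact KeyStrip.refl _
        · simpa using hL.keyStrip hT (Nat.succ_pos i))
      (fun i r hiN => by
        by_contra hne
        have hle := (hL.le_iff (max i 1) r 1 (le_max_right _ _) le_rfl).2
          (Nat.one_le_iff_ne_zero.2 hne)
        have : T r 1 ≤ N := hN ⟨((r : ℤ), 1), show T r 1 ≠ 0 by omega, rfl⟩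
        omega)
    have h := e.symm.isReducedWord hσ
    have h0 : f 0 = [] := by
      have hlen := length_eq_of_egComp (h.factWordGe hf 0) (h.factWordGe hf 1)
        ((hα 0).trans (hα 1).symm)
      rw [factWordGe_succ hf 0, List.length_append] at hlen
      exact List.length_eq_zero_iff.1 (by simpa using hlen)
    have hQL := hasLevels_hatQfact hf h
    have hQ : hatQfact f = T := by
      refine hQL.ext ⟨hL.nonpos, hL.col_zero, fun i r c hi1 hc => ?_⟩
      rw [hα, hL.le_iff i r c hi1 hc, max_eq_left hi1]
    refine ⟨f, ⟨h0, hf, fun i => List.isChain_iff_pairwise.2 (hi i),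
      (flaggedTab_hatQfact_iff hφ hf hi h0 h).1 (hQ ▸ hfl), h, e.wordPerm_eq.trans hwσ⟩, ?_⟩
    exact Prod.ext (hatRho_eq h hY e) hQ

end
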